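/- Let t ∈ ℝ/ℤ be Diophantine. Then for every a ∈ Diff^∞(ℝ/ℤ) with rotation number ρ(a) = t, there exists a unique c ∈ Diff^∞(ℝ/ℤ) such that c(0) = 0 and c ∘ a ∘ c⁻¹ is the rotation R_t. Moreover c depends continuously on a: if a_m ∈ Diff^∞(ℝ/ℤ) with ρ(a_m) = t satisfy ‖a_m − a‖_{C^k} → 0 for every k ∈ ℕ, then the corresponding conjugacies c_m satisfy ‖c_m − c‖_{C^k} → 0 for every k ∈ ℕ. -/

import Mathlib

open Filter Topology Set

noncomputable section

/-- The circle ℝ/ℤ. -/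
abbrev S1 := AddCircle (1 : ℝ)

/-- `F : ℝ → ℝ` is a lift of the circle map `f`: it is C^∞, commutes with the unit
translation, has everywhere positive derivative, and descends to `f` on ℝ/ℤ. -/
def IsLift (f : Equiv.Perm S1) (F : ℝ → ℝ) : Prop :=
  ContDiff ℝ (⊤ : ℕ∞) F ∧ (∀ x, F (x + 1) = F x + 1) ∧ (∀ x, 0 < deriv F x) ∧
    ∀ x : ℝ, f (x : S1) = ((F x : ℝ) : S1)

/-- `f` is an orientation preserving C^∞ diffeomorphism of ℝ/ℤ. -/
def HasLift (f : Equiv.Perm S1) : Prop := ∃ F, IsLift f F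

/-- max over 0 ≤ j ≤ k of sup over x of |F^(j)(x) - G^(j)(x)|. -/
noncomputable def liftDist (k : ℕ) (F G : ℝ → ℝ) : ℝ :=
  ⨆ j : Fin (k + 1), ⨆ x : ℝ, |iteratedDeriv (j : ℕ) F x - iteratedDeriv (j : ℕ) G x|

/-- The C^k distance between two smooth circle diffeomorphisms: infimum over lifts. -/
noncomputable def distC (k : ℕ) (f g : Equiv.Perm S1) : ℝ :=
  sInf {d | ∃ F G, IsLift f F ∧ IsLift g G ∧ d = liftDist k F G}

/-- `f` is recurrent: for every k and ε > 0 there are arbitrarily large n ≥ 1 with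
‖f^n − id‖_{C^k} < ε. -/
def Recurrent (f : Equiv.Perm S1) : Prop :=
  ∀ k : ℕ, ∀ ε : ℝ, 0 < ε → ∀ N : ℕ, ∃ n : ℕ, N ≤ n ∧ 1 ≤ n ∧ distC k (f ^ n) 1 < ε

/-- The word length of `g` with respect to the generating set `S`: the least `k` such that
`g` is a product of `k` elements of `S ∪ S⁻¹`. -/
noncomputable def wordLength (S : Set (Equiv.Perm S1)) (g : Equiv.Perm S1) : ℕ :=
  sInf {k | ∃ l : List (Equiv.Perm S1),
    l.length = k ∧ (∀ x ∈ l, x ∈ S ∨ x⁻¹ ∈ S) ∧ l.prod = g}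

/-- The rotation by `t` on ℝ/ℤ, `x ↦ x + t`. -/
def rot (t : S1) : Equiv.Perm S1 := Equiv.addRight t

/-- `f` is a distortion element of Diff^∞(ℝ/ℤ). -/
def IsDistortion (f : Equiv.Perm S1) : Prop :=
  ∃ S : Finset (Equiv.Perm S1), (∀ g ∈ S, HasLift g) ∧
    f ∈ Subgroup.closure (S : Set (Equiv.Perm S1)) ∧
    Tendsto (fun n : ℕ => (wordLength (S : Set (Equiv.Perm S1)) (f ^ n) : ℝ) / n)
      atTop (nhds 0)

/-- The open arc in ℝ/ℤ which is the image of the interval `(a,b)`. -/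
def arcOO (a b : ℝ) : Set S1 := (fun x : ℝ => (x : S1)) '' Set.Ioo a b

/-- The closed arc in ℝ/ℤ which is the image of the interval `[a,b]`. -/
def arcCC (a b : ℝ) : Set S1 := (fun x : ℝ => (x : S1)) '' Set.Icc a b

/-- `f` is supported on `U`: it is the identity outside `U`. -/
def SupportedOn (f : Equiv.Perm S1) (U : Set S1) : Prop := ∀ x : S1, x ∉ U → f x = x

/-- `f` has rotation number `t ∈ ℝ/ℤ`. -/
def HasRotNum (f : Equiv.Perm S1) (t : S1) : Prop :=
  ∃ F : ℝ → ℝ, ∃ τ : ℝ, IsLift f F ∧ ((τ : ℝ) : S1) = t ∧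
    Tendsto (fun n : ℕ => F^[n] 0 / n) atTop (nhds τ)

/-- A real number is Diophantine. -/
def DiophantineReal (t : ℝ) : Prop :=
  ∃ C : ℝ, 0 < C ∧ ∃ n : ℕ, 0 < n ∧ ∀ p q : ℤ, q ≠ 0 →
    C / |(q : ℝ)| ^ n < |(q : ℝ) * t - (p : ℝ)|

/-- An element of ℝ/ℤ is Diophantine if some (equivalently, every) lift is. -/
def Diophantine (t : S1) : Prop := ∃ τ : ℝ, (τ : S1) = t ∧ DiophantineReal τ


namespace HY
open scoped ContDiff

abbrev Sm (f : ℝ → ℝ) : Prop := ContDiff ℝ ∞ f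

theorem Sm.at {f : ℝ → ℝ} (h : Sm f) (n : ℕ) (x : ℝ) : ContDiffAt ℝ n f x :=
  (h.of_le (by exact_mod_cast le_top)).contDiffAt

theorem Sm.diff {f : ℝ → ℝ} (h : Sm f) : Differentiable ℝ f := h.differentiable (by simp)

theorem Sm.deriv {f : ℝ → ℝ} (h : Sm f) : Sm (deriv f) := by
  have := (contDiff_infty_iff_deriv (f := f)).1 h
  exact this.2

theorem Sm.iter {f : ℝ → ℝ} (h : Sm f) : ∀ n : ℕ, Sm (iteratedDeriv n f)
  | 0 => by simpa using h
  | n+1 => by rw [iteratedDeriv_succ]; exact (Sm.iter h n).deriv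

theorem Sm.hd {f : ℝ → ℝ} (h : Sm f) (x : ℝ) : HasDerivAt f (_root_.deriv f x) x :=
  (h.diff x).hasDerivAt

/-- mean value estimate -/
theorem mvt {u : ℝ → ℝ} (hu : Sm u) {a b M : ℝ} (h : ∀ y ∈ uIcc a b, |deriv u y| ≤ M) :
    |u b - u a| ≤ M * |b - a| := by
  have := (convex_uIcc a b).norm_image_sub_le_of_norm_deriv_le (f := u) (C := M)
    (fun x _ => hu.diff x) (fun x hx => by simpa using h x hx) (left_mem_uIcc) (right_mem_uIcc)
  simpa using this

theorem mvt_eq {u : ℝ → ℝ} (hu : Sm u) (a b : ℝ) :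
    ∃ ξ ∈ uIcc a b, u b - u a = deriv u ξ * (b - a) := by
  rcases lt_trichotomy a b with h | h | h
  · obtain ⟨c, hc, h2⟩ := exists_deriv_eq_slope u h hu.continuous.continuousOn hu.diff.differentiableOn
    refine ⟨c, ?_, ?_⟩
    · rw [uIcc_of_le h.le]; exact Ioo_subset_Icc_self hc
    · rw [h2]; field_simp [(sub_pos.2 h).ne']
  · subst h; exact ⟨a, by simp, by simp⟩
  · obtain ⟨c, hc, h2⟩ := exists_deriv_eq_slope u h hu.continuous.continuousOn hu.diff.differentiableOn
    refine ⟨c, ?_, ?_⟩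
    · rw [uIcc_of_ge h.le]; exact Ioo_subset_Icc_self hc
    · rw [h2]; have := (sub_pos.2 h).ne'; field_simp; ring

theorem lk_exists : ∀ K : ℕ, ∃ C : ℝ, 0 ≤ C ∧ ∀ (u : ℝ → ℝ) (x T A : ℝ), Sm u → 0 < T →
    (∀ y ∈ Icc x (x+T), |u y| ≤ A) →
    ∃ ξ ∈ Icc x (x+T), |iteratedDeriv K u ξ| ≤ C * (A / T^K) := by
  intro K
  induction K with
  | zero =>
    refine ⟨1, by norm_num, fun u x T A hu hT h => ⟨x, ⟨le_rfl, by linarith⟩, ?_⟩⟩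
    simpa using h x ⟨le_rfl, by linarith⟩
  | succ K ih =>
    obtain ⟨C, hC, ih⟩ := ih
    refine ⟨2 * 3^(K+1) * C, by positivity, fun u x T A hu hT h => ?_⟩
    obtain ⟨a, ha, ha2⟩ := ih u x (T/3) A hu (by positivity)
      (fun y hy => h y ⟨hy.1, by linarith [hy.2]⟩)
    obtain ⟨b, hb, hb2⟩ := ih u (x+2*T/3) (T/3) A hu (by positivity)
      (fun y hy => h y ⟨by linarith [hy.1], by linarith [hy.2]⟩)
    have hab : T/3 ≤ b - a := by linarith [ha.2, hb.1]
    obtain ⟨ξ, hξ, h2⟩ := mvt_eq (hu.iter K) a b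
    rw [uIcc_of_le (by linarith)] at hξ
    refine ⟨ξ, ⟨by linarith [ha.1, hξ.1], by linarith [hb.2, hξ.2]⟩, ?_⟩
    rw [iteratedDeriv_succ]
    have h3 : |deriv (iteratedDeriv K u) ξ| * (T/3) ≤ 2 * (C * (A / (T/3)^K)) := by
      calc |deriv (iteratedDeriv K u) ξ| * (T/3) ≤ |deriv (iteratedDeriv K u) ξ| * |b - a| := by
            gcongr; exact hab.trans (le_abs_self _)
        _ = |iteratedDeriv K u b - iteratedDeriv K u a| := by rw [h2, abs_mul]
        _ ≤ _ := by
            have := abs_sub (iteratedDeriv K u b) (iteratedDeriv K u a)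
            linarith
    have h4 : 2 * 3^(K+1) * C * (A / T^(K+1)) = 2 * (C * (A / (T/3)^K)) / (T/3) := by
      rw [div_pow]; field_simp; ring
    rw [h4, le_div_iff₀ (by positivity)]; exact h3

theorem lk (m : ℕ) : ∀ j : ℕ, ∃ C : ℝ, 0 ≤ C ∧ ∀ (u : ℝ → ℝ) (x T A B : ℝ), Sm u → 0 < T →
    (∀ y ∈ Icc x (x+T), |u y| ≤ A) → (∀ y ∈ Icc x (x+T), |iteratedDeriv (j+m) u y| ≤ B) →
    ∀ y ∈ Icc x (x+T), |iteratedDeriv j u y| ≤ C * (A / T^j + B * T^m) := by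
  induction m with
  | zero =>
    refine fun j => ⟨1, by norm_num, fun u x T A B hu hT h h2 y hy => ?_⟩
    have hA : 0 ≤ A := (abs_nonneg _).trans (h y hy)
    have := h2 y hy
    have : 0 ≤ A / T^j := by positivity
    simp only [add_zero] at *; simp; linarith
  | succ m ih =>
    intro j
    obtain ⟨C, hC, ih⟩ := ih (j+1)
    obtain ⟨C2, hC2, hx⟩ := lk_exists j
    refine ⟨C2 + C, by positivity, fun u x T A B hu hT h h2 y hy => ?_⟩
    have hA : 0 ≤ A := (abs_nonneg _).trans (h y hy)
    have hB : 0 ≤ B := (abs_nonneg _).trans (h2 y hy)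
    have h3 := ih u x T A B hu hT h (by intro y hy; have := h2 y hy; rwa [add_right_comm, add_assoc])
    obtain ⟨ξ, hξ, h4⟩ := hx u x T A hu hT h
    have h5 : |iteratedDeriv j u y - iteratedDeriv j u ξ| ≤ C * (A / T^(j+1) + B * T^m) * |y - ξ| := by
      apply mvt (hu.iter j)
      intro z hz
      rw [← iteratedDeriv_succ]
      exact h3 z (ordConnected_Icc.uIcc_subset hξ hy hz)
    have h6 : |y - ξ| ≤ T := by rw [abs_le]; constructor <;> linarith [hy.1, hy.2, hξ.1, hξ.2]
    have h7 : C * (A / T^(j+1) + B * T^m) * |y - ξ| ≤ C * (A / T^(j+1) + B * T^m) * T := by gcongr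
    have h8 : C * (A / T^(j+1) + B * T^m) * T = C * (A / T^j + B * T^(m+1)) := by
      field_simp; try ring
    have h9 := abs_sub_abs_le_abs_sub (iteratedDeriv j u y) (iteratedDeriv j u ξ)
    have h10 : C2 * (A/T^j) ≤ C2 * (A / T^j + B * T^(m+1)) := by
      gcongr; linarith [show 0 ≤ B * T^(m+1) by positivity]
    rw [add_mul]; linarith

/-- pointwise bounds of derivatives -/
def BD (u : ℝ → ℝ) (x : ℝ) (n : ℕ) (c l : ℝ) : Prop :=
  ∀ j ≤ n, |iteratedDeriv j u x| ≤ c * l^j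

theorem BD.nonneg {u x n c l} (h : BD u x n c l) : 0 ≤ c := by
  simpa using (abs_nonneg _).trans (h 0 (Nat.zero_le _))

theorem BD.mono {u x n c l d m} (h : BD u x n c l) (hl : 0 ≤ l) (hc : c ≤ d) (hm : m ≤ n) :
    BD u x m d l := fun j hj => (h j (hj.trans hm)).trans (by gcongr)

theorem BD.add {u v x n c d l} (h : BD u x n c l) (h2 : BD v x n d l) (hu : Sm u) (hv : Sm v) :
    BD (fun y => u y + v y) x n (c + d) l := by
  intro j hj
  have : iteratedDeriv j (fun y => u y + v y) x = iteratedDeriv j u x + iteratedDeriv j v x :=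
    iteratedDeriv_add (hu.at j x) (hv.at j x)
  rw [this, add_mul]
  exact (abs_add_le _ _).trans (add_le_add (h j hj) (h2 j hj))

theorem BD.const_mul {u x n c l} (h : BD u x n c l) (k : ℝ) (hk : 0 ≤ k) :
    BD (fun y => k * u y) x n (k * c) l := by
  intro j hj
  rw [iteratedDeriv_const_mul_field, abs_mul, abs_of_nonneg hk, mul_assoc]
  exact mul_le_mul_of_nonneg_left (h j hj) hk

theorem BD.sum {ι : Type*} {s : Finset ι} {u : ι → ℝ → ℝ} {x n l} {c : ι → ℝ}
    (h : ∀ i ∈ s, BD (u i) x n (c i) l) (hu : ∀ i ∈ s, Sm (u i)) :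
    BD (fun y => ∑ i ∈ s, u i y) x n (∑ i ∈ s, c i) l := by
  intro j hj
  rw [iteratedDeriv_fun_sum (fun i hi => (hu i hi).at j x), Finset.sum_mul]
  exact (Finset.abs_sum_le_sum_abs _ _).trans (Finset.sum_le_sum fun i hi => h i hi j hj)

theorem BD.mul {u v x n c d l} (h : BD u x n c l) (h2 : BD v x n d l) (hu : Sm u) (hv : Sm v)
    (hl : 0 ≤ l) : BD (fun y => u y * v y) x n (2^n * c * d) l := by
  intro j hj
  have hc := h.nonneg
  have hd := h2.nonneg
  have : iteratedDeriv j (fun y => u y * v y) x = _ := iteratedDeriv_mul (hu.at j x) (hv.at j x)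
  rw [this]
  calc _ ≤ ∑ i ∈ Finset.range (j+1), |(j.choose i : ℝ) * iteratedDeriv i u x * iteratedDeriv (j - i) v x| :=
        Finset.abs_sum_le_sum_abs _ _
    _ ≤ ∑ i ∈ Finset.range (j+1), (j.choose i : ℝ) * (c * d * l^j) := by
        apply Finset.sum_le_sum
        intro i hi
        have hi' : i ≤ j := Nat.lt_succ_iff.1 (Finset.mem_range.1 hi)
        rw [abs_mul, abs_mul, Nat.abs_cast, mul_assoc]
        apply mul_le_mul_of_nonneg_left _ (by positivity)
        calc _ ≤ (c * l^i) * (d * l^(j-i)) :=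
              mul_le_mul (h i (hi'.trans hj)) (h2 _ ((Nat.sub_le _ _).trans hj)) (abs_nonneg _) (by positivity)
          _ = c * d * (l^i * l^(j-i)) := by ring
          _ = _ := by rw [← pow_add, Nat.add_sub_cancel' hi']
    _ = 2^j * c * d * l^j := by
        rw [← Finset.sum_mul, ← Nat.cast_sum, Nat.sum_range_choose]; push_cast; ring
    _ ≤ _ := by gcongr; norm_num

theorem BD.succ {u x n c d l} (h0 : |u x| ≤ c) (h : BD (deriv u) x n d l) (hd : d ≤ c * l)
    (hl : 0 ≤ l) : BD u x (n+1) c l := by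
  intro j hj
  cases j with
  | zero => simpa using h0
  | succ j =>
    rw [iteratedDeriv_succ']
    calc _ ≤ d * l^j := h j (by omega)
      _ ≤ c * l * l^j := by gcongr
      _ = _ := by ring

def nl (f : ℝ → ℝ) : ℝ → ℝ := fun x => deriv (deriv f) x / deriv f x
def sch (f : ℝ → ℝ) : ℝ → ℝ := fun x => deriv (nl f) x - (nl f x)^2/2

/-- smooth with positive derivative -/
structure SP (f : ℝ → ℝ) : Prop where
  sm : Sm f
  pos : ∀ x, 0 < deriv f x

theorem SP.nlsm {f} (h : SP f) : Sm (nl f) :=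
  h.sm.deriv.deriv.div h.sm.deriv (fun x => (h.pos x).ne')

theorem SP.schsm {f} (h : SP f) : Sm (sch f) :=
  h.nlsm.deriv.sub ((h.nlsm.pow 2).div_const 2)

theorem deriv_comp' {f g : ℝ → ℝ} (hf : Sm f) (hg : Sm g) :
    deriv (fun x => f (g x)) = fun x => deriv f (g x) * deriv g x := by
  funext x
  exact ((hf.hd (g x)).comp x (hg.hd x)).deriv

theorem SP.comp {f g} (hf : SP f) (hg : SP g) : SP (fun x => f (g x)) :=
  ⟨hf.sm.comp hg.sm, fun x => by rw [deriv_comp' hf.sm hg.sm]; exact mul_pos (hf.pos _) (hg.pos _)⟩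

theorem SP.id : SP (fun x => x) := ⟨contDiff_id, fun x => by simp⟩

theorem SP.iter {f} (hf : SP f) : ∀ n : ℕ, SP (f^[n])
  | 0 => SP.id
  | n+1 => by rw [Function.iterate_succ']; exact hf.comp (SP.iter hf n)

theorem nl_comp {f g} (hf : SP f) (hg : SP g) :
    nl (fun x => f (g x)) = fun x => nl f (g x) * deriv g x + nl g x := by
  funext x
  have h1 := ((hf.sm.deriv.hd (g x)).comp x (hg.sm.hd x)).mul (hg.sm.deriv.hd x)
  have h2 : deriv (deriv (fun x => f (g x))) x =
      deriv (deriv f) (g x) * deriv g x * deriv g x + deriv f (g x) * deriv (deriv g) x := by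
    rw [deriv_comp' hf.sm hg.sm]; exact h1.deriv
  have h3 : deriv (fun x => f (g x)) x = deriv f (g x) * deriv g x := by rw [deriv_comp' hf.sm hg.sm]
  have p1 := (hf.pos (g x)).ne'
  have p2 := (hg.pos x).ne'
  simp only [nl]
  rw [h2, h3]
  field_simp

theorem dd_eq {g} (hg : SP g) (x : ℝ) : deriv (deriv g) x = nl g x * deriv g x := by
  have p2 := (hg.pos x).ne'
  simp only [nl]; field_simp

theorem sch_comp {f g} (hf : SP f) (hg : SP g) :
    sch (fun x => f (g x)) = fun x => sch f (g x) * (deriv g x)^2 + sch g x := by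
  funext x
  have h1 := (((hf.nlsm.hd (g x)).comp x (hg.sm.hd x)).mul (hg.sm.deriv.hd x)).add (hg.nlsm.hd x)
  have h2 : deriv (nl (fun x => f (g x))) x =
      deriv (nl f) (g x) * deriv g x * deriv g x + nl f (g x) * deriv (deriv g) x + deriv (nl g) x := by
    rw [nl_comp hf hg]; exact h1.deriv
  simp only [sch]
  rw [h2, nl_comp hf hg]
  rw [dd_eq hg]
  ring

theorem nl_id : nl (fun x => x) = fun _ => 0 := by
  funext x; simp [nl]
theorem sch_id : sch (fun x => x) = fun _ => 0 := by
  funext x; simp [sch, nl_id]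

theorem sch_iter {f} (hf : SP f) (l : ℕ) :
    sch (f^[l]) = fun x => ∑ i ∈ Finset.range l, sch f (f^[i] x) * (deriv (f^[i]) x)^2 := by
  induction l with
  | zero => simp only [Finset.range_zero, Finset.sum_empty]; exact sch_id
  | succ l ih =>
    have : sch (f^[l+1]) = sch (fun x => f (f^[l] x)) := by rw [Function.iterate_succ']; rfl
    rw [this, sch_comp hf (hf.iter l), ih]
    funext x
    rw [Finset.sum_range_succ]; ring

theorem deriv_nl {f} (x : ℝ) : deriv (nl f) x = sch f x + (nl f x)^2/2 := by
  simp [sch]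

theorem qlem (n : ℕ) : ∀ (k : ℕ) (C : ℝ) (b : ℕ → ℝ), ∃ C' : ℝ, 0 ≤ C' ∧ ∀ (f : ℝ → ℝ) (l x : ℝ) (ψ : ℝ → ℝ),
    SP f → deriv f x ≤ l → BD (nl f) x n (C * l) l → Sm ψ →
    (∀ j y, |iteratedDeriv j ψ y| ≤ b j) →
    BD (fun y => ψ (f y) * (deriv f y)^k) x n (C' * (deriv f x)^k) l := by
  induction n with
  | zero =>
    intro k C b
    refine ⟨|b 0|, abs_nonneg _, fun f l x ψ hf hl _ hψ hb j hj => ?_⟩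
    obtain rfl : j = 0 := by omega
    simp only [iteratedDeriv_zero, pow_zero, mul_one]
    rw [abs_mul, abs_of_nonneg (pow_nonneg (hf.pos x).le k)]
    have := hb 0 (f x)
    rw [iteratedDeriv_zero] at this
    exact mul_le_mul_of_nonneg_right (this.trans (le_abs_self _)) (pow_nonneg (hf.pos x).le k)
  | succ n ih =>
    intro k C b
    obtain ⟨C1, hC1, h1⟩ := ih (k+1) C (fun j => b (j+1))
    obtain ⟨C2, hC2, h2⟩ := ih k C b
    refine ⟨|b 0| + C1 + k * (2^n * C2 * |C|), by positivity, fun f l x ψ hf hl hn hψ hb => ?_⟩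
    have hp := hf.pos x
    have hl0 : 0 < l := hp.trans_le hl
    have hn' := hn.mono (m := n) hl0.le le_rfl (by omega)
    have hn'' := hn'.mono (m := n) (d := |C| * l) hl0.le (by gcongr; exact le_abs_self _) le_rfl
    have B1 := h1 f l x (deriv ψ) hf hl hn' hψ.deriv
      (fun j y => by have := hb (j+1) y; rwa [iteratedDeriv_succ'] at this)
    have B2 := h2 f l x ψ hf hl hn' hψ hb
    have s1 : ∀ j, Sm (fun y => (deriv f y)^j) := fun j => hf.sm.deriv.pow j
    have s2 : Sm (fun y => ψ (f y) * (deriv f y)^k) := (hψ.comp hf.sm).mul (s1 k)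
    have B3 := (B2.mul hn'' s2 hf.nlsm hl0.le).const_mul (k:ℝ) (by positivity)
    have B4 := B1.add B3 ((hψ.deriv.comp hf.sm).mul (s1 (k+1))) (contDiff_const.mul (s2.mul hf.nlsm))
    have e : deriv (fun y => ψ (f y) * (deriv f y)^k) =
        fun y => (deriv ψ (f y) * deriv f y ^ (k+1) + k * (ψ (f y) * deriv f y ^ k * nl f y)) := by
      funext y
      have := ((hψ.hd (f y)).comp y (hf.sm.hd y)).mul ((hf.sm.deriv.hd y).pow k)
      have h3 := this.deriv
      simp only [Pi.mul_def, Function.comp_def, Pi.pow_apply] at h3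
      have h4 : deriv (fun y => ψ (f y) * (deriv f y)^k) y = _ := h3
      rw [h4, dd_eq hf]
      cases k with
      | zero => simp
      | succ k => simp; ring
    rw [← e] at B4
    refine BD.succ ?_ B4 ?_ hl0.le
    · rw [abs_mul, abs_of_nonneg (pow_nonneg hp.le k)]
      have := hb 0 (f x)
      rw [iteratedDeriv_zero] at this
      gcongr
      have : 0 ≤ k * (2^n * C2 * |C|) := by positivity
      linarith [le_abs_self (b 0)]
    · have e1 : C1 * deriv f x ^ (k+1) ≤ C1 * deriv f x ^ k * l := by
        rw [pow_succ, ← mul_assoc]; gcongr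
      have e2 : 0 ≤ |b 0| * deriv f x ^ k * l := by positivity
      nlinarith

theorem hdlem (bs : ℕ → ℝ) (r : ℕ) : ∃ C : ℝ, 0 ≤ C ∧ ∀ (F : ℝ → ℝ) (x l : ℝ) (N : ℕ), SP F →
    (∀ j y, |iteratedDeriv j (sch F) y| ≤ bs j) → 
    (∀ i ≤ N, deriv (F^[i]) x ≤ l) → (∀ i ≤ N, |nl (F^[i]) x| ≤ l) → 
    (∑ i ∈ Finset.range N, (deriv (F^[i]) x)^2 ≤ l^2) →
    ∀ i ≤ N, BD (nl (F^[i])) x r (C * l) l := by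
  induction r with
  | zero =>
    refine ⟨1, by norm_num, fun F x l N hF hb h1 h2 h3 i hi j hj => ?_⟩
    obtain rfl : j = 0 := by omega
    simpa using h2 i hi
  | succ r ih =>
    obtain ⟨C, hC, ih⟩ := ih
    obtain ⟨C', hC', hq⟩ := qlem r 2 C bs
    refine ⟨1 + C' + (1/2) * (2^r * C * C), by positivity, fun F x l N hF hb h1 h2 h3 i hi => ?_⟩
    have hl0 : 0 < l := ((hF.iter 0).pos x).trans_le (h1 0 (Nat.zero_le _))
    have B := ih F x l N hF hb h1 h2 h3
    have Bs : BD (fun y => ∑ m ∈ Finset.range i, sch F (F^[m] y) * (deriv (F^[m]) y)^2) x r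
        (∑ m ∈ Finset.range i, C' * (deriv (F^[m]) x)^2) l := by
      apply BD.sum
      · intro m hm
        have hm' : m ≤ N := by have := Finset.mem_range.1 hm; omega
        exact hq (F^[m]) l x (sch F) (hF.iter m) (h1 m hm') (B m hm') hF.schsm hb
      · intro m hm
        exact (hF.schsm.comp (hF.iter m).sm).mul ((hF.iter m).sm.deriv.pow 2)
    rw [← sch_iter hF i] at Bs
    have hn := (hF.iter i).nlsm
    have Bn := ((B i hi).mul (B i hi) hn hn hl0.le).const_mul (1/2) (by norm_num)
    have Bt := Bs.add Bn (hF.iter i).schsm (contDiff_const.mul (hn.mul hn))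
    have e : deriv (nl (F^[i])) = fun y => sch (F^[i]) y + 1/2 * (nl (F^[i]) y * nl (F^[i]) y) := by
      funext y; rw [deriv_nl]; ring
    rw [← e] at Bt
    refine BD.succ ?_ Bt ?_ hl0.le
    · refine (h2 i hi).trans ?_
      have : 0 ≤ C' + (1/2) * (2^r * C * C) := by positivity
      nlinarith
    · rw [← Finset.mul_sum]
      have e1 : ∑ m ∈ Finset.range i, (deriv (F^[m]) x)^2 ≤ l^2 := by
        refine le_trans ?_ h3
        apply Finset.sum_le_sum_of_subset_of_nonneg
        · exact Finset.range_mono hi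
        · intros; positivity
      have : C' * ∑ m ∈ Finset.range i, (deriv (F^[m]) x)^2 ≤ C' * l^2 := by gcongr
      nlinarith [sq_nonneg l]

/-- bound on derivatives of iterates -/
theorem hdJ (bs : ℕ → ℝ) (r : ℕ) : ∃ C : ℝ, 0 ≤ C ∧ ∀ (F : ℝ → ℝ) (x l : ℝ) (N : ℕ), SP F →
    (∀ j y, |iteratedDeriv j (sch F) y| ≤ bs j) → 
    (∀ i ≤ N, deriv (F^[i]) x ≤ l) → (∀ i ≤ N, |nl (F^[i]) x| ≤ l) → 
    (∑ i ∈ Finset.range N, (deriv (F^[i]) x)^2 ≤ l^2) →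
    ∀ i ≤ N, |iteratedDeriv (r+1) (F^[i]) x| ≤ C * deriv (F^[i]) x * l^r := by
  obtain ⟨C, hC, h⟩ := hdlem bs r
  obtain ⟨C', hC', hq⟩ := qlem r 1 C (fun _ => 1)
  refine ⟨C', hC', fun F x l N hF hb h1 h2 h3 i hi => ?_⟩
  have B := hq (F^[i]) l x (fun _ => 1) (hF.iter i) (h1 i hi) (h F x l N hF hb h1 h2 h3 i hi)
    contDiff_const (fun j y => by rw [iteratedDeriv_const]; split_ifs <;> simp)
  have := B r le_rfl
  rw [iteratedDeriv_succ']
  simpa using this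

/-- periodic continuous functions attain their maximum -/
theorem per_max {f : ℝ → ℝ} (hf : Continuous f) (hp : ∀ x, f (x+1) = f x) :
    ∃ x0, ∀ x, f x ≤ f x0 := by
  obtain ⟨x0, _, h⟩ := isCompact_Icc.exists_isMaxOn (nonempty_Icc.2 (zero_le_one' ℝ)) hf.continuousOn
  refine ⟨x0, fun x => ?_⟩
  have h1 : f (Int.fract x) = f x := by
    have : Function.Periodic f 1 := hp
    have := this.sub_int_mul_eq (x := x) ⌊x⌋
    rw [mul_one] at this
    exact this
  rw [← h1]
  exact h ⟨Int.fract_nonneg x, (Int.fract_lt_one x).le⟩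

/-- maximum principle for Riccati -/
theorem maxp {w v : ℝ → ℝ} {δ κ : ℝ} (hw : Sm w) (hv : Sm v) (hw0 : ∀ x, 0 < w x)
    (hwp : ∀ x, w (x+1) = w x) (hvp : ∀ x, v (x+1) = v x) (hδ : ∀ x, |deriv w x| ≤ δ)
    (hκ : 0 ≤ κ) (h : ∀ x, |deriv v x - (v x)^2/2| * (w x)^2 ≤ κ^2) :
    ∀ x, |v x| * w x ≤ 2*δ + 2*κ := by
  have hs : Sm (fun x => (v x * w x)^2) := (hv.mul hw).pow 2
  obtain ⟨x0, h0⟩ := per_max hs.continuous (fun x => by simp only [hwp, hvp])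
  have hd0 : deriv (fun x => (v x * w x)^2) x0 = 0 :=
    IsLocalMax.deriv_eq_zero (Filter.Eventually.of_forall h0)
  have hδ0 : 0 ≤ δ := (abs_nonneg _).trans (hδ 0)
  have key : |v x0| * w x0 ≤ 2*δ+2*κ := by
    have h1 : deriv (fun x => (v x * w x)^2) x0 =
        2 * (v x0 * w x0) * (deriv v x0 * w x0 + v x0 * deriv w x0) := by
      have := (((hv.hd x0).mul (hw.hd x0)).pow 2).deriv
      have e : (fun x => (v x * w x)^2) = (v * w)^2 := rfl
      rw [e, this]; simp
    rw [hd0] at h1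
    by_cases hv0 : v x0 = 0
    · rw [hv0]; simp; positivity
    have h2 : deriv v x0 * w x0 + v x0 * deriv w x0 = 0 := by
      have := hw0 x0
      have h3 : v x0 * w x0 ≠ 0 := mul_ne_zero hv0 this.ne'
      have h4 : (v x0 * w x0) * (deriv v x0 * w x0 + v x0 * deriv w x0) = 0 := by
        linarith
      exact (mul_eq_zero.1 h4).resolve_left h3
    have h3 := h x0
    have hww := hw0 x0
    -- multiply
    have h4 : (deriv v x0 - (v x0)^2/2) * (w x0)^2 = - (v x0 * w x0) * deriv w x0 - (v x0 * w x0)^2/2 := by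
      linear_combination (w x0) * h2
    have h5 : |(deriv v x0 - (v x0)^2/2) * (w x0)^2| ≤ κ^2 := by
      rw [abs_mul, abs_of_nonneg (sq_nonneg (w x0))]; exact h3
    rw [h4] at h5
    set Y := |v x0| * w x0 with hY
    have hYa : |v x0 * w x0| = Y := by rw [abs_mul, abs_of_pos hww]
    have hY2 : (v x0 * w x0)^2 = Y^2 := by rw [← hYa, sq_abs]
    have h6 : Y^2/2 ≤ κ^2 + Y * δ := by
      have h7 := (abs_le.1 h5).1
      have h8 : |v x0 * w x0 * deriv w x0| ≤ Y * δ := by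
        rw [abs_mul, hYa]; gcongr; exact hδ x0
      have h9 := (abs_le.1 h8).1
      rw [hY2] at h7
      linarith
    have hY0 : 0 ≤ Y := by positivity
    by_contra hcon
    push Not at hcon
    nlinarith
  intro x
  have h1 := h0 x
  have h2 : |v x| * w x ≤ |v x0| * w x0 := by
    have e : ∀ y, |v y| * w y = |v y * w y| := fun y => by rw [abs_mul, abs_of_pos (hw0 y)]
    rw [e, e]; exact sq_le_sq.1 h1
  exact h2.trans key

/-- an abstract best approximation level -/
structure Lev (τ : ℝ) (a N : ℕ) (s p : ℤ) (β : ℝ) : Prop where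
  apos : 0 < a
  aN : a < N
  hs : s = 1 ∨ s = -1
  hβ : β = s * (a * τ - p)
  pos : 0 < β
  min : ∀ i : ℕ, 0 < i → i < N → ∀ q : ℤ, β ≤ |i * τ - q|
  nxt : ∃ q : ℤ, |N * τ - q| < β

section lev
variable {τ : ℝ} {a N : ℕ} {s p : ℤ} {β : ℝ}

theorem Lev.ss (h : Lev τ a N s p β) : (s : ℝ) * s = 1 := by
  rcases h.hs with rfl | rfl <;> norm_num

theorem Lev.sabs (h : Lev τ a N s p β) : |(s : ℝ)| = 1 := by
  rcases h.hs with rfl | rfl <;> norm_num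

theorem Lev.Nβ (h : Lev τ a N s p β) : N * β ≤ 1 := by
  have hN : 0 < N - 1 := by have := h.apos; have := h.aN; omega
  obtain ⟨j, k, hk, hk2, h3⟩ := Real.exists_int_int_abs_mul_sub_le τ hN
  lift k to ℕ using hk.le
  have h4 := h.min k (by exact_mod_cast hk) (by omega) j
  have h5 : (((N-1 : ℕ) : ℝ) + 1) = N := by
    have : N - 1 + 1 = N := by omega
    exact_mod_cast this
  rw [h5] at h3
  have h6 : β ≤ 1 / N := h4.trans (by simpa using h3)
  have : (0:ℝ) < N := by have := h.aN; exact_mod_cast (by omega : 0 < N)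
  rw [le_div_iff₀ this] at h6
  linarith

theorem Lev.β1 (h : Lev τ a N s p β) : β ≤ 1 := by
  have h1 := h.Nβ
  have h2 : (1:ℝ) ≤ N := by have := h.aN; exact_mod_cast (by omega : 1 ≤ N)
  nlinarith [h.pos]

theorem Lev.abs_eq (h : Lev τ a N s p β) : |a * τ - p| = β := by
  have := h.pos
  rw [h.hβ] at this ⊢
  rw [← abs_of_pos this, abs_mul, h.sabs, one_mul]

theorem Lev.le2 (h : Lev τ a N s p β) : 1 ≤ 2 * N * β := by
  obtain ⟨q, hq⟩ := h.nxt
  have ha : (0:ℝ) < a := by exact_mod_cast h.apos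
  have haN : (a:ℝ) < N := by exact_mod_cast h.aN
  have h1 : (N * p - a * q : ℤ) ≠ 0 := by
    intro h0
    have h0' : (N:ℝ) * p - a * q = 0 := by exact_mod_cast h0
    have h2 : a * (N * τ - q) = N * (a * τ - p) := by linear_combination h0'
    have h3 : a * |N * τ - q| = N * β := by
      rw [← h.abs_eq, ← abs_of_pos ha, ← abs_mul, abs_of_pos ha, h2, abs_mul]; simp
    have := h.pos
    nlinarith [abs_nonneg (N * τ - q)]
  have h2 : (1:ℝ) ≤ |((N * p - a * q : ℤ) : ℝ)| := by
    have := Int.one_le_abs h1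
    exact_mod_cast this
  have h3 : (((N * p - a * q : ℤ) : ℝ)) = a * (N * τ - q) - N * (a * τ - p) := by push_cast; ring
  rw [h3] at h2
  have h4 := abs_sub (a * (N * τ - q)) (N * (a * τ - p))
  rw [abs_mul, abs_mul, h.abs_eq, abs_of_pos ha, abs_of_pos (ha.trans haN)] at h4
  nlinarith [h.pos]

theorem Lev.sign (h : Lev τ a N s p β) (hτ : Irrational τ) :
    ∃ q : ℤ, s * (N * τ - q) < 0 ∧ -β < s * (N * τ - q) := by
  obtain ⟨q, hq⟩ := h.nxt
  have h1 : |s * (N * τ - q)| < β := by rw [abs_mul, h.sabs, one_mul]; exact hq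
  refine ⟨q, ?_, (abs_lt.1 h1).1⟩
  by_contra hcon
  push Not at hcon
  have haN := h.aN
  have h2 := h.min (N - a) (by omega) (by have := h.apos; omega) (q - p)
  have h3 : s * (((N - a : ℕ):ℝ) * τ - (q - p : ℤ)) = s * (N * τ - q) - β := by
    rw [h.hβ]; push_cast [haN.le]; ring
  have h4 : |((N - a : ℕ):ℝ) * τ - (q - p : ℤ)| = |s * (N * τ - q) - β| := by
    rw [← h3, abs_mul, h.sabs, one_mul]
  rw [h4, abs_of_nonpos (by linarith [(abs_lt.1 h1).2])] at h2
  have h5 : s * (N * τ - q) = 0 := by linarith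
  have h6 : N * τ - q = 0 := by
    have := h.ss
    have : s * (s * (N * τ - q)) = 0 := by rw [h5]; simp
    rw [← mul_assoc, h.ss] at this; linarith
  have h7 : (N:ℝ) ≠ 0 := by exact_mod_cast (by omega : N ≠ 0)
  apply hτ
  refine ⟨q / N, ?_⟩
  push_cast
  field_simp; linarith

theorem exists_lev (hτ : Irrational τ) (Q : ℕ) (hQ : 1 ≤ Q) :
    ∃ a N s p β, Lev τ a N s p β ∧ a ≤ Q ∧ Q < N := by
  let d : ℕ → ℝ := fun i => |i * τ - round (i * τ)|
  obtain ⟨a, ha, hmin⟩ := Finset.exists_min_image (Finset.Icc 1 Q) d ⟨1, by simp [hQ]⟩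
  rw [Finset.mem_Icc] at ha
  have hne : ∀ q : ℤ, a * τ - q ≠ 0 := by
    intro q h0
    apply hτ
    have : (a:ℝ) ≠ 0 := by exact_mod_cast (by omega : a ≠ 0)
    exact ⟨q / a, by push_cast; field_simp; linarith⟩
  have hda : 0 < d a := abs_pos.2 (hne _)
  have hex : ∃ N : ℕ, 0 < N ∧ d N < d a := by
    obtain ⟨n, hn⟩ := exists_nat_gt (1 / d a)
    have hn0 : 0 < n := by
      have : (0:ℝ) < n := lt_trans (by positivity) hn
      exact_mod_cast this
    obtain ⟨j, k, hk, hk2, h3⟩ := Real.exists_int_int_abs_mul_sub_le τ hn0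
    lift k to ℕ using hk.le
    refine ⟨k, by exact_mod_cast hk, ?_⟩
    have h4 : d k ≤ |k * τ - j| := round_le _ _
    have h5 : 1 / ((n:ℝ) + 1) < d a := by
      rw [div_lt_iff₀ (by positivity)]
      rw [div_lt_iff₀ hda] at hn
      nlinarith
    have : |(k:ℝ) * τ - j| ≤ 1 / ((n:ℝ)+1) := by simpa using h3
    linarith
  classical
  have hN := Nat.find_spec hex
  have hNm : ∀ i, 0 < i → i < Nat.find hex → d a ≤ d i := by
    intro i hi hi2
    have := Nat.find_min hex hi2
    push Not at this
    exact this hi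
  set N := Nat.find hex with hNdef
  have hQN : Q < N := by
    by_contra hcon
    have := hmin N (by rw [Finset.mem_Icc]; omega)
    linarith [hN.2]
  set p := round (a * τ) with hp
  obtain ⟨s, hs, hs2⟩ : ∃ s : ℤ, (s = 1 ∨ s = -1) ∧ d a = s * (a * τ - p) := by
    rcases le_total 0 (a * τ - p) with h | h
    · exact ⟨1, Or.inl rfl, by simp [d, ← hp, abs_of_nonneg h]⟩
    · exact ⟨-1, Or.inr rfl, by simp [d, ← hp, abs_of_nonpos h]⟩
  refine ⟨a, N, s, p, d a, ⟨by omega, by omega, hs, hs2, hda, ?_, ?_⟩, ha.2, hQN⟩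
  · intro i hi hi2 q
    exact (hNm i hi hi2).trans (round_le _ _)
  · exact ⟨round (N * τ), hN.2⟩

end lev

/-- the class of diffeos -/
structure Cls (τ b1 L : ℝ) (bs : ℕ → ℝ) (F : ℝ → ℝ) : Prop where
  sm : Sm F
  per : ∀ x, F (x+1) = F x + 1
  pos : ∀ x, 0 < deriv F x
  le_b1 : ∀ x, deriv F x ≤ b1
  nl_le : ∀ x, |nl F x| ≤ L
  sch_le : ∀ j x, |iteratedDeriv j (sch F) x| ≤ bs j
  ord : ∀ (k l : ℕ) (q : ℤ), k * τ + q < l * τ → ∀ x, F^[k] x + q < F^[l] x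

section cls
variable {τ b1 L : ℝ} {bs : ℕ → ℝ} {F : ℝ → ℝ}

theorem Cls.sp (h : Cls τ b1 L bs F) : SP F := ⟨h.sm, h.pos⟩
theorem Cls.L0 (h : Cls τ b1 L bs F) : 0 ≤ L := (abs_nonneg _).trans (h.nl_le 0)
theorem Cls.b00 (h : Cls τ b1 L bs F) : 0 ≤ bs 0 := (abs_nonneg _).trans (h.sch_le 0 0)
theorem SP.mono {f} (h : SP f) : StrictMono f := strictMono_of_deriv_pos h.pos

theorem per_nat {f : ℝ → ℝ} (h : ∀ x, f (x+1) = f x + 1) (x : ℝ) : ∀ n : ℕ, f (x + n) = f x + n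
  | 0 => by simp
  | n+1 => by
    push_cast
    rw [← add_assoc, h, per_nat h x n, add_assoc]

theorem per_int {f : ℝ → ℝ} (h : ∀ x, f (x+1) = f x + 1) (x : ℝ) (q : ℤ) : f (x + q) = f x + q := by
  obtain ⟨n, rfl | rfl⟩ := q.eq_nat_or_neg
  · simpa using per_nat h x n
  · have := per_nat h (x - n) n
    push_cast
    rw [sub_add_cancel] at this
    rw [← sub_eq_add_neg]; linarith

theorem iter_per {f : ℝ → ℝ} (h : ∀ x, f (x+1) = f x + 1) : ∀ (n : ℕ) x, f^[n] (x+1) = f^[n] x + 1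
  | 0, x => rfl
  | n+1, x => by rw [Function.iterate_succ_apply', iter_per h n, h, ← Function.iterate_succ_apply' f]

theorem deriv_per {f : ℝ → ℝ} (h : ∀ x, f (x+1) = f x + 1) (x : ℝ) : deriv f (x+1) = deriv f x := by
  have h1 : (fun y => f (y+1)) = fun y => f y + 1 := funext h
  have h2 := congrFun (congrArg deriv h1) x
  rw [deriv_comp_add_const, deriv_add_const] at h2
  exact h2

theorem deriv_perT {f : ℝ → ℝ} (h : ∀ x, f (x+1) = f x) (x : ℝ) : deriv f (x+1) = deriv f x := by
  have h1 : (fun y => f (y+1)) = fun y => f y := funext h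
  have h2 := congrFun (congrArg deriv h1) x
  rw [deriv_comp_add_const] at h2
  exact h2

theorem perT_int {f : ℝ → ℝ} (h : ∀ x, f (x+1) = f x) (x : ℝ) (q : ℤ) : f (x + q) = f x := by
  have : Function.Periodic f 1 := h
  simpa using this.int_mul q x

theorem nl_per {f : ℝ → ℝ} (h : ∀ x, f (x+1) = f x + 1) (x : ℝ) : nl f (x+1) = nl f x := by
  simp only [nl]; rw [deriv_per h, deriv_perT (deriv_per h)]

variable (h : Cls τ b1 L bs F)
include h

theorem Cls.iper (n : ℕ) (x : ℝ) : F^[n] (x+1) = F^[n] x + 1 := iter_per h.per n x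
theorem Cls.iint (n : ℕ) (x : ℝ) (q : ℤ) : F^[n] (x+q) = F^[n] x + q := per_int (h.iper n) x q
theorem Cls.isp (n : ℕ) : SP (F^[n]) := h.sp.iter n
theorem Cls.Jint (n : ℕ) (x : ℝ) (q : ℤ) : deriv (F^[n]) (x+q) = deriv (F^[n]) x :=
  perT_int (deriv_per (h.iper n)) x q

theorem Cls.isurj (n : ℕ) : Function.Surjective (F^[n]) := by
  apply Function.Surjective.iterate
  apply h.sm.continuous.surjective
  · rw [tendsto_atTop_atTop]
    intro b
    refine ⟨⌈b - F 0⌉, fun x hx => ?_⟩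
    have h1 := per_int h.per 0 ⌈b - F 0⌉
    have h2 := h.sp.mono.monotone hx
    rw [zero_add] at h1
    linarith [Int.le_ceil (b - F 0)]
  · rw [tendsto_atBot_atBot]
    intro b
    refine ⟨⌊b - F 0⌋, fun x hx => ?_⟩
    have h1 := per_int h.per 0 ⌊b - F 0⌋
    have h2 := h.sp.mono.monotone hx
    rw [zero_add] at h1
    linarith [Int.floor_le (b - F 0)]

theorem Cls.ordS {s : ℤ} (hs : s = 1 ∨ s = -1) (k l : ℕ) (q r : ℤ)
    (hlt : s * (k * τ + q) < s * (l * τ + r)) (x : ℝ) : s * (F^[k] x + q) < s * (F^[l] x + r) := by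
  rcases hs with rfl | rfl
  · have := h.ord k l (q - r) (by push_cast at *; linarith) x
    push_cast at *; linarith
  · have := h.ord l k (r - q) (by push_cast at *; linarith) x
    push_cast at *; linarith

theorem Cls.ordSle (hτ : Irrational τ) {s : ℤ} (hs : s = 1 ∨ s = -1) (k l : ℕ) (q r : ℤ)
    (hlt : s * (k * τ + q) ≤ s * (l * τ + r)) (x : ℝ) : s * (F^[k] x + q) ≤ s * (F^[l] x + r) := by
  rcases hlt.lt_or_eq with h1 | h1
  · exact (h.ordS hs k l q r h1 x).le
  · have h2 : (k:ℝ) * τ + q = l * τ + r := by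
      rcases hs with rfl | rfl <;> push_cast at h1 <;> linarith
    have h3 : k = l := by
      by_contra hne
      have : ((k:ℝ) - l) ≠ 0 := sub_ne_zero.2 (by exact_mod_cast hne)
      apply hτ
      refine ⟨(r - q) / (k - l), ?_⟩
      push_cast
      rw [div_eq_iff this]; linarith
    subst h3
    have : (q:ℝ) = r := by linarith
    rw [this]

end cls

def W (F : ℝ → ℝ) (a : ℕ) (s p : ℤ) (x : ℝ) : ℝ := s * (F^[a] x - x - p)

/-- sum of lengths of disjoint intervals -/
theorem sum_len {n : ℕ} (A B : ℕ → ℝ) (c : ℝ) (hAB : ∀ i < n, A i ≤ B i)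
    (hA : ∀ i < n, c ≤ A i) (hB : ∀ i < n, B i ≤ c + 1)
    (hd : ∀ i < n, ∀ j < n, i ≠ j → B i ≤ A j ∨ B j ≤ A i) :
    ∑ i ∈ Finset.range n, (B i - A i) ≤ 1 := by
  have h1 : MeasureTheory.volume (⋃ i ∈ Finset.range n, Ioo (A i) (B i)) =
      ∑ i ∈ Finset.range n, MeasureTheory.volume (Ioo (A i) (B i)) := by
    apply MeasureTheory.measure_biUnion_finset
    · intro i hi j hj hij
      rw [Finset.mem_coe, Finset.mem_range] at hi hj
      simp only [Function.onFun]
      rw [Set.disjoint_left]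
      intro x hx hx2
      rcases hd i hi j hj hij with h | h
      · linarith [hx.2, hx2.1]
      · linarith [hx.1, hx2.2]
    · intro i _; exact measurableSet_Ioo
  have h2 : MeasureTheory.volume (⋃ i ∈ Finset.range n, Ioo (A i) (B i)) ≤ MeasureTheory.volume (Icc c (c+1)) := by
    apply MeasureTheory.measure_mono
    intro x hx
    simp only [mem_iUnion, Finset.mem_range] at hx
    obtain ⟨i, hi, hx⟩ := hx
    exact ⟨(hA i hi).trans hx.1.le, hx.2.le.trans (hB i hi)⟩
  rw [h1] at h2
  simp only [Real.volume_Ioo, Real.volume_Icc] at h2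
  rw [← ENNReal.ofReal_sum_of_nonneg] at h2
  · rw [ENNReal.ofReal_le_ofReal_iff (by linarith)] at h2
    linarith
  · intro i hi; linarith [hAB i (Finset.mem_range.1 hi)]

section cls2
variable {τ b1 L : ℝ} {bs : ℕ → ℝ} {F : ℝ → ℝ} {a N : ℕ} {s p : ℤ} {β : ℝ}
variable (h : Cls τ b1 L bs F) (hL : Lev τ a N s p β)

include h in
theorem W_sm (a : ℕ) (s p : ℤ) : Sm (W F a s p) :=
  contDiff_const.mul (((h.isp a).sm.sub contDiff_id).sub contDiff_const)

include h in
theorem W_per (x : ℝ) : W F a s p (x+1) = W F a s p x := by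
  simp only [W]; rw [h.iper]; ring

include h in
theorem W_int (x : ℝ) (q : ℤ) : W F a s p (x+q) = W F a s p x := perT_int (W_per h) x q

include h in
theorem W_deriv (x : ℝ) : deriv (W F a s p) x = s * (deriv (F^[a]) x - 1) := by
  have := ((((h.isp a).sm.hd x).sub (hasDerivAt_id x)).sub (hasDerivAt_const x (p:ℝ))).const_mul (s:ℝ)
  have h2 := this.deriv
  simp only [sub_zero] at h2
  exact h2

include h hL in
theorem W_abs_deriv (x : ℝ) : |deriv (W F a s p) x| = |deriv (F^[a]) x - 1| := by
  rw [W_deriv h, abs_mul, hL.sabs, one_mul]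

include h hL in
theorem W_pos (x : ℝ) : 0 < W F a s p x := by
  have h1 := h.ordS hL.hs 0 a 0 (-p) (by
    have := hL.pos; rw [hL.hβ] at this; push_cast; linarith) x
  simp only [W]
  push_cast at h1
  simp only [Function.iterate_zero, id] at h1
  linarith

include h in
theorem W_iter (i : ℕ) (x : ℝ) : W F a s p (F^[i] x) = s * (F^[i] (F^[a] x - p) - F^[i] x) := by
  have h1 : F^[i] (F^[a] x - p) = F^[a] (F^[i] x) - p := by
    have := h.iint i (F^[a] x) (-p)
    push_cast at this
    rw [← sub_eq_add_neg, ← sub_eq_add_neg] at this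
    rw [this, ← Function.iterate_add_apply, ← Function.iterate_add_apply, add_comm]
  rw [h1]; simp only [W]; ring

include h in
theorem W_mvt (i : ℕ) (x : ℝ) : ∃ ξ ∈ uIcc x (F^[a] x - p),
    W F a s p (F^[i] x) = deriv (F^[i]) ξ * W F a s p x := by
  obtain ⟨ξ, h1, h2⟩ := mvt_eq (h.isp i).sm x (F^[a] x - p)
  refine ⟨ξ, h1, ?_⟩
  rw [W_iter h, h2]; simp only [W]; ring

include h hL in
theorem W_sumN (hτ : Irrational τ) (x : ℝ) : ∑ i ∈ Finset.range N, W F a s p (F^[i] x) ≤ 1 := by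
  have hss := hL.ss
  -- shifts
  let A : ℕ → ℝ := fun i => s * F^[i] x
  let q : ℕ → ℤ := fun i => -⌊A i - A 0⌋
  have hq1 : ∀ i, A 0 ≤ A i + q i := fun i => by
    simp only [q]; push_cast; linarith [Int.floor_le (A i - A 0)]
  have hq2 : ∀ i, A i + q i < A 0 + 1 := fun i => by
    simp only [q]; push_cast; linarith [Int.lt_floor_add_one (A i - A 0)]
  have sep : ∀ i < N, ∀ j < N, i ≠ j → ∀ k : ℤ,
      A i + W F a s p (F^[i] x) ≤ A j + k ∨ A j + k + W F a s p (F^[j] x) ≤ A i := by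
    intro i hi j hj hij k
    have hm : β ≤ |s * (i * τ) - s * (j * τ) - k| := by
      rcases lt_or_gt_of_ne hij with h1 | h1
      · have := hL.min (j - i) (by omega) (by omega) (-(s * k))
        have e : (((j - i : ℕ) : ℝ) * τ - ((-(s*k) : ℤ) : ℝ)) = -(s * (s * (i * τ) - s * (j * τ) - k)) := by
          push_cast [h1.le]; linear_combination (i * τ - j * τ) * hss
        rw [e, abs_neg, abs_mul, hL.sabs, one_mul] at this
        exact this
      · have := hL.min (i - j) (by omega) (by omega) ((s * k))
        have e : (((i - j : ℕ) : ℝ) * τ - (((s*k) : ℤ) : ℝ)) = (s * (s * (i * τ) - s * (j * τ) - k)) := by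
          push_cast [h1.le]; linear_combination (j * τ - i * τ) * hss
        rw [e, abs_mul, hL.sabs, one_mul] at this
        exact this
    have hb := hL.hβ
    rcases le_abs.1 hm with h1 | h1
    · right
      have := h.ordSle hτ hL.hs (j + a) i (s * k - p) 0 (by push_cast; linear_combination h1 - hb + k * hss) x
      rw [Function.iterate_add_apply] at this
      simp only [W, A]
      rw [← Function.iterate_add_apply, add_comm a j, Function.iterate_add_apply]
      push_cast at this
      linear_combination this - k * hss
    · left
      have := h.ordSle hτ hL.hs (i + a) j (-p) (s * k) (by push_cast; linear_combination h1 - hb - k * hss) x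
      rw [Function.iterate_add_apply] at this
      simp only [W, A]
      rw [← Function.iterate_add_apply, add_comm a i, Function.iterate_add_apply]
      push_cast at this
      linear_combination this + k * hss
  have key := sum_len (n := N) (fun i => A i + q i) (fun i => A i + q i + W F a s p (F^[i] x)) (A 0)
    (fun i _ => by linarith [W_pos h hL (F^[i] x)]) (fun i _ => hq1 i) ?_ ?_
  · simpa using key
  · intro i hi
    by_cases h0 : i = 0
    · subst h0
      have hq0 : q 0 = 0 := by simp [q]
      have := h.ordSle hτ hL.hs a 0 (-p) s (by
        have := hL.β1; rw [hL.hβ] at this; push_cast; linear_combination this - hss) x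
      simp only [hq0, W, A]
      push_cast at *
      simp only [Function.iterate_zero, id] at *
      linear_combination this + hss
    · have hN0 : 0 < N := by have := hL.aN; omega
      rcases sep i hi 0 hN0 h0 (1 - q i) with h1 | h1
      · push_cast at h1; linarith
      · push_cast at h1; linarith [hq2 i, W_pos h hL (F^[0] x)]
  · intro i hi j hj hij
    rcases sep i hi j hj hij (q j - q i) with h1 | h1
    · left; push_cast at h1; linarith
    · right; push_cast at h1; linarith

include h hL in
theorem W_sum (hτ : Irrational τ) {B l : ℕ} (hl : l ≤ B * N) (x : ℝ) :
    ∑ i ∈ Finset.range l, W F a s p (F^[i] x) ≤ B := by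
  have h1 : ∑ i ∈ Finset.range l, W F a s p (F^[i] x) ≤ ∑ i ∈ Finset.range (B*N), W F a s p (F^[i] x) := by
    apply Finset.sum_le_sum_of_subset_of_nonneg (Finset.range_mono hl)
    intro i _ _; exact (W_pos h hL _).le
  refine h1.trans ?_
  clear h1 hl
  induction B with
  | zero => simp
  | succ B ih =>
    rw [Nat.succ_mul, Finset.sum_range_add]
    have := W_sumN h hL hτ (F^[B*N] x)
    simp only [← Function.iterate_add_apply] at this
    have e : ∑ i ∈ Finset.range N, W F a s p (F^[B*N + i] x) ≤ 1 := by
      refine le_trans (le_of_eq ?_) this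
      apply Finset.sum_congr rfl; intro i _; rw [add_comm]
    push_cast; linarith

/-- log of derivative of iterate -/
def lJ (F : ℝ → ℝ) (l : ℕ) (x : ℝ) : ℝ := Real.log (deriv (F^[l]) x)

include h in
theorem J_add (l m : ℕ) (x : ℝ) : deriv (F^[l+m]) x = deriv (F^[l]) (F^[m] x) * deriv (F^[m]) x := by
  have e : F^[l+m] = fun x => F^[l] (F^[m] x) := by funext x; rw [Function.iterate_add_apply]
  rw [e, deriv_comp' (h.isp l).sm (h.isp m).sm]

include h in
theorem lJ_add (l m : ℕ) (x : ℝ) : lJ F (l+m) x = lJ F l (F^[m] x) + lJ F m x := by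
  simp only [lJ]
  rw [J_add h, Real.log_mul ((h.isp l).pos _).ne' ((h.isp m).pos _).ne']

include h in
theorem lJ_exp (l : ℕ) (x : ℝ) : Real.exp (lJ F l x) = deriv (F^[l]) x :=
  Real.exp_log ((h.isp l).pos _)

theorem lJ_deriv {f : ℝ → ℝ} (hf : SP f) (x : ℝ) : HasDerivAt (fun y => Real.log (deriv f y)) (nl f x) x :=
  (hf.sm.deriv.hd x).log (hf.pos x).ne'

theorem lJ_lip {f : ℝ → ℝ} (hf : SP f) {x y M : ℝ} (hM : ∀ z ∈ uIcc x y, |nl f z| ≤ M) :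
    |Real.log (deriv f y) - Real.log (deriv f x)| ≤ M * |y - x| := by
  have hs : Sm (fun y => Real.log (deriv f y)) := hf.sm.deriv.log (fun x => (hf.pos x).ne')
  apply mvt hs
  intro z hz
  rw [(lJ_deriv hf z).deriv]; exact hM z hz

include hL in
theorem W_absdiff {x y : ℝ} (hy : y ∈ uIcc x (F^[a] x - p)) : |y - x| ≤ |W F a s p x| := by
  simp only [W]
  rw [abs_mul, hL.sabs, one_mul]
  have := abs_sub_left_of_mem_uIcc hy
  rwa [show F^[a] x - p - x = F^[a] x - x - p by ring] at this

include h in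
theorem iter_mem {x y : ℝ} (i : ℕ) (hy : y ∈ uIcc x (F^[a] x - p)) :
    F^[i] y ∈ uIcc (F^[i] x) (F^[a] (F^[i] x) - p) := by
  have h1 : F^[a] (F^[i] x) - p = F^[i] (F^[a] x - p) := by
    have := h.iint i (F^[a] x) (-p)
    push_cast at this
    rw [← sub_eq_add_neg, ← sub_eq_add_neg] at this
    rw [this, ← Function.iterate_add_apply, ← Function.iterate_add_apply, add_comm]
  rw [h1]
  have hm := (h.isp i).mono.monotone
  rw [mem_uIcc] at *
  rcases hy with hy | hy
  · left; exact ⟨hm hy.1, hm hy.2⟩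
  · right; exact ⟨hm hy.1, hm hy.2⟩

include h hL in
theorem dist0 (hτ : Irrational τ) {B l : ℕ} (hl : l ≤ B * N) {x y : ℝ} (hy : y ∈ uIcc x (F^[a] x - p)) :
    |lJ F l y - lJ F l x| ≤ L * B := by
  have h1 : |lJ F l y - lJ F l x| ≤ L * ∑ i ∈ Finset.range l, W F a s p (F^[i] x) := by
    clear hl
    induction l with
    | zero => simp [lJ]
    | succ l ih =>
      rw [add_comm, lJ_add h, lJ_add h, add_comm 1, Finset.sum_range_succ, mul_add]
      have h2 : |lJ F 1 (F^[l] y) - lJ F 1 (F^[l] x)| ≤ L * W F a s p (F^[l] x) := by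
        have h3 := lJ_lip h.sp (x := F^[l] x) (y := F^[l] y) (M := L) (fun z _ => h.nl_le z)
        have h4 := W_absdiff hL (iter_mem h l hy)
        rw [abs_of_pos (W_pos h hL _)] at h4
        simp only [lJ, Function.iterate_one]
        exact h3.trans (mul_le_mul_of_nonneg_left h4 h.L0)
      have h5 := abs_add_le (lJ F 1 (F^[l] y) - lJ F 1 (F^[l] x)) (lJ F l y - lJ F l x)
      rw [show lJ F 1 (F^[l] y) + lJ F l y - (lJ F 1 (F^[l] x) + lJ F l x) =
        (lJ F 1 (F^[l] y) - lJ F 1 (F^[l] x)) + (lJ F l y - lJ F l x) by ring]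
      linarith
  exact h1.trans (mul_le_mul_of_nonneg_left (W_sum h hL hτ hl x) h.L0)

include h hL in
theorem cover (hτ : Irrational τ) (y z : ℝ) : ∃ j < N + a, ∃ q : ℤ,
    y ∈ uIcc (F^[j] z + q) (F^[a] (F^[j] z + q) - p) := by
  have hss := hL.ss
  let q : ℕ → ℤ := fun j => s * ⌊s * y - s * F^[j] z⌋
  let A : ℕ → ℝ := fun j => s * (F^[j] z + q j)
  have hA : ∀ j, A j = s * F^[j] z + ⌊s * y - s * F^[j] z⌋ := fun j => by
    simp only [A, q]; push_cast; linear_combination ⌊s * y - s * F^[j] z⌋ * hss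
  have hq1 : ∀ j, A j ≤ s * y := fun j => by
    rw [hA]; linarith [Int.floor_le (s * y - s * F^[j] z)]
  have hq2 : ∀ j, s * y - 1 < A j := fun j => by
    rw [hA]; linarith [Int.lt_floor_add_one (s * y - s * F^[j] z)]
  have huniq : ∀ (j : ℕ) (k : ℤ), s * (F^[j] z + k) ≤ s * y → s * y - 1 < s * (F^[j] z + k) →
      s * (F^[j] z + k) = A j := by
    intro j k h1 h2
    have : ⌊s * y - s * F^[j] z⌋ = s * k := by
      rw [Int.floor_eq_iff]; push_cast; constructor <;> linarith
    rw [hA, this]; push_cast; ring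
  have hN0 : 0 < N + a := by have := hL.apos; omega
  obtain ⟨j, hj, hmax⟩ := Finset.exists_max_image (Finset.range (N+a)) A ⟨0, by simpa using hN0⟩
  rw [Finset.mem_range] at hj
  refine ⟨j, hj, q j, ?_⟩
  have up : s * y ≤ s * (F^[a + j] z - p + q j) := by
    by_contra hcon
    push Not at hcon
    by_cases hjN : j < N
    · have h1 : A j < s * (F^[a+j] z + (q j - p : ℤ)) := by
        have := W_pos h hL (F^[j] z)
        simp only [W, ← Function.iterate_add_apply] at this
        simp only [A]; push_cast; linarith
      have h2 := huniq (a+j) (q j - p) (by push_cast; linarith) (by linarith [hq2 j])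
      have h3 := hmax (a+j) (by rw [Finset.mem_range]; omega)
      linarith
    · obtain ⟨k, hk1, hk2⟩ := hL.sign hτ
      have hjN' : ((j - N : ℕ) : ℝ) = j - N := by push_cast [not_lt.1 hjN]; ring
      have h1 : A j < s * (F^[j-N] z + (k + q j : ℤ)) := by
        have := h.ordS hL.hs j (j - N) 0 k (by rw [hjN']; push_cast; linarith) z
        simp only [A]; push_cast at *; linarith
      have h2 : s * (F^[j-N] z + (k + q j : ℤ)) < s * (F^[a+j] z - p + q j) := by
        have := h.ordS hL.hs (j - N) (a+j) k (-p) (by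
          rw [hjN']; push_cast; have := hL.hβ; linarith) z
        push_cast at *; linarith
      have h3 := huniq (j-N) (k + q j) (by linarith) (by linarith [hq2 j])
      have h4 := hmax (j-N) (by rw [Finset.mem_range]; omega)
      linarith
  have lo := hq1 j
  have e : F^[a] (F^[j] z + q j) - p = F^[a+j] z - p + q j := by
    rw [h.iint, ← Function.iterate_add_apply]; ring
  rw [e, mem_uIcc]
  simp only [A] at lo
  rcases hL.hs with hs | hs
  · left; rw [hs] at up lo; push_cast at up lo; constructor <;> linarith
  · right; rw [hs] at up lo; push_cast at up lo; constructor <;> linarith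

include h hL in
theorem denjoy (hτ : Irrational τ) (y : ℝ) : |lJ F a y| ≤ 3 * L := by
  obtain ⟨z, _, hz⟩ := mvt_eq (h.isp a).sm 0 1
  have h1 : deriv (F^[a]) z = 1 := by
    have := h.iper a 0
    rw [zero_add] at this; rw [this] at hz; linarith
  have hz0 : lJ F a z = 0 := by simp [lJ, h1]
  obtain ⟨j, hj, q, hy⟩ := cover h hL hτ y z
  have haN := hL.aN
  have h2 := dist0 h hL hτ (B := 1) (l := a) (by omega) hy
  have h3 : lJ F a (F^[j] z + q) = lJ F a (F^[j] z) := by simp only [lJ]; rw [h.Jint]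
  have h4 := dist0 h hL hτ (B := 2) (l := j) (x := z) (y := F^[a] z - p) (by omega) right_mem_uIcc
  have h5 : lJ F j (F^[a] z - p) = lJ F j (F^[a] z) := by
    simp only [lJ]; have := h.Jint j (F^[a] z) (-p)
    push_cast at this; rw [← sub_eq_add_neg] at this; rw [this]
  have h6 := lJ_add h a j z
  have h7 := lJ_add h j a z
  rw [add_comm j a] at h7
  rw [h3] at h2
  rw [h5] at h4
  push_cast at *
  rw [abs_le] at *
  constructor <;> linarith [h2.1, h2.2, h4.1, h4.2]

include h hL in
theorem vlem (hτ : Irrational τ) {B l : ℕ} {D M δ κ : ℝ} (hl : l ≤ B * N) (hD : 0 ≤ D)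
    (hJ : ∀ i < l, ∀ x, deriv (F^[i]) x * W F a s p x ≤ D * W F a s p (F^[i] x))
    (hM : ∀ x, W F a s p x ≤ M) (hδ : ∀ x, |deriv (W F a s p) x| ≤ δ) (hκ : 0 ≤ κ)
    (hκ2 : bs 0 * D^2 * (B * M) ≤ κ^2) (x : ℝ) :
    |nl (F^[l]) x| * W F a s p x ≤ 2 * δ + 2 * κ := by
  refine maxp (W_sm h a s p) (h.isp l).nlsm (W_pos h hL) (W_per h) (nl_per (h.iper l)) hδ hκ ?_ x
  intro x
  have hM0 : 0 ≤ M := (W_pos h hL x).le.trans (hM x)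
  refine le_trans ?_ hκ2
  have e : deriv (nl (F^[l])) x - (nl (F^[l]) x)^2/2 = sch (F^[l]) x := rfl
  rw [e, sch_iter h.sp]
  calc |∑ i ∈ Finset.range l, sch F (F^[i] x) * deriv F^[i] x ^ 2| * W F a s p x ^ 2
      ≤ (∑ i ∈ Finset.range l, |sch F (F^[i] x) * deriv F^[i] x ^ 2|) * W F a s p x ^ 2 := by
        gcongr; exact Finset.abs_sum_le_sum_abs _ _
    _ = ∑ i ∈ Finset.range l, |sch F (F^[i] x)| * (deriv F^[i] x * W F a s p x) ^ 2 := by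
        rw [Finset.sum_mul]; apply Finset.sum_congr rfl; intro i _
        rw [abs_mul, abs_of_nonneg (sq_nonneg (deriv F^[i] x))]; ring
    _ ≤ ∑ i ∈ Finset.range l, (bs 0 * D^2 * M) * W F a s p (F^[i] x) := by
        apply Finset.sum_le_sum
        intro i hi
        have h1 := h.sch_le 0 (F^[i] x)
        rw [iteratedDeriv_zero] at h1
        have h2 := hJ i (Finset.mem_range.1 hi) x
        have h3 := W_pos h hL (F^[i] x)
        have h4 := W_pos h hL x
        have h5 := (h.isp i).pos x
        have h6 := hM (F^[i] x)
        have h7 := h.b00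
        calc |sch F (F^[i] x)| * (deriv F^[i] x * W F a s p x) ^ 2
            ≤ bs 0 * (D * W F a s p (F^[i] x))^2 := by gcongr
          _ = bs 0 * D^2 * W F a s p (F^[i] x) * W F a s p (F^[i] x) := by ring
          _ ≤ _ := by gcongr
    _ = (bs 0 * D^2 * M) * ∑ i ∈ Finset.range l, W F a s p (F^[i] x) := by rw [Finset.mul_sum]
    _ ≤ (bs 0 * D^2 * M) * B := by
        have h7 := h.b00
        gcongr; exact W_sum h hL hτ hl x
    _ = _ := by ring

end cls2

section two
variable {τ b1 L : ℝ} {bs : ℕ → ℝ} {F : ℝ → ℝ} {a N : ℕ} {s p : ℤ} {β : ℝ}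
  {a' N' : ℕ} {s' p' : ℤ} {β' : ℝ}
variable (h : Cls τ b1 L bs F) (hL : Lev τ a N s p β) (hL' : Lev τ a' N' s' p' β')

include h in
theorem W_sum_tel (y : ℝ) (j : ℕ) :
    ∑ i ∈ Finset.range j, W F a' s' p' (F^[i*a'] y) = s' * (F^[j*a'] y - j * p' - y) := by
  induction j with
  | zero => simp
  | succ j ih =>
    rw [Finset.sum_range_succ, ih]
    simp only [W, ← Function.iterate_add_apply]
    rw [show (j+1)*a' = a' + j*a' by ring]
    push_cast; ring

include h hL hL' in
theorem twolev (hτ : Irrational τ) (y : ℝ) : ∃ x, (y = x ∨ y = F^[a] x - p) ∧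
    (∀ j : ℕ, j * β' ≤ β → F^[j*a'] y - j * p' ∈ uIcc x (F^[a] x - p)) ∧
    (∀ j : ℕ, j * β' ≤ β → ∑ i ∈ Finset.range j, W F a' s' p' (F^[i*a'] y) ≤ W F a s p x) ∧
    (∀ j : ℕ, β ≤ j * β' → W F a s p x ≤ ∑ i ∈ Finset.range j, W F a' s' p' (F^[i*a'] y)) := by
  have hβ := hL.hβ
  have hβ' := hL'.hβ
  have hp := hL.pos
  have hp' := hL'.pos
  have hss' := hL'.ss
  -- sandwich helper
  have mem : ∀ x z : ℝ, s * x ≤ s * z → s * z ≤ s * (F^[a] x - p) → z ∈ uIcc x (F^[a] x - p) := by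
    intro x z h1 h2
    rw [mem_uIcc]
    rcases hL.hs with hs | hs
    · left; rw [hs] at h1 h2; push_cast at h1 h2; constructor <;> linarith
    · right; rw [hs] at h1 h2; push_cast at h1 h2; constructor <;> linarith
  have hcase : s' = s ∨ s' = -s := by
    rcases hL.hs with rfl | rfl <;> rcases hL'.hs with rfl | rfl <;> simp
  rcases hcase with hc | hc
  · refine ⟨y, Or.inl rfl, ?_, ?_, ?_⟩
    · intro j hj
      have hj0 : 0 ≤ j * β' := by positivity
      rw [hβ', hc] at hj hj0
      apply mem
      · have := h.ordSle hτ hL.hs 0 (j*a') 0 (-(j*p')) (by push_cast; linarith) y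
        push_cast at this; simp only [Function.iterate_zero, id] at this; linarith
      · have := h.ordSle hτ hL.hs (j*a') a (-(j*p')) (-p) (by push_cast; linarith) y
        push_cast at this; linarith
    · intro j hj
      rw [hβ', hc] at hj
      rw [W_sum_tel h, hc]
      have := h.ordSle hτ hL.hs (j*a') a (-(j*p')) (-p) (by push_cast; linarith) y
      push_cast at this; simp only [W]; linarith
    · intro j hj
      rw [hβ', hc] at hj
      rw [W_sum_tel h, hc]
      have := h.ordSle hτ hL.hs a (j*a') (-p) (-(j*p')) (by push_cast; linarith) y
      push_cast at this; simp only [W]; linarith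
  · obtain ⟨x, hx⟩ := h.isurj a (y + p)
    have hy : y = F^[a] x - p := by linarith
    have e : ∀ j : ℕ, F^[j*a'] y = F^[j*a' + a] x - p := by
      intro j
      have := h.iint (j*a') (F^[a] x) (-p)
      push_cast at this
      rw [hy, sub_eq_add_neg, this, Function.iterate_add_apply]; ring
    have hc' : (s':ℝ) = -s := by rw [hc]; push_cast; ring
    refine ⟨x, Or.inr hy, ?_, ?_, ?_⟩
    · intro j hj
      have hj0 : 0 ≤ j * β' := by positivity
      rw [hβ', hc'] at hj hj0
      rw [e]
      apply mem
      · have := h.ordSle hτ hL.hs 0 (j*a'+a) 0 (-(j*p'+p)) (by push_cast; linarith) x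
        push_cast at this; simp only [Function.iterate_zero, id] at this; linarith
      · have := h.ordSle hτ hL.hs (j*a'+a) a (-(j*p'+p)) (-p) (by push_cast; linarith) x
        push_cast at this; linarith
    · intro j hj
      rw [hβ', hc'] at hj
      rw [W_sum_tel h, hc', e]
      have := h.ordSle hτ hL.hs 0 (j*a'+a) 0 (-(j*p'+p)) (by push_cast; linarith) x
      push_cast at this; simp only [Function.iterate_zero, id] at this
      simp only [W]; rw [hy]; linarith
    · intro j hj
      rw [hβ', hc'] at hj
      rw [W_sum_tel h, hc', e]
      have := h.ordSle hτ hL.hs (j*a'+a) 0 (-(j*p'+p)) 0 (by push_cast; linarith) x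
      push_cast at this; simp only [Function.iterate_zero, id] at this
      simp only [W]; rw [hy]; linarith

include h hL in
theorem W_le_one (hτ : Irrational τ) (x : ℝ) : W F a s p x ≤ 1 := by
  have := W_sum h hL hτ (B := 1) (l := 1) (by have := hL.aN; omega) x
  simpa using this

include h hL in
theorem J_le (hτ : Irrational τ) (x : ℝ) : deriv (F^[a]) x ≤ Real.exp (3*L) := by
  rw [← lJ_exp h]; exact Real.exp_le_exp.2 (abs_le.1 (denjoy h hL hτ x)).2

include h hL in
theorem J_ge (hτ : Irrational τ) (x : ℝ) : (Real.exp (3*L))⁻¹ ≤ deriv (F^[a]) x := by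
  rw [← lJ_exp h, ← Real.exp_neg]; exact Real.exp_le_exp.2 (abs_le.1 (denjoy h hL hτ x)).1

include h in
theorem E_one : 1 ≤ Real.exp (3*L) := Real.one_le_exp (by have := h.L0; linarith)

include h hL in
theorem W_iter_a (hτ : Irrational τ) (x : ℝ) :
    (Real.exp (3*L))⁻¹ * W F a s p x ≤ W F a s p (F^[a] x) ∧
    W F a s p (F^[a] x) ≤ Real.exp (3*L) * W F a s p x := by
  obtain ⟨ξ, _, h1⟩ := W_mvt h (a := a) (s := s) (p := p) a x
  have := W_pos h hL x
  rw [h1]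
  exact ⟨by gcongr; exact J_ge h hL hτ ξ, by gcongr; exact J_le h hL hτ ξ⟩

include h hL in
theorem W_near (hτ : Irrational τ) {x z : ℝ} (hz : z ∈ uIcc x (F^[a] x - p)) :
    (Real.exp (3*L))⁻¹ * W F a s p x ≤ W F a s p z := by
  obtain ⟨ξ, _, h1⟩ := mvt_eq (h.isp a).sm x z
  have hJ := J_ge h hL hτ ξ
  have hE := inv_le_one_of_one_le₀ (E_one h)
  have hw := W_pos h hL x
  have e : W F a s p z = deriv (F^[a]) ξ * (s * (z - x)) + W F a s p x - s * (z - x) := by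
    simp only [W]; linear_combination s * h1
  have ht : 0 ≤ s * (z - x) ∧ s * (z - x) ≤ W F a s p x := by
    simp only [W] at hw ⊢
    rw [mem_uIcc] at hz
    rcases hL.hs with hs | hs <;> rw [hs] at hw ⊢ <;> push_cast at * <;>
      rcases hz with hz | hz <;> constructor <;> linarith [hz.1, hz.2]
  rw [e]
  have h3 : (Real.exp (3*L))⁻¹ * (s * (z - x)) ≤ deriv (F^[a]) ξ * (s * (z - x)) :=
    mul_le_mul_of_nonneg_right hJ ht.1
  have h4 : 0 ≤ (1 - (Real.exp (3*L))⁻¹) * (W F a s p x - s * (z - x)) :=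
    mul_nonneg (by linarith) (by linarith [ht.2])
  linarith

theorem Lev.half (hL : Lev τ a N s p β) (hL' : Lev τ a' N' s' p' β') {m : ℕ} (hm : 2 * m * N ≤ N') :
    m * β' ≤ β := by
  have h1 := hL'.Nβ
  have h2 := hL.le2
  have h3 : (2:ℝ) * m * N ≤ N' := by exact_mod_cast hm
  have hN : (0:ℝ) < N := by have := hL.aN; exact_mod_cast (by omega : 0 < N)
  have h4 := hL'.pos
  by_contra hc
  push Not at hc
  have : 2 * N * β < 2 * N * (m * β') := by gcongr
  nlinarith
end two

theorem initial_a {τ : ℝ} (hτ : Irrational τ) (b1 L : ℝ) (bs : ℕ → ℝ) (i : ℕ) :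
    ∃ a N s p β, Lev τ a N s p β ∧ ∀ F, Cls τ b1 L bs F → ∀ x,
      W F a s p x ≤ (1 / (1 + (Real.exp (3*L))⁻¹))^i := by
  induction i with
  | zero =>
    obtain ⟨a, N, s, p, β, hL, _⟩ := exists_lev hτ 1 le_rfl
    exact ⟨a, N, s, p, β, hL, fun F h x => by simpa using W_le_one h hL hτ x⟩
  | succ i ih =>
    obtain ⟨a, N, s, p, β, hL, hi⟩ := ih
    obtain ⟨a', N', s', p', β', hL', h1, h2⟩ := exists_lev hτ (4*N) (by have := hL.aN; omega)
    refine ⟨a', N', s', p', β', hL', fun F h y => ?_⟩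
    have hβ : ((2:ℕ):ℝ) * β' ≤ β := hL.half hL' (by omega)
    obtain ⟨x, _, _, h3, _⟩ := twolev h hL hL' hτ y
    have h4 := (h3 2 hβ).trans (hi F h x)
    have h5 := (W_iter_a h hL' hτ y).1
    simp only [Finset.sum_range_succ, Finset.sum_range_zero, zero_mul, one_mul, zero_add, Function.iterate_zero, id] at h4
    rw [pow_succ, mul_one_div, le_div_iff₀ (by positivity)]
    linarith

set_option maxHeartbeats 2000000 in
theorem initial {τ : ℝ} (hτ : Irrational τ) (b1 L : ℝ) (bs : ℕ → ℝ) {η : ℝ} (hη : 0 < η) :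
    ∃ a N s p β, Lev τ a N s p β ∧ ∀ F, Cls τ b1 L bs F → ∀ x,
      W F a s p x ≤ η ∧ |deriv (W F a s p) x| ≤ η := by
  obtain ⟨Ck, hCk, hlk⟩ := lk 1 1
  set E := Real.exp (3*L) with hE
  have hE0 : 0 < E := Real.exp_pos _
  set C0 := 2 * E + 1 with hC0
  set C1 := C0 * E with hC1
  set C3 := E * E * Real.exp (2 * C1) with hC3
  set C4 := C3 * E with hC4
  have hC30 : 0 < C3 := by positivity
  have hC40 : 0 < C4 := by positivity
  have hC00 : 0 < C0 := by positivity
  -- target smallness of σ = sqrt ρ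
  obtain ⟨σ, hσ0, hσ1, hσ2, hσ3⟩ : ∃ σ : ℝ, 0 < σ ∧ σ ≤ 1 ∧ σ * E ≤ 1/2 ∧
      σ * (Ck * (2 + 2 * C0 * E) + 1) ≤ η := by
    have hd : 0 < Ck * (2 + 2 * C0 * E) + 1 := by positivity
    refine ⟨min 1 (min (1/(2*E)) (η / (Ck * (2 + 2 * C0 * E) + 1))), by positivity, min_le_left _ _, ?_, ?_⟩
    · have : min 1 (min (1/(2*E)) (η / (Ck * (2 + 2 * C0 * E) + 1))) ≤ 1/(2*E) :=
        (min_le_right _ _).trans (min_le_left _ _)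
      calc _ ≤ 1/(2*E) * E := by gcongr
        _ = 1/2 := by field_simp
    · rw [← le_div_iff₀ hd]; exact (min_le_right _ _).trans (min_le_right _ _)
  obtain ⟨m, hm⟩ := exists_nat_ge (C4 / σ^2)
  have hm0 : (0:ℝ) < m := lt_of_lt_of_le (by positivity) hm
  have hm1 : 1 ≤ m := by exact_mod_cast hm0
  set B := 2 * m * m with hB
  have hB0 : (0:ℝ) < B := by rw [hB]; push_cast; positivity
  set D := Real.exp (L * B) with hD
  have hD0 : 0 < D := Real.exp_pos _
  obtain ⟨i, hi⟩ : ∃ i : ℕ, (1 / (1 + E⁻¹))^i < min 1 (1/(4*((|bs 0|+1)*D^2*B))) := by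
    apply exists_pow_lt_of_lt_one (by positivity)
    rw [div_lt_one (by positivity)]
    have : 0 < E⁻¹ := by positivity
    linarith
  obtain ⟨a, N, s, p, β, hL, hM⟩ := initial_a hτ b1 L bs i
  have hN0 : 0 < N := by have := hL.aN; omega
  obtain ⟨a', N', s', p', β', hL', h1, h2⟩ := exists_lev hτ (2*m*N) (by
    have := Nat.mul_pos hm1 hN0; nlinarith)
  refine ⟨a', N', s', p', β', hL', fun F h => ?_⟩
  have hE1 : 1 ≤ E := E_one h
  have hmβ : (m:ℝ) * β' ≤ β := hL.half hL' h2.le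
  have hw1 : ∀ x, W F a s p x ≤ 1 := W_le_one h hL hτ
  -- nonlinearity bound
  have hnl : ∀ l ≤ B * N, ∀ x, |nl (F^[l]) x| * W F a s p x ≤ C0 := by
    intro l hl x
    have := vlem h hL hτ (B := B) (l := l) (D := D) (M := 1/(4*((|bs 0|+1)*D^2*B))) (δ := E) (κ := 1/2)
      hl hD0.le ?_ (fun x => (hM F h x).trans (hi.le.trans (min_le_right _ _))) ?_ (by norm_num) ?_ x
    · rw [hC0]; linarith
    · intro i hi x
      obtain ⟨ξ, hξ, hξ2⟩ := W_mvt h (a := a) (s := s) (p := p) i x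
      have h3 := dist0 h hL hτ (B := B) (l := i) (by omega) hξ
      rw [hξ2, ← mul_assoc]
      apply mul_le_mul_of_nonneg_right _ (W_pos h hL x).le
      rw [← lJ_exp h, ← lJ_exp h, hD, ← Real.exp_add]
      apply Real.exp_le_exp.2
      linarith [(abs_le.1 h3).1]
    · intro x
      rw [W_abs_deriv h hL, abs_le]
      have := J_le h hL hτ x
      have := (h.isp a).pos x
      constructor <;> linarith
    · have e : bs 0 * D^2 * (B * (1/(4*((|bs 0|+1)*D^2*B)))) = bs 0 / (4 * (|bs 0|+1)) := by
        have : |bs 0| + 1 ≠ 0 := by positivity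
        field_simp
      rw [e, div_le_iff₀ (by positivity)]
      linarith [le_abs_self (bs 0)]
  have hdist : ∀ l ≤ B * N, ∀ x, ∀ z ∈ uIcc x (F^[a] x - p), |lJ F l z - lJ F l x| ≤ C1 := by
    intro l hl x z hz
    have hwx := W_pos h hL x
    have h3 := lJ_lip (h.isp l) (x := x) (y := z) (M := C0 * E / W F a s p x) (fun v hv => by
      have hv' : v ∈ uIcc x (F^[a] x - p) := uIcc_subset_uIcc left_mem_uIcc hz hv
      have h4 := W_near h hL hτ hv'
      have h5 := hnl l hl v
      rw [le_div_iff₀ hwx]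
      have h6 : W F a s p x ≤ E * W F a s p v := by
        rw [← inv_mul_le_iff₀ hE0]; exact h4
      calc _ ≤ |nl (F^[l]) v| * (E * W F a s p v) := by gcongr
        _ = E * (|nl (F^[l]) v| * W F a s p v) := by ring
        _ ≤ E * C0 := by gcongr
        _ = _ := by ring)
    refine h3.trans ?_
    have h4 := W_absdiff hL hz
    rw [abs_of_pos hwx] at h4
    calc _ ≤ C0 * E / W F a s p x * W F a s p x := by gcongr
      _ = C1 := by rw [div_mul_cancel₀ _ hwx.ne']
  have ha'B : ∀ j ≤ m, j * a' ≤ B * N := by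
    intro j hj
    calc j * a' ≤ m * (2*m*N) := Nat.mul_le_mul hj h1
      _ = B * N := by rw [hB]; ring
  have hu : ∀ y, W F a' s' p' y ≤ C4 / m * W F a s p y := by
    intro y
    obtain ⟨x, hyx, hx1, hx2, _⟩ := twolev h hL hL' hτ y
    have hym : y ∈ uIcc x (F^[a] x - p) := by
      rcases hyx with rfl | hyx
      · exact left_mem_uIcc
      · rw [hyx]; exact right_mem_uIcc
    have hwx := W_pos h hL x
    have huy := W_pos h hL' y
    have hjb : ∀ j : ℕ, j ≤ m → (j:ℝ) * β' ≤ β := fun j hj => by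
      have : (j:ℝ) ≤ m := by exact_mod_cast hj
      nlinarith [hL'.pos]
    have hlow : ∀ j < m, W F a' s' p' y ≤ C3 * W F a' s' p' (F^[j*a'] y) := by
      intro j hj
      have hmone : 1 ≤ m := by omega
      have hm1 := hx1 j (hjb j hj.le)
      have hw1 := W_near h hL hτ hm1
      have hw2 : W F a s p (F^[j*a'] y - j*p') = W F a s p (F^[j*a'] y) := by
        have := W_int h (a := a) (s := s) (p := p) (F^[j*a'] y) (-(j*p'))
        push_cast at this; rw [← this]; ring_nf
      rw [hw2] at hw1
      have hw3 : W F a s p (F^[j*a'] y) ≤ E * W F a s p (F^[j*a'] x) := by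
        rcases hyx with rfl | hyx
        · nlinarith [W_pos h hL (F^[j*a'] y)]
        · have e : W F a s p (F^[j*a'] y) = W F a s p (F^[a] (F^[j*a'] x)) := by
            have := h.iint (j*a') (F^[a] x) (-p)
            push_cast at this
            rw [hyx, sub_eq_add_neg, this]
            have h7 := W_int h (a := a) (s := s) (p := p) (F^[j*a'] (F^[a] x)) (-p)
            push_cast at h7
            rw [h7, ← Function.iterate_add_apply, ← Function.iterate_add_apply, add_comm]
          rw [e]; exact (W_iter_a h hL hτ _).2
      obtain ⟨ξ, hξ, hξ2⟩ := W_mvt h (a := a) (s := s) (p := p) (j*a') x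
      obtain ⟨ζ, hζ, hζ2⟩ := W_mvt h (a := a') (s := s') (p := p') (j*a') y
      have hζ' : ζ ∈ uIcc x (F^[a] x - p) := by
        have h8 := hx1 1 (hjb 1 hmone)
        simp only [Nat.cast_one, one_mul] at h8
        exact uIcc_subset_uIcc hym h8 hζ
      have hJξ : E⁻¹ ≤ E * deriv (F^[j*a']) ξ := by
        rw [hξ2] at hw3
        have : E⁻¹ * W F a s p x ≤ (E * deriv (F^[j*a']) ξ) * W F a s p x := by linarith
        exact le_of_mul_le_mul_right this hwx
      have hJ2 : deriv (F^[j*a']) ξ ≤ Real.exp (2*C1) * deriv (F^[j*a']) ζ := by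
        rw [← lJ_exp h, ← lJ_exp h, ← Real.exp_add]
        apply Real.exp_le_exp.2
        have d1 := hdist _ (ha'B j hj.le) x ξ hξ
        have d2 := hdist _ (ha'B j hj.le) x ζ hζ'
        linarith [(abs_le.1 d1).2, (abs_le.1 d2).1]
      have hJ3 : 1 ≤ C3 * deriv (F^[j*a']) ζ := by
        have : 1 ≤ E * (E * deriv (F^[j*a']) ξ) := by
          rw [inv_le_iff_one_le_mul₀' hE0] at hJξ; exact hJξ
        calc (1:ℝ) ≤ E * (E * deriv (F^[j*a']) ξ) := this
          _ ≤ E * (E * (Real.exp (2*C1) * deriv (F^[j*a']) ζ)) := by gcongr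
          _ = _ := by rw [hC3]; ring
      rw [hζ2, ← mul_assoc]
      nlinarith
    have hsum : m * W F a' s' p' y ≤ C3 * W F a s p x := by
      calc m * W F a' s' p' y = ∑ j ∈ Finset.range m, W F a' s' p' y := by simp
        _ ≤ ∑ j ∈ Finset.range m, C3 * W F a' s' p' (F^[j*a'] y) :=
            Finset.sum_le_sum fun j hj => hlow j (Finset.mem_range.1 hj)
        _ = C3 * ∑ j ∈ Finset.range m, W F a' s' p' (F^[j*a'] y) := by rw [Finset.mul_sum]
        _ ≤ _ := by gcongr; exact hx2 m hmβ
    have hxy : W F a s p x ≤ E * W F a s p y := by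
      rw [← inv_mul_le_iff₀ hE0]; exact W_near h hL hτ hym
    rw [div_mul_eq_mul_div, le_div_iff₀ hm0]
    calc _ = m * W F a' s' p' y := by ring
      _ ≤ C3 * W F a s p x := hsum
      _ ≤ C3 * (E * W F a s p y) := by gcongr
      _ = _ := by rw [hC4]; ring
  have hρ : C4 / m ≤ σ^2 := by
    rw [div_le_iff₀ hm0]; rw [div_le_iff₀ (by positivity)] at hm; linarith
  have hu' : ∀ y, W F a' s' p' y ≤ σ^2 * W F a s p y := fun y =>
    (hu y).trans (mul_le_mul_of_nonneg_right hρ (W_pos h hL y).le)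
  intro x
  have hwx := W_pos h hL x
  constructor
  · calc _ ≤ σ^2 * W F a s p x := hu' x
      _ ≤ σ^2 * 1 := by gcongr; exact hw1 x
      _ ≤ σ * 1 := by nlinarith
      _ ≤ σ * (Ck * (2 + 2 * C0 * E) + 1) := by
          gcongr; linarith [show 0 ≤ Ck * (2 + 2 * C0 * E) by positivity]
      _ ≤ η := hσ3
  · set T := σ * W F a s p x with hT
    have hT0 : 0 < T := by positivity
    have hwin : ∀ y ∈ Icc x (x+T), |W F a s p y - W F a s p x| ≤ W F a s p x / 2 := by
      intro y hy
      have h3 := mvt (W_sm h a s p) (a := x) (b := y) (M := E) (fun z _ => by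
        rw [W_abs_deriv h hL, abs_le]
        have := J_le h hL hτ z
        have := (h.isp a).pos z
        constructor <;> linarith)
      have h4 : |y - x| ≤ T := by rw [abs_le]; constructor <;> linarith [hy.1, hy.2]
      calc _ ≤ E * |y - x| := h3
        _ ≤ E * T := by gcongr
        _ = (σ * E) * W F a s p x := by rw [hT]; ring
        _ ≤ 1/2 * W F a s p x := by gcongr
        _ = _ := by ring
    have := hlk (W F a' s' p') x T (2 * σ^2 * W F a s p x) (2 * C0 * E / W F a s p x)
      (W_sm h a' s' p') hT0 ?_ ?_ x ⟨le_rfl, by linarith⟩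
    · rw [iteratedDeriv_one] at this
      refine this.trans ?_
      have e : Ck * (2 * σ^2 * W F a s p x / T^1 + 2 * C0 * E / W F a s p x * T^1) =
          σ * (Ck * (2 + 2 * C0 * E)) := by
        rw [hT]; field_simp
      rw [e]; nlinarith
    · intro y hy
      rw [abs_of_pos (W_pos h hL' y)]
      have := (abs_le.1 (hwin y hy)).2
      calc _ ≤ σ^2 * W F a s p y := hu' y
        _ ≤ σ^2 * (2 * W F a s p x) := by gcongr; linarith
        _ = _ := by ring
    · intro y hy
      have h3 := (abs_le.1 (hwin y hy)).1
      have h4 : iteratedDeriv (1+1) (W F a' s' p') y = s' * (nl (F^[a']) y * deriv (F^[a']) y) := by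
        rw [iteratedDeriv_succ, iteratedDeriv_one]
        have e : deriv (W F a' s' p') = fun x => s' * (deriv (F^[a']) x - 1) := funext fun x => W_deriv h x
        rw [e, ← dd_eq (h.isp a')]
        have := (((h.isp a').sm.deriv.hd y).sub (hasDerivAt_const y (1:ℝ))).const_mul (s':ℝ)
        have h5 := this.deriv
        simp only [sub_zero] at h5
        exact h5
      rw [h4, abs_mul, hL'.sabs, one_mul, abs_mul, abs_of_pos ((h.isp a').pos y)]
      have h5 := hnl a' (by simpa using ha'B 1 hm1) y
      have h6 := J_le h hL' hτ y
      rw [le_div_iff₀ hwx]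
      have h7 : W F a s p x ≤ 2 * W F a s p y := by linarith
      have := (h.isp a').pos y
      calc _ ≤ |nl (F^[a']) y| * E * (2 * W F a s p y) := by gcongr
        _ = 2 * E * (|nl (F^[a']) y| * W F a s p y) := by ring
        _ ≤ 2 * E * C0 := by gcongr
        _ = _ := by ring

section main
variable {τ b1 L : ℝ} {bs : ℕ → ℝ} {F : ℝ → ℝ} {a N : ℕ} {s p : ℤ} {β : ℝ}
  {a' N' : ℕ} {s' p' : ℤ} {β' : ℝ}
variable (h : Cls τ b1 L bs F) (hL : Lev τ a N s p β) (hL' : Lev τ a' N' s' p' β')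

include h in
theorem near_w {δ : ℝ} (hδ : ∀ x, |deriv (W F a s p) x| ≤ δ) (x z : ℝ) :
    |W F a s p z - W F a s p x| ≤ δ * |z - x| := mvt (W_sm h a s p) (fun y _ => hδ y)

include h hL in
theorem near_I {δ : ℝ} (hδ : ∀ x, |deriv (W F a s p) x| ≤ δ) {x z : ℝ}
    (hz : z ∈ uIcc x (F^[a] x - p)) : |W F a s p z - W F a s p x| ≤ δ * W F a s p x := by
  have h1 := near_w h hδ x z
  have h2 := W_absdiff hL hz
  rw [abs_of_pos (W_pos h hL x)] at h2
  have : 0 ≤ δ := (abs_nonneg _).trans (hδ 0)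
  exact h1.trans (by gcongr)

include h hL in
theorem stepAJ {c δ : ℝ} (hδ : ∀ x, |deriv (W F a s p) x| ≤ δ) (hδ2 : δ ≤ 1/2) (hc : 4 * c ≤ 1)
    (hc0 : 0 ≤ c) {i : ℕ}
    (hn : ∀ x, |nl (F^[i]) x| * W F a s p x ≤ c) (x : ℝ) :
    deriv (F^[i]) x * W F a s p x ≤ 2 * W F a s p (F^[i] x) := by
  obtain ⟨ξ, hξ, hξ2⟩ := W_mvt h (a := a) (s := s) (p := p) i x
  have hwx := W_pos h hL x
  have h3 := lJ_lip (h.isp i) (x := x) (y := ξ) (M := 2 * c / W F a s p x) (fun v hv => by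
    have hv' : v ∈ uIcc x (F^[a] x - p) := uIcc_subset_uIcc left_mem_uIcc hξ hv
    have h4 := (abs_le.1 (near_I h hL hδ hv')).1
    rw [le_div_iff₀ hwx]
    have h6 : W F a s p x ≤ 2 * W F a s p v := by nlinarith
    calc _ ≤ |nl (F^[i]) v| * (2 * W F a s p v) := by gcongr
      _ = 2 * (|nl (F^[i]) v| * W F a s p v) := by ring
      _ ≤ 2 * c := by gcongr; exact hn v)
  have h4 := W_absdiff hL hξ
  rw [abs_of_pos hwx] at h4
  have h5 : |lJ F i ξ - lJ F i x| ≤ 1/2 := by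
    refine h3.trans ?_
    calc _ ≤ 2 * c / W F a s p x * W F a s p x := by gcongr
      _ = 2 * c := by rw [div_mul_cancel₀ _ hwx.ne']
      _ ≤ 1/2 := by linarith
  rw [hξ2, ← mul_assoc]
  apply mul_le_mul_of_nonneg_right _ hwx.le
  rw [← lJ_exp h, ← lJ_exp h]
  have h6 : Real.exp (1/2) ≤ 2 := by
    have h7 : Real.exp (1/2) * Real.exp (1/2) = Real.exp 1 := by rw [← Real.exp_add]; norm_num
    have := Real.exp_one_lt_d9
    nlinarith [Real.exp_pos (1/2)]
  calc Real.exp (lJ F i x) ≤ Real.exp (1/2 + lJ F i ξ) :=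
        Real.exp_le_exp.2 (by linarith [(abs_le.1 h5).1])
    _ = Real.exp (1/2) * Real.exp (lJ F i ξ) := Real.exp_add _ _
    _ ≤ _ := by gcongr

include h hL in
theorem stepA (hτ : Irrational τ) {ε C1 : ℝ} {B : ℕ} (hε : 0 < ε) (hε2 : ε ≤ 1/2)
    (hC1 : C1 = 2 + 4 * √|bs 0|) (hCε : 4 * C1 * ε ≤ 1) (hB : B * ε^6 ≤ 1)
    (hw : ∀ x, W F a s p x ≤ ε^16) (hδ : ∀ x, |deriv (W F a s p) x| ≤ ε^8) :
    ∀ l ≤ B * N, ∀ x, |nl (F^[l]) x| * W F a s p x ≤ C1 * ε^5 := by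
  have hε1 : ε ≤ 1 := by linarith
  have hC10 : 0 ≤ C1 := by rw [hC1]; positivity
  have e1 : ε^5 ≤ ε := by simpa using pow_le_pow_of_le_one hε.le hε1 (show 1 ≤ 5 by norm_num)
  have e2 : ε^8 ≤ 1/2 := le_trans (by simpa using pow_le_pow_of_le_one hε.le hε1 (show 1 ≤ 8 by norm_num)) hε2
  intro l
  induction l using Nat.strong_induction_on with
  | _ l ih =>
    intro hl x
    have := vlem h hL hτ (B := B) (l := l) (D := 2) (M := ε^16) (δ := ε^8) (κ := 2 * √|bs 0| * ε^5)
      hl (by norm_num) ?_ hw hδ (by positivity) ?_ x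
    · refine this.trans ?_
      have e3 : ε^8 ≤ ε^5 := pow_le_pow_of_le_one hε.le hε1 (by norm_num)
      rw [hC1]; nlinarith
    · intro i hi x
      refine stepAJ h hL (c := C1 * ε^5) hδ e2 ?_ (by positivity) (ih i hi (by omega)) x
      nlinarith
    · rw [mul_pow, mul_pow, Real.sq_sqrt (abs_nonneg _)]
      have : bs 0 * 2^2 * (B * ε^16) = (4 * bs 0 * ε^10) * (B * ε^6) := by ring
      rw [this]
      have e4 : 0 ≤ 4 * |bs 0| * ε^10 := by positivity
      calc _ ≤ (4 * |bs 0| * ε^10) * (B * ε^6) := by gcongr; exact le_abs_self _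
        _ ≤ (4 * |bs 0| * ε^10) * 1 := by gcongr
        _ = _ := by ring
end main

/-- derivative bounds of iterates -/
theorem stepB (bs : ℕ → ℝ) (r : ℕ) : ∃ C : ℝ, 0 ≤ C ∧ ∀ {τ b1 L : ℝ} {F : ℝ → ℝ} {a N : ℕ} {s p : ℤ} {β : ℝ}
   (_ : Cls τ b1 L bs F) (_ : Lev τ a N s p β) (_ : Irrational τ) {ε C1 : ℝ} {B : ℕ} (_ : 0 < ε) (_ : ε ≤ 1/2)
    (_ : C1 = 2 + 4 * √|bs 0|) (_ : 4 * C1 * ε ≤ 1) (_ : B * ε^6 ≤ 1)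
    (_ : ∀ x, W F a s p x ≤ ε^16) (_ : ∀ x, |deriv (W F a s p) x| ≤ ε^8),
    ∀ l ≤ B * N, ∀ x, |iteratedDeriv (r+1) (F^[l]) x| ≤
      C * deriv (F^[l]) x * ((C1+2) * ε^5 / W F a s p x)^r := by
  obtain ⟨C, hC, hh⟩ := hdJ bs r
  refine ⟨C, hC, ?_⟩
  intro τ b1 L F a N s p β h hL hτ ε C1 B hε hε2 hC1 hCε hB hw hδ l hl x
  have hε1 : ε ≤ 1 := by linarith
  have hC10 : 0 ≤ C1 := by rw [hC1]; positivity
  have e1 : ε^5 ≤ ε := by simpa using pow_le_pow_of_le_one hε.le hε1 (show 1 ≤ 5 by norm_num)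
  have e2 : ε^8 ≤ 1/2 := le_trans (by simpa using pow_le_pow_of_le_one hε.le hε1 (show 1 ≤ 8 by norm_num)) hε2
  have e3 : ε^16 ≤ ε^5 := pow_le_pow_of_le_one hε.le hε1 (by norm_num)
  have hs := stepA h hL hτ hε hε2 hC1 hCε hB hw hδ
  have hJ : ∀ i ≤ B * N, deriv (F^[i]) x * W F a s p x ≤ 2 * W F a s p (F^[i] x) := fun i hi =>
    stepAJ h hL (c := C1 * ε^5) hδ e2 (by nlinarith) (by positivity) (hs i hi) x
  have hwx := W_pos h hL x
  refine hh F x _ (B*N) h.sp h.sch_le ?_ ?_ ?_ l hl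
  · intro i hi
    rw [le_div_iff₀ hwx]
    refine (hJ i hi).trans ?_
    have := hw (F^[i] x)
    have : 0 ≤ C1 * ε^5 := by positivity
    nlinarith
  · intro i hi
    rw [le_div_iff₀ hwx]
    refine (hs i hi x).trans ?_
    have : 0 ≤ 2 * ε^5 := by positivity
    nlinarith
  · rw [div_pow, le_div_iff₀ (by positivity), Finset.sum_mul]
    calc _ ≤ ∑ i ∈ Finset.range (B*N), 4 * ε^16 * W F a s p (F^[i] x) := by
          apply Finset.sum_le_sum
          intro i hi
          have h1 := hJ i (Finset.mem_range.1 hi).le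
          have h2 := W_pos h hL (F^[i] x)
          have h3 := hw (F^[i] x)
          have h4 := (h.isp i).pos x
          calc _ = (deriv (F^[i]) x * W F a s p x)^2 := by ring
            _ ≤ (2 * W F a s p (F^[i] x))^2 := by gcongr
            _ = 4 * W F a s p (F^[i] x) * W F a s p (F^[i] x) := by ring
            _ ≤ _ := by gcongr
      _ = 4 * ε^16 * ∑ i ∈ Finset.range (B*N), W F a s p (F^[i] x) := by rw [Finset.mul_sum]
      _ ≤ 4 * ε^16 * B := by gcongr; exact W_sum h hL hτ le_rfl x
      _ = 4 * ε^10 * (B * ε^6) := by ring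
      _ ≤ 4 * ε^10 * 1 := by gcongr
      _ = 2^2 * ε^10 := by norm_num
      _ ≤ (C1+2)^2 * ε^10 := by gcongr; linarith
      _ = _ := by ring

/-- the derivative of `u` -/
theorem stepC (L : ℝ) (bs : ℕ → ℝ) (r : ℕ) (hr : 1 ≤ r) : ∃ C : ℝ, 0 ≤ C ∧
  ∀ {τ b1 : ℝ} {F : ℝ → ℝ} {a N : ℕ} {s p : ℤ} {β : ℝ} {a' N' : ℕ} {s' p' : ℤ} {β' : ℝ}
   (_ : Cls τ b1 L bs F) (_ : Lev τ a N s p β) (_ : Lev τ a' N' s' p' β') 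
   (_ : Irrational τ) {ε C1 R : ℝ} {B : ℕ} (_ : 0 < ε) (_ : ε ≤ 1/2)
    (_ : C1 = 2 + 4 * √|bs 0|) (_ : 4 * C1 * ε ≤ 1) (_ : B * ε^6 ≤ 1)
    (_ : ∀ x, W F a s p x ≤ ε^16) (_ : ∀ x, |deriv (W F a s p) x| ≤ ε^8)
    (_ : a' ≤ B * N) (_ : ∀ x, W F a' s' p' x ≤ R * W F a s p x),
    ∀ x, |deriv (W F a' s' p') x| ≤ C * (R * ε^4 + ε^r) := by
  obtain ⟨Ck, hCk, hlk⟩ := lk r 1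
  obtain ⟨C, hC, hh⟩ := stepB bs r
  set C1 := 2 + 4 * √|bs 0| with hC1
  have hC10 : 0 ≤ C1 := by positivity
  refine ⟨Ck * (2 + C * Real.exp (3*L) * (2 * (C1 + 2))^r), by positivity, ?_⟩
  intro τ b1 F a N s p β a' N' s' p' β' h hL hL' hτ ε C1' R B hε hε2 hC1' hCε hB hw hδ ha' hR x
  have hCC : C1' = C1 := hC1'
  subst hCC
  have hε1 : ε ≤ 1 := by linarith
  have hwx := W_pos h hL x
  have hR0 : 0 < R := by
    have := (W_pos h hL' x).trans_le (hR x)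
    exact pos_of_mul_pos_left this hwx.le
  set T := W F a s p x / ε^4 with hT
  have hT0 : 0 < T := by positivity
  have e4 : ε^4 ≤ 1/2 := le_trans (by simpa using pow_le_pow_of_le_one hε.le hε1 (show 1 ≤ 4 by norm_num)) hε2
  have hwin : ∀ y ∈ Icc x (x+T), |W F a s p y - W F a s p x| ≤ W F a s p x / 2 := by
    intro y hy
    have h3 := near_w h hδ x y
    have h4 : |y - x| ≤ T := by rw [abs_le]; constructor <;> linarith [hy.1, hy.2]
    calc _ ≤ ε^8 * |y - x| := h3
      _ ≤ ε^8 * T := by gcongr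
      _ = ε^4 * W F a s p x := by rw [hT]; field_simp
      _ ≤ 1/2 * W F a s p x := by gcongr
      _ = _ := by ring
  have := hlk (W F a' s' p') x T (R * (2 * W F a s p x)) 
      (C * Real.exp (3*L) * ((2*(C1+2)) * ε^5 / W F a s p x)^r)
      (W_sm h a' s' p') hT0 ?_ ?_ x ⟨le_rfl, by linarith⟩
  · rw [iteratedDeriv_one] at this
    refine this.trans ?_
    have e : Ck * (R * (2 * W F a s p x) / T^1 + 
      C * Real.exp (3*L) * ((2*(C1+2)) * ε^5 / W F a s p x)^r * T^r) =
        Ck * (2 * (R * ε^4) + C * Real.exp (3*L) * (2*(C1+2))^r * ε^r) := by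
      have e5 : ((2*(C1+2)) * ε^5 / W F a s p x)^r * T^r = (2*(C1+2))^r * ε^r := by
        rw [← mul_pow, ← mul_pow]; congr 1; rw [hT]; field_simp
      rw [mul_assoc (C * Real.exp (3*L)), e5, hT]; field_simp
    rw [e]
    have h1 : 0 ≤ C * Real.exp (3*L) * (2*(C1+2))^r := by positivity
    have h2 : 0 ≤ R * ε^4 := by positivity
    have h3 : 0 ≤ ε^r := by positivity
    rw [mul_assoc Ck]
    apply mul_le_mul_of_nonneg_left _ hCk
    nlinarith [mul_nonneg h1 h2]
  · intro y hy
    rw [abs_of_pos (W_pos h hL' y)]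
    refine (hR y).trans ?_
    have := (abs_le.1 (hwin y hy)).2
    gcongr; linarith
  · intro y hy
    have h3 := (abs_le.1 (hwin y hy)).1
    have hwy := W_pos h hL y
    have h4 : iteratedDeriv (1+r) (W F a' s' p') y = s' * iteratedDeriv (r+1) (F^[a']) y := by
      rw [add_comm 1 r, iteratedDeriv_succ', iteratedDeriv_succ']
      have e : deriv (W F a' s' p') = fun x => s' * (deriv (F^[a']) x - 1) := funext fun x => W_deriv h x
      rw [e, iteratedDeriv_const_mul_field]
      obtain ⟨k, rfl⟩ : ∃ k, r = k + 1 := ⟨r - 1, by omega⟩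
      rw [iteratedDeriv_succ', iteratedDeriv_succ']
      congr 2
      funext z; rw [deriv_sub_const]
    rw [h4, abs_mul, hL'.sabs, one_mul]
    refine (hh h hL hτ hε hε2 rfl hCε hB hw hδ a' ha' y).trans ?_
    have h6 := J_le h hL' hτ y
    have h7 : (C1+2) * ε^5 / W F a s p y ≤ (2*(C1+2)) * ε^5 / W F a s p x := by
      rw [div_le_div_iff₀ hwy hwx]
      have : W F a s p x ≤ 2 * W F a s p y := by linarith
      calc _ ≤ (C1+2) * ε^5 * (2 * W F a s p y) := by gcongr
        _ = _ := by ring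
    gcongr

set_option maxHeartbeats 1000000 in
/-- main step -/
theorem mainstep {τ : ℝ} (hτ : Irrational τ) (b1 L : ℝ) (bs : ℕ → ℝ) (r : ℕ) (hr : 1 ≤ r) :
  ∃ C ε0 : ℝ, 0 < C ∧ 0 < ε0 ∧ ∀ ε : ℝ, 0 < ε → ε ≤ ε0 → 
   ∀ (a N : ℕ) (s p : ℤ) (β : ℝ) (a' N' : ℕ) (s' p' : ℤ) (β' : ℝ),
   Lev τ a N s p β → Lev τ a' N' s' p' β' → ∀ B : ℕ, B * ε^6 ≤ 1 → a' ≤ B * N → 2 * β' ≤ β →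
   ∀ F, Cls τ b1 L bs F → (∀ x, W F a s p x ≤ ε^16) → (∀ x, |deriv (W F a s p) x| ≤ ε^8) →
   ∀ y, |deriv (W F a' s' p') y| ≤ C * (β'/β * ε^4 + ε^r) ∧ 
    W F a' s' p' y ≤ C * (β'/β + ε^r) * W F a s p y ∧
    |W F a' s' p' y / (β'/β) - W F a s p y| ≤ C * (β'/β + ε^4 + ε^r/(β'/β)) * W F a s p y := by
  obtain ⟨K, hK, h4⟩ := stepC L bs r hr
  set C1 := 2 + 4 * √|bs 0| with hC1
  have hC10 : 0 < C1 := by positivity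
  set C' := 8 + K * 8 + K * (4 * K + 1) + 4 * K with hC'
  have hC'0 : 0 < C' := by positivity
  refine ⟨C' + 2 + 8 * C', min (1/2) (min (1/(4*C1)) (1/(4*K+1))), by positivity, by positivity, ?_⟩
  intro ε hε hε0 a N s p β a' N' s' p' β' hL hL' B hB ha' hββ F h hw hδ
  have hε2 : ε ≤ 1/2 := hε0.trans (min_le_left _ _)
  have hε1 : ε ≤ 1 := by linarith
  have hCε : 4 * C1 * ε ≤ 1 := by
    have := hε0.trans ((min_le_right _ _).trans (min_le_left _ _))
    rw [le_div_iff₀ (by positivity)] at this; linarith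
  have hKε : 4 * K * ε ≤ 1 := by
    have := hε0.trans ((min_le_right _ _).trans (min_le_right _ _))
    rw [le_div_iff₀ (by positivity)] at this; nlinarith
  have e4 : ε^4 ≤ ε := by simpa using pow_le_pow_of_le_one hε.le hε1 (show 1 ≤ 4 by norm_num)
  have e84 : ε^8 ≤ ε^4 := pow_le_pow_of_le_one hε.le hε1 (by norm_num)
  have hβ := hL.pos
  have hβ' := hL'.pos
  set θ := β'/β with hθ
  have hθ0 : 0 < θ := by positivity
  have hθ2 : θ ≤ 1/2 := by rw [hθ, div_le_iff₀ hβ]; linarith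
  set u := W F a' s' p' with hu
  set w := W F a s p with hwd
  have hw0 : ∀ x, 0 < w x := W_pos h hL
  have hu0 : ∀ x, 0 < u x := W_pos h hL'
  -- geometry
  have hI : ∀ {x z : ℝ}, z ∈ uIcc x (F^[a] x - p) → |w z - w x| ≤ ε^8 * w x := fun hz => near_I h hL hδ hz
  have hI2 : ∀ {x z : ℝ}, z ∈ uIcc x (F^[a] x - p) → w x ≤ 2 * w z := fun {x z} hz => by
    have := (abs_le.1 (hI hz)).1
    nlinarith [hw0 x]
  have hym : ∀ {x y : ℝ}, (y = x ∨ y = F^[a] x - p) → y ∈ uIcc x (F^[a] x - p) := by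
    rintro x y (rfl | rfl)
    · exact left_mem_uIcc
    · exact right_mem_uIcc
  -- maximal ratio
  obtain ⟨x0, hx0⟩ := per_max (f := fun x => u x / w x) 
    ((W_sm h a' s' p').continuous.div (W_sm h a s p).continuous (fun x => (hw0 x).ne'))
    (fun x => by simp only [hu, hwd]; rw [W_per h, W_per h])
  set R := u x0 / w x0 with hR
  have hR0 : 0 < R := div_pos (hu0 x0) (hw0 x0)
  have huR : ∀ x, u x ≤ R * w x := fun x => by
    have := hx0 x
    rwa [div_le_iff₀ (hw0 x)] at this
  have hud := h4 h hL hL' hτ hε hε2 hC1 hCε hB hw hδ ha' huR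
  -- number of steps
  set m := ⌊β/β'⌋₊ with hm
  have hm1 : (m:ℝ) * β' ≤ β := by
    have := Nat.floor_le (show 0 ≤ β/β' by positivity)
    rwa [le_div_iff₀ hβ'] at this
  have hm2 : β ≤ ((m+1 : ℕ):ℝ) * β' := by
    have := (Nat.lt_floor_add_one (β/β')).le
    rw [div_le_iff₀ hβ'] at this
    push_cast; exact this
  have hmθ : m * θ ≤ 1 := by rw [hθ, ← mul_div_assoc, div_le_one hβ]; exact hm1
  have hmθ2 : 1 ≤ (m+1) * θ := by rw [hθ, ← mul_div_assoc, le_div_iff₀ hβ]; push_cast at hm2; linarith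
  -- counting
  have count : ∀ (Ω : ℝ), (∀ x, |deriv u x| ≤ Ω) → ∀ y, ∃ x, |w x - w y| ≤ 2 * ε^8 * w y ∧ w x ≤ 2 * w y ∧
      m * (u y - Ω * w x) ≤ w x ∧ w x ≤ (m+1) * (u y + Ω * w x) := by
    intro Ω hΩ y
    obtain ⟨x, hyx, c1, c2, c3⟩ := twolev h hL hL' hτ y
    have hy := hym hyx
    have hΩ0 : 0 ≤ Ω := (abs_nonneg _).trans (hΩ 0)
    have hxy2 := hI2 hy
    have hd : ∀ j ≤ m, |u (F^[j*a'] y) - u y| ≤ Ω * w x := by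
      intro j hj
      have hmem := c1 j (by
        have : (j:ℝ) ≤ m := by exact_mod_cast hj
        nlinarith)
      have e : u (F^[j*a'] y) = u (F^[j*a'] y - j*p') := by
        have := W_int h (a := a') (s := s') (p := p') (F^[j*a'] y) (-(j*p'))
        rw [hu, ← this]; push_cast; ring_nf
      rw [e]
      have h5 := mvt (W_sm h a' s' p') (a := y) (b := F^[j*a'] y - j*p') (fun z _ => hΩ z)
      have h6 : |F^[j*a'] y - j*p' - y| ≤ w x := by
        have h7 := abs_sub_le_of_uIcc_subset_uIcc (uIcc_subset_uIcc hy hmem)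
        refine h7.trans ?_
        have := W_absdiff hL (right_mem_uIcc (a := x) (b := F^[a] x - p))
        rwa [abs_of_pos (hw0 x)] at this
      exact h5.trans (by gcongr)
    refine ⟨x, ?_, hxy2, ?_, ?_⟩
    · rw [abs_sub_comm]
      refine (hI hy).trans ?_
      have : 0 < ε^8 := by positivity
      nlinarith
    · have := c2 m hm1
      refine le_trans ?_ this
      calc m * (u y - Ω * w x) = ∑ i ∈ Finset.range m, (u y - Ω * w x) := by
            rw [Finset.sum_const, Finset.card_range, nsmul_eq_mul]
        _ ≤ _ := Finset.sum_le_sum fun j hj => by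
          have := (abs_le.1 (hd j (Finset.mem_range.1 hj).le)).1
          linarith
    · have := c3 (m+1) hm2
      refine le_trans this ?_
      calc _ ≤ ∑ i ∈ Finset.range (m+1), (u y + Ω * w x) := Finset.sum_le_sum fun j hj => by
            have := (abs_le.1 (hd j (by have := Finset.mem_range.1 hj; omega))).2
            linarith
        _ = _ := by rw [Finset.sum_const, Finset.card_range, nsmul_eq_mul]; push_cast; ring
  have hmhalf : 1 ≤ 2 * θ * m := by nlinarith
  have hεr : 0 < ε^r := by positivity
  have hε4 : 0 < ε^4 := by positivity
  -- bound on R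
  have hRb : R ≤ 8 * θ + 4 * K * ε^r := by
    obtain ⟨x, _, g1, g2, _⟩ := count _ hud x0
    set Ω := K * (R * ε^4 + ε^r) with hΩ
    have hΩ0 : 0 ≤ Ω := by positivity
    have k1 : u x0 ≤ 2 * θ * w x + Ω * w x := by
      by_cases hneg : u x0 - Ω * w x ≤ 0
      · have := mul_pos hθ0 (hw0 x)
        linarith
      · push Not at hneg
        have : (u x0 - Ω * w x) ≤ 2 * θ * (m * (u x0 - Ω * w x)) := by
          have := mul_le_mul_of_nonneg_right hmhalf hneg.le
          linarith
        have k0 := mul_le_mul_of_nonneg_left g2 (show 0 ≤ 2 * θ by positivity)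
        linarith
    have k2 : R * w x0 ≤ (2 * θ + Ω) * (2 * w x0) := by
      rw [hR, div_mul_cancel₀ _ (hw0 x0).ne']
      calc _ ≤ (2 * θ + Ω) * w x := by linarith
        _ ≤ _ := by gcongr
    have k3 : R ≤ 2 * (2 * θ + Ω) := by
      refine le_of_mul_le_mul_right ?_ (hw0 x0)
      linarith
    have k4 : K * (R * ε^4) ≤ R / 4 := by
      have : K * ε^4 ≤ 1/4 := by have := mul_le_mul_of_nonneg_left e4 hK; linarith
      have := mul_le_mul_of_nonneg_left this hR0.le
      linarith
    rw [hΩ] at k3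
    linarith
  have hub : ∀ y, u y ≤ C' * (θ + ε^r) * w y := by
    intro y
    refine (huR y).trans ?_
    have : R ≤ C' * (θ + ε^r) := by
      have t1 : 0 ≤ K * θ := by positivity
      have t2 : 0 ≤ K * K * θ := by positivity
      have t3 : 0 ≤ K * K * ε^r := by positivity
      have t4 : 0 ≤ K * ε^r := by positivity
      rw [hC']; linarith
    exact mul_le_mul_of_nonneg_right this (hw0 y).le
  have hdb : ∀ y, |deriv u y| ≤ C' * (θ * ε^4 + ε^r) := by
    intro y
    refine (hud y).trans ?_
    have s0 : ε^4 ≤ 1 := by linarith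
    have s1 : R * ε^4 ≤ 8 * (θ * ε^4) + 4 * K * ε^r := by
      calc R * ε^4 ≤ (8 * θ + 4 * K * ε^r) * ε^4 := by gcongr
        _ = 8 * (θ * ε^4) + 4 * K * ε^r * ε^4 := by ring
        _ ≤ 8 * (θ * ε^4) + 4 * K * ε^r * 1 := by gcongr
        _ = _ := by ring
    calc K * (R * ε^4 + ε^r) ≤ K * (8 * (θ * ε^4) + 4 * K * ε^r + ε^r) := by gcongr
      _ = K * 8 * (θ * ε^4) + K * (4*K+1) * ε^r := by ring
      _ ≤ _ := by
        have t1 : 0 ≤ K * (4*K+1) * (θ * ε^4) := by positivity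
        have t2 : 0 ≤ K * 8 * ε^r := by positivity
        have t3 : 0 ≤ (8 + 4 * K) * (θ * ε^4 + ε^r) := by positivity
        rw [hC']; linarith
  intro y
  have hwy := hw0 y
  refine ⟨(hdb y).trans ?_, (hub y).trans ?_, ?_⟩
  · gcongr; linarith
  · gcongr; linarith
  · obtain ⟨x, g0, g1, g2, g3⟩ := count _ hdb y
    have huy := hu0 y
    have hub' := hub y
    set om := C' * (θ * ε^4 + ε^r) * w x with hom
    have hom0 : 0 ≤ om := by have := hw0 x; positivity
    have homθ : om / θ ≤ 2 * C' * (ε^4 + ε^r/θ) * w y := by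
      have : om / θ = C' * (ε^4 + ε^r/θ) * w x := by rw [hom]; field_simp
      rw [this]
      calc _ ≤ C' * (ε^4 + ε^r/θ) * (2 * w y) := by gcongr
        _ = _ := by ring
    have homom : om ≤ om / θ := by rw [le_div_iff₀ hθ0]; nlinarith
    have hw8 : |w x - w y| ≤ 2 * ε^4 * w y := g0.trans (by gcongr)
    have hi1 : (m:ℝ) ≤ 1/θ := by rw [le_div_iff₀ hθ0]; exact hmθ
    have hi2 : 1/θ ≤ m + 1 := by rw [div_le_iff₀ hθ0]; exact hmθ2
    have eu : u y / θ = u y * (1/θ) := by ring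
    have eo : om / θ = om * (1/θ) := by ring
    have hup : u y / θ ≤ w x + om / θ + u y := by
      rw [eu, eo]
      nlinarith [mul_le_mul_of_nonneg_left hi2 huy.le, mul_le_mul_of_nonneg_left hi1 hom0]
    have hlo : w x ≤ u y / θ + u y + om / θ + om := by
      rw [eu, eo]
      nlinarith [mul_le_mul_of_nonneg_left hi1 huy.le, mul_le_mul_of_nonneg_left hi1 hom0]
    have hrθ : ε^r ≤ ε^r / θ := by rw [le_div_iff₀ hθ0]; nlinarith
    have hab : |u y / θ - w y| ≤ 2 * ε^4 * w y + C' * (θ + ε^r) * w y + 2 * (2 * C' * (ε^4 + ε^r/θ) * w y) := by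
      rw [abs_le] at hw8 ⊢
      constructor <;> linarith [hw8.1, hw8.2, homom.trans homθ]
    refine hab.trans ?_
    have t1 : C' * ε^r * w y ≤ C' * (ε^r/θ) * w y := by gcongr
    have t2 : 0 ≤ C' * θ * w y := by positivity
    have t3 : 0 ≤ C' * ε^4 * w y := by positivity
    have t4 : 0 ≤ C' * (ε^r/θ) * w y := by positivity
    have t5 : 0 ≤ θ * w y := by positivity
    have t6 : 0 ≤ (ε^r/θ) * w y := by positivity
    linarith

theorem num1 {C ε θ q : ℝ} (hC : 0 < C) (hε : 0 < ε) (hθ : 0 < θ) (hq : 0 < q) (h1 : θ ≤ 4 * ε^6)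
    (h2 : θ ≤ q^48) (h3 : 8 * C * ε ≤ 1) : C * (θ * ε^4) ≤ (q * ε)^8 / 2 := by
  refine le_of_pow_le_pow_left₀ (n := 6) (by norm_num) (by positivity) ?_
  have h4 : (8 * C * ε)^6 ≤ 1 := pow_le_one₀ (by positivity) h3
  calc (C * (θ * ε^4))^6 = C^6 * ε^24 * (θ * θ^5) := by ring
    _ ≤ C^6 * ε^24 * (q^48 * (4*ε^6)^5) := by gcongr
    _ = (q*ε)^48 * (8 * C * ε)^6 / 256 := by ring
    _ ≤ (q*ε)^48 * 1 / 256 := by gcongr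
    _ ≤ (q*ε)^48 / 64 := by have : 0 < (q*ε)^48 := by positivity
                            linarith
    _ = _ := by ring

theorem num2 {C ε θ q : ℝ} (hC : 0 < C) (hε : 0 < ε) (hε1 : ε ≤ 1) (hθ : 0 < θ) (hq : 0 < q) (h1 : θ ≤ 4 * ε^6)
    (h2 : θ ≤ q^48) (h3 : 8 * C * ε ≤ 1) : C * θ ≤ q^16 / 2 := by
  refine le_of_pow_le_pow_left₀ (n := 3) (by norm_num) (by positivity) ?_
  have h4 : (8 * C * ε)^3 ≤ 1 := pow_le_one₀ (by positivity) h3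
  calc (C * θ)^3 = C^3 * (θ * θ^2) := by ring
    _ ≤ C^3 * (q^48 * (4*ε^6)^2) := by gcongr
    _ = q^48 * ((8 * C * ε)^3 * ε^9) / 32 := by ring
    _ ≤ q^48 * (1 * 1) / 32 := by gcongr; exact pow_le_one₀ hε.le hε1
    _ ≤ q^48 / 8 := by have : 0 < q^48 := by positivity
                       linarith
    _ = _ := by ring

theorem stepE {τ c : ℝ} (hτ : Irrational τ) (b1 L : ℝ) (bs : ℕ → ℝ) {n : ℕ} (hc : 0 < c) (hc2 : c ≤ 1/2)
   (hn : 1 ≤ n) (hD : ∀ a : ℕ, 0 < a → ∀ p : ℤ, c / a^n ≤ |a * τ - p|) :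
   ∃ es : ℝ, 0 < es ∧ es ≤ 1/1000 ∧ ∀ m : ℕ, 48 ≤ m → ∀ (ε : ℝ) (a N : ℕ) (s p : ℤ) (β : ℝ), 
    0 < ε → ε ≤ es → Lev τ a N s p β → ε^m ≤ β → 
    (∀ F, Cls τ b1 L bs F → ∀ x, W F a s p x ≤ ε^16 ∧ |deriv (W F a s p) x| ≤ ε^8) →
    ∃ (ε' : ℝ) (a' N' : ℕ) (s' p' : ℤ) (β' : ℝ) (B : ℕ), 
      0 < ε' ∧ ε' ≤ ε/2 ∧ Lev τ a' N' s' p' β' ∧ ε'^m ≤ β' ∧ 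
      (∀ F, Cls τ b1 L bs F → ∀ x, W F a' s' p' x ≤ ε'^16 ∧ |deriv (W F a' s' p') x| ≤ ε'^8) ∧
      B * ε^6 ≤ 1 ∧ a' ≤ B * N ∧ 2 * β' ≤ β ∧ β' ≤ 4 * ε^6 * β ∧ c * ε^((m+6)*n) ≤ β' := by
  set r := 32*n+1 with hr
  obtain ⟨C, ε0, hC, hε0, hms⟩ := mainstep hτ b1 L bs r (by omega)
  refine ⟨min (1/1000) (min ε0 (min (1/(8*C)) (c^16/(2*C)))), by positivity, min_le_left _ _, ?_⟩
  intro m hm ε a N s p β hε hεs hL hεβ hF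
  have hε1000 : ε ≤ 1/1000 := hεs.trans (min_le_left _ _)
  have hεε0 : ε ≤ ε0 := hεs.trans ((min_le_right _ _).trans (min_le_left _ _))
  have h8C : 8 * C * ε ≤ 1 := by
    have := hεs.trans ((min_le_right _ _).trans ((min_le_right _ _).trans (min_le_left _ _)))
    rw [le_div_iff₀ (by positivity)] at this; linarith
  have hcC : 2 * C * ε ≤ c^16 := by
    have := hεs.trans ((min_le_right _ _).trans ((min_le_right _ _).trans (min_le_right _ _)))
    rw [le_div_iff₀ (by positivity)] at this; linarith
  have hε1 : ε ≤ 1 := by linarith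
  have hβ := hL.pos
  set B := ⌊1/ε^6⌋₊ with hB
  have hB1 : B * ε^6 ≤ 1 := by
    have := Nat.floor_le (show 0 ≤ 1/ε^6 by positivity)
    rwa [le_div_iff₀ (by positivity)] at this
  have hε6 : ε^6 ≤ (1/1000)^6 := by gcongr
  have hB2 : 1 ≤ 2 * (B * ε^6) := by
    have := (Nat.lt_floor_add_one (1/ε^6)).le
    rw [div_le_iff₀ (by positivity), ← hB] at this
    norm_num at hε6
    linarith
  have hBN : (0:ℝ) < B * N := by
    have h1 : (0:ℝ) < B := pos_of_mul_pos_left (by linarith : 0 < B * ε^6) (by positivity)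
    have h2 : (0:ℝ) < N := by have := hL.aN; exact_mod_cast (by omega : 0 < N)
    positivity
  obtain ⟨a', N', s', p', β', hL', ha', hN'⟩ := exists_lev hτ (B*N) (by exact_mod_cast hBN)
  have hβ' := hL'.pos
  have hN'r : (B:ℝ) * N ≤ N' := by exact_mod_cast hN'.le
  -- θ ≤ 4 ε^6
  have h46 : β' ≤ 4 * ε^6 * β := by
    have h1 := hL'.Nβ
    have h2 := hL.le2
    have hN : (0:ℝ) ≤ N := by positivity
    have h3 : B * N * β' ≤ 2 * N * β := (mul_le_mul_of_nonneg_right hN'r hβ'.le).trans (h1.trans h2)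
    have hN0 : (0:ℝ) < N := by have := hL.aN; exact_mod_cast (by omega : 0 < N)
    have h4 : B * β' ≤ 2 * β := by
      refine le_of_mul_le_mul_left ?_ hN0; linarith
    calc β' ≤ (2 * (B * ε^6)) * β' := le_mul_of_one_le_left hβ'.le hB2
      _ = 2 * ε^6 * (B * β') := by ring
      _ ≤ 2 * ε^6 * (2 * β) := by gcongr
      _ = _ := by ring
  have h2β : 2 * β' ≤ β := by
    have : 4 * ε^6 ≤ 1/2 := by norm_num at hε6; linarith
    nlinarith
  -- lower bound
  have hlow : c * ε^((m+6)*n) ≤ β' := by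
    have ha0 : (0:ℝ) < a' := by exact_mod_cast hL'.apos
    have h1 := hD a' hL'.apos p'
    rw [hL'.abs_eq] at h1
    refine le_trans ?_ h1
    rw [le_div_iff₀ (by positivity)]
    have h2 : (a':ℝ) * ε^(m+6) ≤ 1 := by
      have h3 : (a':ℝ) ≤ B * N := by exact_mod_cast ha'
      calc (a':ℝ) * ε^(m+6) ≤ (B * N) * ε^(m+6) := by gcongr
        _ = (B * ε^6) * (N * ε^m) := by ring
        _ ≤ 1 * (N * β) := by gcongr
        _ ≤ 1 := by rw [one_mul]; exact hL.Nβ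
    calc c * ε^((m+6)*n) * a'^n = c * (a' * ε^(m+6))^n := by rw [mul_pow, pow_mul]; ring
      _ ≤ c * 1 := by gcongr; exact pow_le_one₀ (by positivity) h2
      _ = c := mul_one c
  -- new epsilon
  obtain ⟨e, he0, hem⟩ : ∃ e : ℝ, 0 < e ∧ e^m = β' := 
    ⟨β'^((m:ℝ)⁻¹), by positivity, by
      rw [← Real.rpow_natCast, ← Real.rpow_mul hβ'.le, inv_mul_cancel₀ (by exact_mod_cast (by omega : m ≠ 0)), Real.rpow_one]⟩
  set ε' := min (ε/2) e with hε'
  have hε'0 : 0 < ε' := by positivity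
  have hε'm : ε'^m ≤ β' := by rw [← hem]; gcongr; exact min_le_right _ _
  have he1 : c * ε^(2*n) ≤ e := by
    refine le_of_pow_le_pow_left₀ (n := m) (by omega) he0.le ?_
    rw [hem]; refine le_trans ?_ hlow
    rw [mul_pow, ← pow_mul]
    have : c^m ≤ c := by simpa using pow_le_pow_of_le_one hc.le (by linarith) (show 1 ≤ m by omega)
    have h2 : ε^(2*n*m) ≤ ε^((m+6)*n) := pow_le_pow_of_le_one hε.le hε1 (by nlinarith)
    gcongr
  have he2 : c * ε^(2*n) ≤ ε' := by
    refine le_min ?_ he1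
    have : ε^(2*n) ≤ ε := by simpa using pow_le_pow_of_le_one hε.le hε1 (show 1 ≤ 2*n by omega)
    calc c * ε^(2*n) ≤ 1/2 * ε := by gcongr
      _ = _ := by ring
  set θ := β'/β with hθ
  have hθ0 : 0 < θ := by positivity
  have hθ1 : θ ≤ 4 * ε^6 := by rw [hθ, div_le_iff₀ hβ]; exact h46
  set q := ε'/ε with hq
  have hq0 : 0 < q := by positivity
  have hqε : q * ε = ε' := by rw [hq]; field_simp
  have hθq : θ ≤ q^48 := by
    rcases min_choice (ε/2) e with h1 | h1
    · have : q = 1/2 := by rw [hq, hε', h1]; field_simp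
      rw [this]; refine hθ1.trans ?_
      norm_num at hε6 ⊢
      linarith
    · have hqe : q = e/ε := by rw [hq, hε', h1]
      have hq1 : q ≤ 1 := by
        have : ε' ≤ ε/2 := min_le_left _ _
        rw [hq, div_le_one hε]; linarith
      refine le_trans ?_ (pow_le_pow_of_le_one hq0.le hq1 hm)
      rw [hqe, div_pow, hem, hθ]
      gcongr
  have hr1 : C * ε^r ≤ c^16 * ε^(32*n) / 2 := by
    rw [hr, pow_succ]
    have := mul_le_mul_of_nonneg_right hcC (show 0 ≤ ε^(32*n) by positivity)
    linarith
  have hc1 : c ≤ 1 := by linarith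
  have hq16 : c^16 * ε^(32*n) ≤ q^16 := by
    have : c * ε^(2*n) ≤ q := by
      rw [hq, le_div_iff₀ hε]
      exact (mul_le_of_le_one_right (by positivity) hε1).trans he2
    calc _ = (c * ε^(2*n))^16 := by ring
      _ ≤ _ := by gcongr
  have hq8 : c^16 * ε^(32*n) ≤ ε'^8 := by
    calc c^16 * ε^(32*n) ≤ c^8 * ε^(16*n) := by
          gcongr ?_ * ?_
          · exact pow_le_pow_of_le_one hc.le hc1 (by norm_num)
          · exact pow_le_pow_of_le_one hε.le hε1 (by omega)
      _ = (c * ε^(2*n))^8 := by ring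
      _ ≤ _ := by gcongr
  refine ⟨ε', a', N', s', p', β', B, hε'0, min_le_left _ _, hL', hε'm, ?_, hB1, ha', h2β, h46, hlow⟩
  intro F h x
  obtain ⟨g1, g2, _⟩ := hms ε hε hεε0 a N s p β a' N' s' p' β' hL hL' B hB1 ha' h2β F h (fun x => (hF F h x).1)
    (fun x => (hF F h x).2) x
  rw [← hθ] at g1 g2
  constructor
  · have k := num2 hC hε hε1 hθ0 hq0 hθ1 hθq h8C
    have hw := (hF F h x).1
    calc _ ≤ _ := g2
      _ ≤ q^16 * W F a s p x := by
        refine mul_le_mul_of_nonneg_right ?_ (W_pos h hL x).le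
        linarith
      _ ≤ q^16 * ε^16 := by gcongr
      _ = _ := by rw [← mul_pow, hqε]
  · have k := num1 hC hε hθ0 hq0 hθ1 hθq h8C
    rw [hqε] at k
    linarith

/-- crude lower bound for the displacement -/
theorem W_crude {τ : ℝ} (hτ : Irrational τ) (b1 L : ℝ) (bs : ℕ → ℝ) {a N : ℕ} {s p : ℤ} {β : ℝ} 
    (hL : Lev τ a N s p β) : ∃ e : ℝ, 0 < e ∧ ∀ F, Cls τ b1 L bs F → ∀ x, e ≤ W F a s p x := by
  obtain ⟨k, hk⟩ := exists_nat_gt (1/β)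
  have hβ := hL.pos
  rw [div_lt_iff₀ hβ] at hk
  have hk0 : (0:ℝ) < k := pos_of_mul_pos_left (by linarith) hβ.le
  set E := Real.exp (3*L) with hE
  have hE0 : 0 < E := Real.exp_pos _
  refine ⟨1/(k * E^k), by positivity, fun F h x => ?_⟩
  have hw := W_pos h hL x
  have hE1 : 1 ≤ E := E_one h
  have h1 : ∀ j : ℕ, W F a s p (F^[j*a] x) ≤ E^j * W F a s p x := by
    intro j
    induction j with
    | zero => simp
    | succ j ih =>
      have := (W_iter_a h hL hτ (F^[j*a] x)).2
      rw [← Function.iterate_add_apply, show a + j*a = (j+1)*a by ring] at this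
      refine this.trans ?_
      rw [pow_succ]
      calc _ ≤ E * (E^j * W F a s p x) := by gcongr
        _ = _ := by ring
  have h2 : 1 ≤ ∑ i ∈ Finset.range k, W F a s p (F^[i*a] x) := by
    rw [W_sum_tel h]
    have h3 := h.ordS hL.hs 0 (k*a) s (-(k*p)) (by
      have h5 := hL.ss
      have h4 := hL.hβ
      push_cast
      have : (s:ℝ) * (k * a * τ + -(k*p)) = k * β := by rw [h4]; ring
      rw [this]; linarith) x
    simp only [Function.iterate_zero, id] at h3
    have h5 := hL.ss
    push_cast at h3
    linarith
  have h3 : ∑ i ∈ Finset.range k, W F a s p (F^[i*a] x) ≤ ∑ i ∈ Finset.range k, E^k * W F a s p x := by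
    refine Finset.sum_le_sum fun j hj => (h1 j).trans ?_
    have : j ≤ k := (Finset.mem_range.1 hj).le
    gcongr
  rw [Finset.sum_const, Finset.card_range, nsmul_eq_mul] at h3
  rw [div_le_iff₀ (by positivity)]
  linarith

structure Sta (τ b1 L : ℝ) (bs : ℕ → ℝ) (m : ℕ) (es : ℝ) where
  ε : ℝ
  a : ℕ
  N : ℕ
  s : ℤ
  p : ℤ
  β : ℝ
  h0 : 0 < ε
  h1 : ε ≤ es
  hL : Lev τ a N s p β
  hm : ε^m ≤ β
  hF : ∀ F, Cls τ b1 L bs F → ∀ x, W F a s p x ≤ ε^16 ∧ |deriv (W F a s p) x| ≤ ε^8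

theorem exists_run {α : Type*} (R : α → α → Prop) (h : ∀ x, ∃ y, R x y) (x0 : α) : 
    ∃ u : ℕ → α, u 0 = x0 ∧ ∀ i, R (u i) (u (i+1)) := by
  choose f hf using h
  refine ⟨fun i => f^[i] x0, rfl, fun i => ?_⟩
  simp only [Function.iterate_succ_apply']
  exact hf _

theorem conclA {τ c : ℝ} (hτ : Irrational τ) (b1 L : ℝ) (bs : ℕ → ℝ) {n : ℕ} (hc : 0 < c) (hc2 : c ≤ 1/2)
   (hn : 1 ≤ n) (hD : ∀ a : ℕ, 0 < a → ∀ p : ℤ, c / a^n ≤ |a * τ - p|) :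
   ∃ (a N : ℕ → ℕ) (s p : ℕ → ℤ) (β : ℕ → ℝ) (c0 C0 : ℝ), 0 < c0 ∧ 0 < C0 ∧ 
    (∀ i, Lev τ (a i) (N i) (s i) (p i) (β i)) ∧ Tendsto β atTop (𝓝 0) ∧ 
    ∀ F, Cls τ b1 L bs F → ∀ i x, c0 * β i ≤ W F (a i) (s i) (p i) x ∧ W F (a i) (s i) (p i) x ≤ C0 * β i := by
  obtain ⟨es, hes, hes1, hst⟩ := stepE hτ b1 L bs hc hc2 hn hD
  obtain ⟨ai, Ni, si, pi, βi, hLi, hFi⟩ := initial hτ b1 L bs (η := es^16) (by positivity)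
  obtain ⟨m, hm⟩ : ∃ m : ℕ, 48 ≤ m ∧ es^m ≤ βi := by
    obtain ⟨k, hk⟩ := exists_pow_lt_of_lt_one hLi.pos (show es < 1 by linarith)
    exact ⟨k + 48, by omega, (pow_le_pow_of_le_one hes.le (by linarith) (by omega)).trans hk.le⟩
  let s0 : Sta τ b1 L bs m es := ⟨es, ai, Ni, si, pi, βi, hes, le_rfl, hLi, hm.2, fun F h x => 
    ⟨(hFi F h x).1, (hFi F h x).2.trans (pow_le_pow_of_le_one hes.le (by linarith) (by norm_num))⟩⟩
  let R : Sta τ b1 L bs m es → Sta τ b1 L bs m es → Prop := fun x y => y.ε ≤ x.ε/2 ∧ ∃ B : ℕ, 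
    B * x.ε^6 ≤ 1 ∧ y.a ≤ B * x.N ∧ 2 * y.β ≤ x.β ∧ y.β ≤ 4 * x.ε^6 * x.β ∧ c * x.ε^((m+6)*n) ≤ y.β
  have hR : ∀ x, ∃ y, R x y := by
    intro x
    obtain ⟨ε', a', N', s', p', β', B, k1, k2, k3, k4, k5, k6⟩ := hst m hm.1 x.ε x.a x.N x.s x.p x.β x.h0 x.h1 x.hL x.hm x.hF
    exact ⟨⟨ε', a', N', s', p', β', k1, k2.trans (by linarith [x.h0, x.h1]), k3, k4, k5⟩, k2, B, k6⟩
  obtain ⟨u, -, hu⟩ := exists_run R hR s0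
  have hεu : ∀ i j, (u (i+j)).ε ≤ (u i).ε * (1/2)^j := by
    intro i j
    induction j with
    | zero => simp
    | succ j ih =>
      have := (hu (i+j)).1
      rw [pow_succ, ← add_assoc]; linarith
  have hβu : ∀ j, (u j).β ≤ (1/2)^j := by
    intro j
    induction j with
    | zero => simpa using (u 0).hL.β1
    | succ j ih =>
      obtain ⟨B, _, _, h2, _⟩ := (hu j).2
      rw [pow_succ]; linarith
  set r := (m+6)*n+1 with hr
  obtain ⟨C, ε0, hC, hε0, hms⟩ := mainstep hτ b1 L bs r (by omega)
  set C3 := C * (4 + 1 + 1/c) with hC3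
  have hC30 : 0 < C3 := by positivity
  obtain ⟨i1, hi1⟩ : ∃ i1, (u i1).ε ≤ ε0 ∧ C3 * (u i1).ε ≤ 1/4 := by
    have h1 : 0 < min ε0 (1/(4*C3)) := by positivity
    obtain ⟨k, hk⟩ := exists_pow_lt_of_lt_one h1 (show (1/2:ℝ) < 1 by norm_num)
    refine ⟨k, ?_⟩
    have h2 := hεu 0 k
    rw [zero_add] at h2
    have h3 : (u k).ε ≤ min ε0 (1/(4*C3)) := by
      refine h2.trans (le_trans ?_ hk.le)
      have := (u 0).h1
      have h5 : (u 0).ε ≤ 1 := by linarith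
      exact mul_le_of_le_one_left (by positivity) h5
    refine ⟨h3.trans (min_le_left _ _), ?_⟩
    have := h3.trans (min_le_right _ _)
    rw [le_div_iff₀ (by positivity)] at this
    linarith
  obtain ⟨e, he0, he⟩ := W_crude hτ b1 L bs (u i1).hL
  have hβ1 := (u i1).hL.pos
  refine ⟨fun j => (u (i1+j)).a, fun j => (u (i1+j)).N, fun j => (u (i1+j)).s, fun j => (u (i1+j)).p, fun j => (u (i1+j)).β,
    e / (u i1).β * (1/2), 1/(u i1).β * 2, by positivity, by positivity, fun j => (u (i1+j)).hL, ?_, ?_⟩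
  · refine squeeze_zero (fun j => (u (i1+j)).hL.pos.le) (fun j => ?_) 
      (tendsto_pow_atTop_nhds_zero_of_lt_one (by norm_num) (show (1/2:ℝ) < 1 by norm_num))
    exact (hβu (i1+j)).trans (pow_le_pow_of_le_one (by norm_num) (by norm_num) (by omega))
  intro F h
  -- ratio
  have step : ∀ j x, |W F (u (i1+(j+1))).a (u (i1+(j+1))).s (u (i1+(j+1))).p x / (u (i1+(j+1))).β - 
      W F (u (i1+j)).a (u (i1+j)).s (u (i1+j)).p x / (u (i1+j)).β| ≤ 
      (1/4 * (1/2)^j) * (W F (u (i1+j)).a (u (i1+j)).s (u (i1+j)).p x / (u (i1+j)).β) := by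
    intro j x
    obtain ⟨B, g1, g2, g3, g4, g5⟩ := (hu (i1+j)).2
    rw [← add_assoc]
    have hε := (u (i1+j)).h0
    have hε1 : (u (i1+j)).ε ≤ 1 := by have := (u (i1+j)).h1; linarith
    have hεi := hεu i1 j
    have hj1 : ((1:ℝ)/2)^j ≤ 1 := pow_le_one₀ (by norm_num) (by norm_num)
    have hεe : (u (i1+j)).ε ≤ ε0 := by
      refine hεi.trans (le_trans ?_ hi1.1)
      exact mul_le_of_le_one_right (u i1).h0.le hj1
    obtain ⟨_, _, k⟩ := hms _ hε hεe _ _ _ _ _ _ _ _ _ _ (u (i1+j)).hL (u (i1+j+1)).hL B g1 g2 g3 F h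
      (fun x => ((u (i1+j)).hF F h x).1) (fun x => ((u (i1+j)).hF F h x).2) x
    have hβ := (u (i1+j)).hL.pos
    have hβ' := (u (i1+j+1)).hL.pos
    have hwp := W_pos h (u (i1+j)).hL x
    have hββ1 := (u (i1+j)).hL.β1
    set ε := (u (i1+j)).ε
    set β := (u (i1+j)).β
    set β' := (u (i1+j+1)).β
    set w := W F (u (i1+j)).a (u (i1+j)).s (u (i1+j)).p x
    set v := W F (u (i1+j+1)).a (u (i1+j+1)).s (u (i1+j+1)).p x
    have e1 : v / β' - w / β = (v / (β'/β) - w) / β := by field_simp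
    rw [e1, abs_div, abs_of_pos hβ, ← mul_div_assoc]
    gcongr
    refine k.trans ?_
    refine mul_le_mul_of_nonneg_right ?_ hwp.le
    have t1 : β'/β ≤ 4 * ε := by
      rw [div_le_iff₀ hβ]; refine g4.trans ?_
      gcongr
      simpa using pow_le_pow_of_le_one hε.le hε1 (show 1 ≤ 6 by norm_num)
    have t2 : ε^4 ≤ ε := by simpa using pow_le_pow_of_le_one hε.le hε1 (show 1 ≤ 4 by norm_num)
    have t3 : ε^r/(β'/β) ≤ 1/c * ε := by
      rw [div_le_iff₀ (by positivity)]
      have : c * ε^((m+6)*n) ≤ β'/β := g5.trans (by rw [le_div_iff₀ hβ]; nlinarith)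
      calc ε^r = 1/c * ε * (c * ε^((m+6)*n)) := by rw [hr, pow_succ]; field_simp
        _ ≤ _ := by gcongr
    calc C * (β'/β + ε^4 + ε^r/(β'/β)) ≤ C * (4 * ε + ε + 1/c * ε) := by gcongr
      _ = C3 * ε := by rw [hC3]; ring
      _ ≤ C3 * ((u i1).ε * (1/2)^j) := by gcongr
      _ = (C3 * (u i1).ε) * (1/2)^j := by ring
      _ ≤ _ := by gcongr; exact hi1.2
  have key : ∀ x j, (1/2 + (1/2) * (1/2)^j) * (W F (u i1).a (u i1).s (u i1).p x / (u i1).β) ≤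
      W F (u (i1+j)).a (u (i1+j)).s (u (i1+j)).p x / (u (i1+j)).β ∧ 
      W F (u (i1+j)).a (u (i1+j)).s (u (i1+j)).p x / (u (i1+j)).β ≤ (2 - (1/2)^j) * (W F (u i1).a (u i1).s (u i1).p x / (u i1).β) := by
    intro x j
    have hφ : 0 < W F (u i1).a (u i1).s (u i1).p x / (u i1).β := div_pos (W_pos h (u i1).hL x) hβ1
    set φ := W F (u i1).a (u i1).s (u i1).p x / (u i1).β
    induction j with
    | zero => constructor <;> simp <;> norm_num <;> ring_nf <;> rfl
    | succ j ih =>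
      have hs := abs_le.1 (step j x)
      set ψ := W F (u (i1+j)).a (u (i1+j)).s (u (i1+j)).p x / (u (i1+j)).β
      set ψ' := W F (u (i1+(j+1))).a (u (i1+(j+1))).s (u (i1+(j+1))).p x / (u (i1+(j+1))).β
      have hz0 : (0:ℝ) < (1/2)^j := by positivity
      have hz1 : ((1:ℝ)/2)^j ≤ 1 := pow_le_one₀ (by norm_num) (by norm_num)
      rw [pow_succ]
      set z := ((1:ℝ)/2)^j
      constructor
      · have a1 : (1 - 1/4*z) * ((1/2 + 1/2*z)*φ) ≤ (1 - 1/4*z) * ψ := by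
          apply mul_le_mul_of_nonneg_left ih.1; linarith
        have a2 : (1/2 + 1/2*(z*(1/2))) ≤ (1 - 1/4*z) * (1/2 + 1/2*z) := by nlinarith
        have a3 := mul_le_mul_of_nonneg_right a2 hφ.le
        linarith [hs.1]
      · have a1 : (1 + 1/4*z) * ψ ≤ (1 + 1/4*z) * ((2 - z)*φ) := by
          apply mul_le_mul_of_nonneg_left ih.2; linarith
        have a2 : (1 + 1/4*z) * (2 - z) ≤ 2 - z*(1/2) := by nlinarith
        have a3 := mul_le_mul_of_nonneg_right a2 hφ.le
        linarith [hs.2]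
  intro j x
  obtain ⟨k1, k2⟩ := key x j
  have hβ := (u (i1+j)).hL.pos
  have hz0 : (0:ℝ) < (1/2)^j := by positivity
  have hφ : 0 < W F (u i1).a (u i1).s (u i1).p x / (u i1).β := div_pos (W_pos h (u i1).hL x) hβ1
  have l1 : e / (u i1).β ≤ W F (u i1).a (u i1).s (u i1).p x / (u i1).β := by gcongr; exact he F h x
  have l2 : W F (u i1).a (u i1).s (u i1).p x / (u i1).β ≤ 1/(u i1).β := by gcongr; exact W_le_one h (u i1).hL hτ x
  set φ := W F (u i1).a (u i1).s (u i1).p x / (u i1).β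
  constructor
  · rw [← le_div_iff₀ hβ]; nlinarith
  · rw [← div_le_iff₀ hβ]; nlinarith

theorem conclB {τ c : ℝ} (hτ : Irrational τ) (b1 L : ℝ) (bs : ℕ → ℝ) {n : ℕ} (hc : 0 < c) (hc2 : c ≤ 1/2)
   (hn : 1 ≤ n) (hD : ∀ a : ℕ, 0 < a → ∀ p : ℤ, c / a^n ≤ |a * τ - p|) :
   ∃ C5 : ℝ, 1 ≤ C5 ∧ ∀ F, Cls τ b1 L bs F → (∀ k x, deriv (F^[k]) x ≤ C5) ∧ 
    (∀ k x, 1 ≤ C5 * deriv (F^[k]) x) ∧ (∀ (l : ℕ) (p : ℤ) x, |F^[l] x - x - p| ≤ C5 * |l * τ - p|) := by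
  obtain ⟨a, N, s, p, β, c0, C0, hc0, hC0, hL, hβ, hW⟩ := conclA hτ b1 L bs hc hc2 hn hD
  refine ⟨1 + C0/c0 + C0, by have : 0 < C0/c0 := by positivity
                             linarith, fun F h => ?_⟩
  have hlim : ∀ k x, ∃ ξ : ℕ → ℝ, Tendsto ξ atTop (𝓝 x) ∧ 
      ∀ i, deriv (F^[k]) (ξ i) ≤ C0/c0 ∧ c0 / C0 ≤ deriv (F^[k]) (ξ i) := by
    intro k x
    have h1 := fun i => W_mvt h (a := a i) (s := s i) (p := p i) k x
    choose ξ hξ hξ2 using h1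
    refine ⟨ξ, ?_, fun i => ?_⟩
    · rw [tendsto_iff_dist_tendsto_zero]
      refine squeeze_zero (fun _ => dist_nonneg) (fun i => ?_) (by simpa using hβ.const_mul C0)
      rw [Real.dist_eq]
      refine (W_absdiff (hL i) (hξ i)).trans ?_
      rw [abs_of_pos (W_pos h (hL i) x)]
      exact (hW F h i x).2
    · have hw := W_pos h (hL i) x
      have e : deriv (F^[k]) (ξ i) = W F (a i) (s i) (p i) (F^[k] x) / W F (a i) (s i) (p i) x := by
        rw [hξ2 i]; field_simp
      have hb := (hL i).pos
      rw [e]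
      constructor
      · rw [div_le_div_iff₀ hw hc0]
        have h1 := (hW F h i (F^[k] x)).2
        have h2 := (hW F h i x).1
        calc _ ≤ C0 * β i * c0 := by gcongr
          _ = C0 * (c0 * β i) := by ring
          _ ≤ _ := by gcongr
      · rw [div_le_div_iff₀ hC0 hw]
        have h1 := (hW F h i (F^[k] x)).1
        have h2 := (hW F h i x).2
        calc _ ≤ c0 * (C0 * β i) := by gcongr
          _ = c0 * β i * C0 := by ring
          _ ≤ _ := by gcongr
  have hcont : ∀ k, Continuous (deriv (F^[k])) := fun k => (h.isp k).sm.deriv.continuous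
  refine ⟨fun k x => ?_, fun k x => ?_, fun l q x => ?_⟩
  · obtain ⟨ξ, h1, h2⟩ := hlim k x
    have := le_of_tendsto (((hcont k).tendsto x).comp h1) (Eventually.of_forall fun i => (h2 i).1)
    linarith
  · obtain ⟨ξ, h1, h2⟩ := hlim k x
    have h3 := ge_of_tendsto (((hcont k).tendsto x).comp h1) (Eventually.of_forall fun i => (h2 i).2)
    have h4 := (h.isp k).pos x
    have h5 : C0/c0 * (c0/C0) = 1 := by field_simp
    have h6 : C0/c0 * (c0/C0) ≤ C0/c0 * deriv (F^[k]) x := by gcongr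
    nlinarith
  · set δ := |l * τ - q| with hδ
    have hδ0 : 0 ≤ δ := abs_nonneg _
    have key : ∀ i, |F^[l] x - x - q| ≤ C0 * (δ + β i) := by
      intro i
      have hb := (hL i).pos
      have hs := (hL i).hs
      obtain ⟨k, hk1, hk2⟩ : ∃ k : ℕ, δ ≤ k * β i ∧ k * β i ≤ δ + β i := by
        refine ⟨⌈δ / β i⌉₊, ?_, ?_⟩
        · have := Nat.le_ceil (δ / β i); rwa [div_le_iff₀ hb] at this
        · have := (Nat.ceil_lt_add_one (show 0 ≤ δ / β i by positivity)).le
          calc _ ≤ (δ / β i + 1) * β i := by gcongr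
            _ = _ := by field_simp
      have hsum : ∀ y, s i * (F^[k*a i] y - k * p i - y) ≤ C0 * (δ + β i) := by
        intro y
        rw [← W_sum_tel h]
        calc _ ≤ ∑ j ∈ Finset.range k, C0 * β i := Finset.sum_le_sum fun j _ => (hW F h i _).2
          _ = C0 * (k * β i) := by rw [Finset.sum_const, Finset.card_range, nsmul_eq_mul]; ring
          _ ≤ _ := by gcongr
      have hkb : (s i : ℝ) * (k * a i * τ - k * p i) = k * β i := by rw [(hL i).hβ]; ring
      have habs : |F^[l] x - x - q| = |(s i : ℝ) * (F^[l] x - x - q)| := by rw [abs_mul, (hL i).sabs, one_mul]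
      have hδs : δ = |(s i : ℝ) * (l * τ - q)| := by rw [abs_mul, (hL i).sabs, one_mul]
      rcases le_total 0 ((s i : ℝ) * (l * τ - q)) with h0 | h0
      · rw [abs_of_nonneg h0] at hδs
        have g1 := h.ordSle hτ hs 0 l 0 (-q) (by push_cast; linarith) x
        have g2 := h.ordSle hτ hs l (k * a i) (-q) (-(k * p i)) (by push_cast; linarith) x
        simp only [Function.iterate_zero, id] at g1
        push_cast at g1 g2
        have := hsum x
        rw [habs, abs_of_nonneg (by linarith)]
        linarith
      · rw [abs_of_nonpos h0] at hδs
        have g1 := h.ordSle hτ hs l 0 (-q) 0 (by push_cast; linarith) x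
        have g2 := h.ordSle hτ hs 0 (k * a i + l) 0 (-(k * p i) - q) (by push_cast; linarith) x
        simp only [Function.iterate_zero, id] at g1 g2
        rw [Function.iterate_add_apply] at g2
        push_cast at g1 g2
        have := hsum (F^[l] x)
        rw [habs, abs_of_nonpos (by linarith)]
        linarith
    have hl := ge_of_tendsto' ((hβ.const_add δ).const_mul C0) key
    rw [add_zero] at hl
    refine hl.trans ?_
    have : 0 < C0/c0 := by positivity
    gcongr; linarith

theorem highD (b1 L : ℝ) (bs : ℕ → ℝ) (C5 : ℝ) (hC5 : 1 ≤ C5) (r : ℕ) : ∃ D : ℝ, 0 < D ∧ ∀ τ F, Cls τ b1 L bs F → 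
    (∀ k x, deriv (F^[k]) x ≤ C5) → ∀ (M : ℕ) (κ : ℝ), 1 ≤ κ → M ≤ κ^2 → ∀ i ≤ M, ∀ x,
      |iteratedDeriv (r+1) (F^[i]) x| ≤ D * κ^r := by
  obtain ⟨C, hC, hh⟩ := hdJ bs r
  set q := √|bs 0| with hq
  have hq0 : 0 ≤ q := Real.sqrt_nonneg _
  have hqq : q^2 = |bs 0| := Real.sq_sqrt (abs_nonneg _)
  set A := C5 + 2 * (q * C5) with hA
  have hA0 : 0 < A := by positivity
  refine ⟨C * C5 * A^r + 1, by positivity, fun τ F h hJ M κ hκ hM i hi x => ?_⟩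
  have hsum : ∀ j ≤ M, ∀ y, ∑ i ∈ Finset.range j, (deriv (F^[i]) y)^2 ≤ (C5 * κ)^2 := by
    intro j hj y
    have hjr : (j:ℝ) ≤ M := by exact_mod_cast hj
    calc _ ≤ ∑ i ∈ Finset.range j, C5^2 := Finset.sum_le_sum fun i _ => by
            have := (h.isp i).pos y; gcongr; exact hJ i y
      _ = j * C5^2 := by rw [Finset.sum_const, Finset.card_range, nsmul_eq_mul]
      _ ≤ κ^2 * C5^2 := by gcongr; linarith
      _ = _ := by ring
  have hnl : ∀ j ≤ M, ∀ y, |nl (F^[j]) y| ≤ 2 * (q * (C5 * κ)) := by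
    intro j hj y
    have := maxp (w := fun _ => 1) (v := nl (F^[j])) (δ := 0) (κ := q * (C5 * κ)) contDiff_const (h.isp j).nlsm
      (fun _ => one_pos) (fun _ => rfl) (nl_per (h.iper j)) (fun x => by simp) (by positivity) ?_ y
    · simpa using this
    · intro x
      have e : deriv (nl (F^[j])) x - (nl (F^[j]) x)^2/2 = sch (F^[j]) x := rfl
      rw [e, sch_iter h.sp, one_pow, mul_one]
      calc |∑ i ∈ Finset.range j, sch F (F^[i] x) * deriv F^[i] x ^ 2| 
          ≤ ∑ i ∈ Finset.range j, |sch F (F^[i] x) * deriv F^[i] x ^ 2| := Finset.abs_sum_le_sum_abs _ _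
        _ ≤ ∑ i ∈ Finset.range j, |bs 0| * (deriv F^[i] x)^2 := by
          refine Finset.sum_le_sum fun i _ => ?_
          rw [abs_mul, abs_of_nonneg (sq_nonneg (deriv F^[i] x))]
          have h1 := h.sch_le 0 (F^[i] x)
          rw [iteratedDeriv_zero] at h1
          exact mul_le_mul_of_nonneg_right (h1.trans (le_abs_self _)) (sq_nonneg _)
        _ = |bs 0| * ∑ i ∈ Finset.range j, (deriv F^[i] x)^2 := by rw [Finset.mul_sum]
        _ ≤ |bs 0| * (C5 * κ)^2 := by gcongr; exact hsum j hj x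
        _ = _ := by rw [← hqq]; ring
  have hqc : 0 ≤ q * C5 * κ := by positivity
  have := hh F x (A * κ) M h.sp h.sch_le (fun i _ => (hJ i x).trans ?_) (fun i hi => (hnl i hi x).trans ?_) 
    ((hsum M le_rfl x).trans ?_) i hi
  · refine this.trans ?_
    rw [mul_pow]
    calc _ ≤ C * C5 * (A^r * κ^r) := by gcongr; exact hJ i x
      _ = C * C5 * A^r * κ^r := by ring
      _ ≤ _ := by gcongr; linarith
  · rw [hA]; nlinarith
  · rw [hA]; nlinarith
  · rw [hA]; gcongr; nlinarith

/-- iterated differences -/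
def Df (F : ℝ → ℝ) (l : ℕ) (q : ℤ) : ℕ → ℕ → ℝ → ℝ
  | 0, i => fun x => F^[i*l] x - i * q
  | j+1, i => fun x => Df F l q j (i+1) x - Df F l q j i x

theorem Df_sm {F : ℝ → ℝ} (h : ∀ k, Sm (F^[k])) (l : ℕ) (q : ℤ) : ∀ j i, Sm (Df F l q j i)
  | 0, _ => (h _).sub contDiff_const
  | j+1, i => (Df_sm h l q j (i+1)).sub (Df_sm h l q j i)

theorem Df_shift {F : ℝ → ℝ} (h : ∀ (k : ℕ) x (q : ℤ), F^[k] (x + q) = F^[k] x + q) (l : ℕ) (q : ℤ) : ∀ j i x, 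
    Df F l q j (i+1) x = Df F l q j i (F^[l] x - q)
  | 0, i, x => by
    have := h (i*l) (F^[l] x) (-q)
    simp only [Df]
    rw [sub_eq_add_neg (F^[l] x), ← Int.cast_neg, this, ← Function.iterate_add_apply]
    push_cast
    rw [add_mul, one_mul]; ring
  | j+1, i, x => by
    simp only [Df]
    rw [Df_shift h l q j (i+1) x, Df_shift h l q j i x]

theorem Df_hd {F : ℝ → ℝ} (h : ∀ k, Sm (F^[k])) (l : ℕ) (q : ℤ) (r : ℕ) {N : ℕ} {B : ℝ} 
    (hB : ∀ i ≤ N, ∀ x, |iteratedDeriv (r+1) (F^[i*l]) x| ≤ B) : ∀ j i, i + j ≤ N → ∀ x,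
    |iteratedDeriv (r+1) (Df F l q j i) x| ≤ 2^j * B
  | 0, i, hi, x => by
    have : iteratedDeriv (r+1) (Df F l q 0 i) x = iteratedDeriv (r+1) (F^[i*l]) x := by
      simp only [Df]
      rw [iteratedDeriv_succ', iteratedDeriv_succ']
      congr 1
      funext z
      rw [deriv_sub_const]
    rw [this, pow_zero, one_mul]; exact hB i hi x
  | j+1, i, hi, x => by
    have : iteratedDeriv (r+1) (Df F l q (j+1) i) x = 
        iteratedDeriv (r+1) (Df F l q j (i+1)) x - iteratedDeriv (r+1) (Df F l q j i) x :=
      iteratedDeriv_sub ((Df_sm h l q j (i+1)).at _ x) ((Df_sm h l q j i).at _ x)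
    rw [this]
    refine (abs_sub _ _).trans ?_
    have h1 := Df_hd h l q r hB j (i+1) (by omega) x
    have h2 := Df_hd h l q r hB j i (by omega) x
    rw [pow_succ]; linarith

theorem diffb (b1 L : ℝ) (bs : ℕ → ℝ) {C5 : ℝ} (hC5 : 1 ≤ C5) {c : ℝ} (hc : 0 < c) (n N : ℕ) (hn : 1 ≤ n) (hN : 1 ≤ N) :
   ∃ A : ℝ, 0 < A ∧ ∀ τ F, Cls τ b1 L bs F → (∀ k x, deriv (F^[k]) x ≤ C5) → 
    (∀ (l : ℕ) (p : ℤ) x, |F^[l] x - x - p| ≤ C5 * |l * τ - p|) → 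
    ∀ (κ β : ℝ) (l : ℕ) (q : ℤ), 1 ≤ κ → l ≤ 2 * κ^4 → β = |l * τ - q| → c ≤ β * κ^(4*n) → ∀ x, 
     |Df F l q N 0 x| ≤ A * β^N * κ^(3*N) := by
  obtain ⟨r, hr⟩ : ∃ r, r = 4*n*N := ⟨_, rfl⟩
  obtain ⟨D, hD, hhd⟩ := highD b1 L bs C5 hC5 r
  obtain ⟨Ck, hCk, hlk⟩ := lk r 1
  have main : ∀ j, j + 1 ≤ N → ∃ A : ℝ, 0 < A ∧ ∀ τ F, Cls τ b1 L bs F → (∀ k x, deriv (F^[k]) x ≤ C5) → 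
    (∀ (l : ℕ) (p : ℤ) x, |F^[l] x - x - p| ≤ C5 * |l * τ - p|) → 
    ∀ (κ β : ℝ) (l : ℕ) (q : ℤ), 1 ≤ κ → l ≤ 2 * κ^4 → β = |l * τ - q| → c ≤ β * κ^(4*n) → ∀ x, 
     |Df F l q (j+1) 0 x| ≤ A * β^(j+1) * κ^(3*(j+1)) := by
    intro j
    induction j with
    | zero =>
      intro _
      refine ⟨C5, by linarith, fun τ F h hJ hdis κ β l q hκ hl hβ hcβ x => ?_⟩
      have := hdis l q x
      have e : Df F l q (0+1) 0 x = F^[l] x - x - q := by simp [Df]; ring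
      rw [e]
      refine this.trans ?_
      rw [← hβ]
      have hb0 : 0 ≤ β := hβ ▸ abs_nonneg _
      have : 1 ≤ κ^(3*(0+1)) := one_le_pow₀ hκ
      rw [zero_add, pow_one]
      exact le_mul_of_one_le_right (by positivity) this
    | succ j ih =>
      intro hj
      obtain ⟨A, hA, ih⟩ := ih (by omega)
      set E := 2^(j+1) * (D * (2*N)^r) / c^(j+1) with hE
      have hE0 : 0 ≤ E := by positivity
      refine ⟨C5 * (Ck * (A + E)) + 1, by positivity, fun τ F h hJ hdis κ β l q hκ hl hβ hcβ x => ?_⟩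
      have hb0 : 0 ≤ β := hβ ▸ abs_nonneg _
      have hκ0 : 0 < κ := by linarith
      have ih' := ih τ F h hJ hdis κ β l q hκ hl hβ hcβ
      have hsm : ∀ k, Sm (F^[k]) := fun k => (h.isp k).sm
      have hBd : ∀ i ≤ N, ∀ x, |iteratedDeriv (r+1) (F^[i*l]) x| ≤ D * (2*N*κ^2)^r := by
        intro i hi x
        have hN1 : (1:ℝ) ≤ N := by exact_mod_cast hN
        have hκ2 : 1 ≤ κ^2 := one_le_pow₀ hκ
        refine hhd τ F h hJ (N*l) (2*N*κ^2) (by nlinarith) ?_ (i*l) (Nat.mul_le_mul_right _ hi) x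
        push_cast
        calc (N:ℝ) * l ≤ N * (2 * κ^4) := by gcongr
          _ ≤ N * (2 * κ^4) * (2 * N) := le_mul_of_one_le_right (by positivity) (by linarith)
          _ = _ := by ring
      set u := Df F l q (j+1) 0 with hu
      have husm : Sm u := Df_sm hsm l q _ _
      have hud : ∀ y, |deriv u y| ≤ Ck * (A + E) * β^(j+1) * κ^(3*(j+1)+3) := by
        intro y
        have := hlk u y (κ^3)⁻¹ (A * β^(j+1) * κ^(3*(j+1))) (2^(j+1) * (D * (2*N*κ^2)^r)) husm (by positivity)
          (fun z _ => ih' z) (fun z _ => by rw [add_comm 1 r]; exact Df_hd hsm l q r hBd (j+1) 0 (by omega) z) y 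
          ⟨le_rfl, by have : 0 < (κ^3)⁻¹ := by positivity
                      linarith⟩
        rw [iteratedDeriv_one] at this
        refine this.trans ?_
        have e1 : A * β^(j+1) * κ^(3*(j+1)) / (κ^3)⁻¹^1 = A * (β^(j+1) * κ^(3*(j+1)+3)) := by
          rw [pow_one, div_inv_eq_mul, pow_add]; ring
        have e2 : 2^(j+1) * (D * (2*N*κ^2)^r) * (κ^3)⁻¹^r = E * (c^(j+1) * (κ^r)⁻¹) := by
          rw [hE, mul_pow (2*(N:ℝ))]
          have : (κ^2)^r * (κ^3)⁻¹^r = (κ^r)⁻¹ := by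
            rw [← mul_pow, ← inv_pow κ r]; congr 1; field_simp
          calc _ = 2^(j+1) * (D * (2*N)^r) * ((κ^2)^r * (κ^3)⁻¹^r) := by ring
            _ = _ := by rw [this]; field_simp
        have e3 : c^(j+1) * (κ^r)⁻¹ ≤ β^(j+1) := by
          rw [mul_inv_le_iff₀ (by positivity)]
          calc c^(j+1) ≤ (β * κ^(4*n))^(j+1) := by gcongr
            _ = β^(j+1) * κ^(4*n*(j+1)) := by rw [mul_pow, ← pow_mul]
            _ ≤ _ := by
              gcongr ?_ * κ^?_
              · rw [hr]; gcongr; omega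
        have e4 : β^(j+1) ≤ β^(j+1) * κ^(3*(j+1)+3) := le_mul_of_one_le_right (by positivity) (one_le_pow₀ hκ)
        rw [e1, e2]
        calc _ ≤ Ck * (A * (β^(j+1) * κ^(3*(j+1)+3)) + E * (β^(j+1) * κ^(3*(j+1)+3))) := by
              have := mul_le_mul_of_nonneg_left (e3.trans e4) hE0
              gcongr
          _ = _ := by ring
      have e : Df F l q (j+1+1) 0 x = u (F^[l] x - q) - u x := by
        rw [hu, ← Df_shift h.iint]; rfl
      rw [e]
      refine (mvt husm (fun y _ => hud y)).trans ?_
      have hd := hdis l q x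
      rw [← hβ, sub_right_comm] at hd
      have hX : 0 ≤ β^(j+1+1) * κ^(3*(j+1+1)) := by positivity
      calc _ ≤ Ck * (A + E) * β^(j+1) * κ^(3*(j+1)+3) * (C5 * β) := by gcongr
        _ = C5 * (Ck * (A + E)) * (β^(j+1+1) * κ^(3*(j+1+1))) := by ring
        _ ≤ _ := by linarith
  obtain ⟨M, rfl⟩ : ∃ M, N = M + 1 := ⟨N - 1, by omega⟩
  exact main M le_rfl

def Orb (τ : ℝ) : Set ℝ := {t | ∃ lp : ℕ × ℤ, t = lp.1 * τ - lp.2}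

theorem Orb_dense {τ : ℝ} (hτ : Irrational τ) : Dense (Orb τ) := by
  rw [Metric.dense_iff]
  intro x ε hε
  obtain ⟨Q, hQ⟩ := exists_nat_gt (1/ε)
  obtain ⟨a, N, s, p, β, hL, h1, h2⟩ := exists_lev hτ (Q+1) (by omega)
  have hβ := hL.pos
  have hβε : β < ε := by
    have h3 := hL.Nβ
    have h4 : (Q:ℝ) ≤ N := by exact_mod_cast (by omega)
    rw [div_lt_iff₀ hε] at hQ
    by_contra hc
    push Not at hc
    have hQ0 : (0:ℝ) ≤ Q := by positivity
    nlinarith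
  -- shift
  obtain ⟨m, hm⟩ : ∃ m : ℤ, 0 ≤ s * (x + m) := by
    rcases hL.hs with rfl | rfl
    · exact ⟨-⌊x⌋, by push_cast; linarith [Int.floor_le x]⟩
    · exact ⟨-⌈x⌉, by push_cast; linarith [Int.le_ceil x]⟩
  set j := ⌊s * (x+m) / β⌋₊ with hj
  have j1 : j * β ≤ s * (x+m) := by
    have := Nat.floor_le (div_nonneg hm hβ.le); rwa [le_div_iff₀ hβ] at this
  have j2 : s * (x+m) < j * β + β := by
    have := Nat.lt_floor_add_one (s * (x+m) / β)
    rw [div_lt_iff₀ hβ] at this; linarith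
  refine ⟨(j * a : ℕ) * τ - ((j * p + m : ℤ)), ?_, ⟨(j*a, j*p+m), rfl⟩⟩
  rw [Metric.mem_ball, Real.dist_eq]
  refine lt_of_le_of_lt ?_ hβε
  have e : |((j * a : ℕ):ℝ) * τ - ((j * p + m : ℤ)) - x| = |(s:ℝ) * (((j * a : ℕ):ℝ) * τ - ((j * p + m : ℤ)) - x)| := by
    rw [abs_mul, hL.sabs, one_mul]
  have e2 : (s:ℝ) * (((j * a : ℕ):ℝ) * τ - ((j * p + m : ℤ)) - x) = j * β - s * (x+m) := by
    rw [hL.hβ]; push_cast; ring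
  rw [e, e2, abs_le]; constructor <;> linarith

theorem exists_g {τ b1 L : ℝ} {bs : ℕ → ℝ} (hτ : Irrational τ) {C5 : ℝ} (hC5 : 1 ≤ C5) {F : ℝ → ℝ} (h : Cls τ b1 L bs F) 
    (hd : ∀ (l : ℕ) (p : ℤ) x, |F^[l] x - x - p| ≤ C5 * |l * τ - p|) : 
    ∃ g : ℝ → ℝ, g 0 = 0 ∧ (∀ x y, |g x - g y| ≤ C5 * |x - y|) ∧ (∀ t, g (t+1) = g t + 1) ∧ (∀ t, g (t+τ) = F (g t)) := by
  have est : ∀ (l l' : ℕ) (p p' : ℤ), |(F^[l] 0 - p) - (F^[l'] 0 - p')| ≤ C5 * |(l * τ - p) - (l' * τ - p')| := by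
    intro l l' p p'
    wlog hll : l' ≤ l generalizing l l' p p'
    · rw [abs_sub_comm, abs_sub_comm (l * τ - p)]
      exact this l' l p' p (by omega)
    obtain ⟨k, rfl⟩ := Nat.exists_eq_add_of_le' hll
    have := hd k (p - p') (F^[l'] 0)
    rw [← Function.iterate_add_apply] at this
    push_cast at this ⊢
    convert this using 2 <;> ring_nf
  let g0 : ℝ → ℝ := fun t => open Classical in if hh : ∃ lp : ℕ × ℤ, t = lp.1 * τ - lp.2 then F^[hh.choose.1] 0 - hh.choose.2 else 0
  have hg0 : ∀ (l : ℕ) (p : ℤ), g0 (l * τ - p) = F^[l] 0 - p := by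
    intro l p
    have hh : ∃ lp : ℕ × ℤ, (l * τ - p) = lp.1 * τ - lp.2 := ⟨(l, p), rfl⟩
    have e : g0 (l * τ - p) = F^[hh.choose.1] 0 - hh.choose.2 := by simp only [g0]; rw [dif_pos hh]
    have h1 := est l hh.choose.1 p hh.choose.2
    rw [← hh.choose_spec, sub_self, abs_zero, mul_zero] at h1
    rw [e]
    have := abs_nonpos_iff.1 h1
    linarith
  have hlip : LipschitzOnWith ⟨C5, by linarith⟩ g0 (Orb τ) := by
    refine LipschitzOnWith.of_dist_le_mul ?_
    rintro _ ⟨⟨l, p⟩, rfl⟩ _ ⟨⟨l', p'⟩, rfl⟩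
    simp only [Real.dist_eq, NNReal.coe_mk]
    rw [hg0, hg0]; exact est l l' p p'
  obtain ⟨g, hgl, hge⟩ := hlip.extend_real
  have hgc := hgl.continuous
  have hgD : ∀ (l : ℕ) (p : ℤ), g (l * τ - p) = F^[l] 0 - p := by
    intro l p
    rw [← hge ⟨(l, p), rfl⟩, hg0]
  refine ⟨g, ?_, ?_, ?_, ?_⟩
  · have := hgD 0 0; simpa using this
  · intro x y
    have := hgl.dist_le_mul x y
    rw [Real.dist_eq, Real.dist_eq] at this; exact this
  · have : (fun t => g (t+1)) = fun t => g t + 1 := by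
      refine Continuous.ext_on (Orb_dense hτ) (by fun_prop) (by fun_prop) ?_
      rintro _ ⟨⟨l, p⟩, rfl⟩
      have h1 := hgD l (p-1)
      have h2 := hgD l p
      push_cast at h1
      simp only
      rw [h2, show (l:ℝ) * τ - p + 1 = l * τ - (p - 1) by ring, h1]; ring
    exact fun t => congrFun this t
  · have hFc : Continuous F := h.sm.continuous
    have : (fun t => g (t+τ)) = fun t => F (g t) := by
      refine Continuous.ext_on (Orb_dense hτ) (by fun_prop) (by fun_prop) ?_
      rintro _ ⟨⟨l, p⟩, rfl⟩
      have h1 := hgD (l+1) p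
      have h2 := hgD l p
      push_cast at h1
      simp only
      rw [h2, show (l:ℝ) * τ - p + τ = (l+1) * τ - p by ring, h1, Function.iterate_succ_apply']
      have := h.iint 1 (F^[l] 0) (-p)
      simp only [Function.iterate_one] at this
      push_cast at this
      rw [sub_eq_add_neg, sub_eq_add_neg, this]
    exact fun t => congrFun this t

def ee (k : ℤ) (t : ℝ) : ℂ := Complex.exp ((2 * Real.pi * Complex.I * k) * t)
def cf (k : ℤ) (u : ℝ → ℝ) : ℂ := ∫ t in (0:ℝ)..1, ee (-k) t * (u t : ℂ)

theorem ee_add (k : ℤ) (s t : ℝ) : ee k (s+t) = ee k s * ee k t := by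
  simp only [ee]; rw [← Complex.exp_add]; push_cast; ring_nf
theorem ee_neg (k : ℤ) (t : ℝ) : ee k t * ee (-k) t = 1 := by
  simp only [ee]; rw [← Complex.exp_add]; push_cast; ring_nf; simp
theorem ee_one (k : ℤ) : ee k 1 = 1 := by
  simp only [ee]
  rw [Complex.exp_eq_one_iff]; exact ⟨k, by push_cast; ring⟩
theorem ee_cont (k : ℤ) : Continuous (ee k) := by unfold ee; fun_prop
theorem ee_norm (k : ℤ) (t : ℝ) : ‖ee k t‖ = 1 := by
  simp only [ee]
  rw [show (2 * Real.pi * Complex.I * k) * (t:ℂ) = ((2*Real.pi*k*t : ℝ):ℂ) * Complex.I by push_cast; ring]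
  exact Complex.norm_exp_ofReal_mul_I _

theorem cf_sub (k : ℤ) {u v : ℝ → ℝ} (hu : Continuous u) (hv : Continuous v) : 
    cf k (fun t => u t - v t) = cf k u - cf k v := by
  simp only [cf]
  have := ee_cont (-k)
  rw [← intervalIntegral.integral_sub (Continuous.intervalIntegrable (by fun_prop) _ _) (Continuous.intervalIntegrable (by fun_prop) _ _)]
  congr 1; funext t; push_cast; ring

theorem cf_norm (k : ℤ) {u : ℝ → ℝ} {B : ℝ} (hB : ∀ t, |u t| ≤ B) : ‖cf k u‖ ≤ B := by
  have := intervalIntegral.norm_integral_le_of_norm_le_const (a := 0) (b := 1) (f := fun t => ee (-k) t * (u t : ℂ)) (C := B)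
    (fun t _ => by rw [norm_mul, ee_norm, one_mul, Complex.norm_real]; exact hB t)
  simpa [cf] using this

theorem cf_shift (k : ℤ) {u : ℝ → ℝ} (hp : ∀ t, u (t+1) = u t) (b : ℝ) : 
    cf k (fun t => u (t+b)) = ee k b * cf k u := by
  have hper : Function.Periodic (fun t => ee (-k) t * (u t : ℂ)) 1 := by
    intro t; simp only; rw [ee_add, ee_one, mul_one, hp]
  have h1 := hper.intervalIntegral_add_eq b 0
  have h2 := intervalIntegral.integral_comp_add_right (a := 0) (b := 1) (fun t => ee (-k) t * (u t : ℂ)) b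
  rw [zero_add, add_comm 1 b, h1, zero_add] at h2
  simp only [cf]
  rw [← h2, ← intervalIntegral.integral_const_mul]
  congr 1; funext t
  rw [ee_add, mul_assoc, ← mul_assoc, ← mul_assoc, mul_right_comm (ee k b), ee_neg, one_mul]

theorem cf_const (k : ℤ) (hk : k ≠ 0) (c : ℝ) : cf k (fun _ => c) = 0 := by
  have h1 := cf_shift k (u := fun _ => c) (fun _ => rfl) (1/(2*k))
  simp only at h1
  have : ee k (1/(2*k)) = -1 := by
    simp only [ee]
    have hk' : (k:ℂ) ≠ 0 := by exact_mod_cast hk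
    rw [← Complex.exp_pi_mul_I]; congr 1; push_cast; field_simp
  rw [this] at h1
  have h2 : (2:ℂ) * cf k (fun _ => c) = 0 := by linear_combination h1
  simpa using h2

theorem fourier_sm (B : ℝ) (A : ℕ → ℝ) : ∃ Bs : ℕ → ℝ, ∀ ψ : ℝ → ℝ, Continuous ψ → (∀ t, ψ (t+1) = ψ t) → 
    (∀ t, |ψ t| ≤ B) → (∀ M (k : ℤ), k ≠ 0 → ‖cf k ψ‖ ≤ A M / |(k:ℝ)|^M) → 
    Sm ψ ∧ ∀ j x, |iteratedDeriv j ψ x| ≤ Bs j := by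
  let v : ℕ → ℤ → ℝ := fun j i => (if i = 0 then B else 0) + A (j+2) * (2*Real.pi)^j * (1/(i:ℝ)^2)
  have hv : ∀ j, Summable (v j) := fun j => 
    (hasSum_ite_eq (0:ℤ) B).summable.add ((Real.summable_one_div_int_pow.2 (by norm_num)).mul_left _)
  refine ⟨fun j => ∑' i, v j i, fun ψ hc hp hB hA => ?_⟩
  have hper : Function.Periodic (fun t => (ψ t : ℂ)) (1:ℝ) := by
    intro t; simp only; rw [hp]
  let f : C(AddCircle (1:ℝ), ℂ) := ⟨hper.lift, by
    have : Continuous (hper.lift ∘ (QuotientAddGroup.mk : ℝ → AddCircle (1:ℝ))) := by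
      have e : (hper.lift ∘ (QuotientAddGroup.mk : ℝ → AddCircle (1:ℝ))) = fun t => (ψ t:ℂ) := rfl
      rw [e]; fun_prop
    exact (QuotientAddGroup.isQuotientMap_mk _).continuous_iff.2 this⟩
  have hf : ∀ t : ℝ, f (t : AddCircle (1:ℝ)) = ψ t := fun t => rfl
  have : Fact ((0:ℝ) < 1) := ⟨one_pos⟩
  have hee : ∀ (k : ℤ) (t : ℝ), fourier k (t : AddCircle (1:ℝ)) = ee k t := by
    intro k t
    rw [fourier_coe_apply, ee]; congr 1; push_cast; ring
  have hco : ∀ k, fourierCoeff f k = cf k ψ := by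
    intro k
    rw [fourierCoeff_eq_intervalIntegral _ _ 0]
    simp only [div_one, one_smul, zero_add, cf]
    congr 1; funext t
    rw [hee, hf, smul_eq_mul]
  let T : ℤ → ℝ → ℂ := fun k x => cf k ψ * ee k x
  have hTs : ∀ k, ContDiff ℝ ∞ (T k) := by
    intro k
    have : ContDiff ℝ ∞ (fun x : ℝ => (x:ℂ)) := Complex.ofRealCLM.contDiff
    exact contDiff_const.mul ((contDiff_const.mul this).cexp)
  have hTd : ∀ k j, iteratedDeriv j (T k) = fun x => (2 * Real.pi * Complex.I * k)^j * T k x := by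
    intro k j
    induction j with
    | zero => simp
    | succ j ih =>
      rw [iteratedDeriv_succ, ih]
      funext x
      have h1 : HasDerivAt (fun x : ℝ => ee k x) (ee k x * (2 * Real.pi * Complex.I * k)) x := by
        have h2 : HasDerivAt (fun x : ℝ => (2 * Real.pi * Complex.I * k) * (x:ℂ)) ((2 * Real.pi * Complex.I * k)*1) x := 
          (Complex.ofRealCLM.hasDerivAt (x := x)).const_mul _
        rw [mul_one] at h2
        exact h2.cexp
      have h3 := ((h1.const_mul (cf k ψ)).const_mul ((2 * Real.pi * Complex.I * k)^j)).deriv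
      simp only [T]
      rw [h3]; ring
  have hTb : ∀ (j : ℕ) (k : ℤ) (x : ℝ), ‖iteratedFDeriv ℝ j (T k) x‖ ≤ v j k := by
    intro j k x
    rw [norm_iteratedFDeriv_eq_norm_iteratedDeriv, hTd]
    simp only [T, v]
    rw [norm_mul, norm_mul, ee_norm, mul_one, norm_pow]
    have e : ‖(2 * Real.pi * Complex.I * k : ℂ)‖ = 2 * Real.pi * |(k:ℝ)| := by
      simp [abs_of_pos Real.pi_pos]
    rw [e]
    by_cases hk : k = 0
    · subst hk
      rw [if_pos rfl]
      have h1 := cf_norm 0 hB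
      have hB0 := (norm_nonneg _).trans h1
      rcases Nat.eq_zero_or_pos j with rfl | hj
      · simpa using h1
      · simp [zero_pow hj.ne', hB0]
    · rw [if_neg hk, zero_add]
      have h1 := hA (j+2) k hk
      have hk0 : 0 < |(k:ℝ)| := abs_pos.2 (by exact_mod_cast hk)
      calc (2 * Real.pi * |(k:ℝ)|)^j * ‖cf k ψ‖ ≤ (2 * Real.pi * |(k:ℝ)|)^j * (A (j+2) / |(k:ℝ)|^(j+2)) := by
            have := Real.pi_pos
            gcongr
        _ = _ := by
            rw [← sq_abs (k:ℝ), mul_pow]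
            field_simp
            try ring
  have hsum : Summable (fourierCoeff f) := by
    refine Summable.of_norm_bounded (hv 0) fun k => ?_
    have := hTb 0 k 0
    rw [norm_iteratedFDeriv_zero] at this
    simpa only [T, norm_mul, ee_norm, mul_one, hco] using this
  have hrep : (fun x => (ψ x : ℂ)) = fun x => ∑' k, T k x := by
    funext x
    have := (has_pointwise_sum_fourier_series_of_summable hsum (x : AddCircle (1:ℝ))).tsum_eq
    rw [hf] at this
    rw [← this]
    congr 1; funext k
    rw [hco, hee, smul_eq_mul]
  have hs : ContDiff ℝ ∞ (fun x => (ψ x : ℂ)) := by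
    rw [hrep]
    exact contDiff_tsum (N := ⊤) hTs (fun j _ => hv j) (fun j k x _ => hTb j k x)
  have hψ : ψ = Complex.reCLM ∘ (fun x => (ψ x : ℂ)) := by funext x; simp
  refine ⟨by rw [hψ]; exact Complex.reCLM.contDiff.comp hs, fun j x => ?_⟩
  have h1 : ‖iteratedFDeriv ℝ j (fun x => (ψ x : ℂ)) x‖ ≤ ∑' i, v j i := by
    rw [hrep, iteratedFDeriv_tsum (N := ⊤) hTs (fun j _ => hv j) (fun j k x _ => hTb j k x) le_top]
    exact tsum_of_norm_bounded (hv j).hasSum (fun k => hTb j k x)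
  have h3 := Complex.ofRealLI.norm_iteratedFDeriv_comp_left (f := ψ) (x := x) (n := j) (i := j) (by
    have hψs : Sm ψ := by rw [hψ]; exact Complex.reCLM.contDiff.comp hs
    exact hψs.at j x) le_rfl
  have h4 : (Complex.ofRealLI ∘ ψ) = (fun x => (ψ x : ℂ)) := rfl
  rw [h4, norm_iteratedFDeriv_eq_norm_iteratedDeriv (f := ψ), Real.norm_eq_abs] at h3
  rw [← h3]; exact h1

theorem ee_lb (k : ℤ) (b : ℝ) (h : |(k:ℝ)| * |b| ≤ 1/2) : 4 * (|(k:ℝ)| * |b|) ≤ ‖ee k b - 1‖ := by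
  have e : ee k b = Complex.exp (Complex.I * ((2*Real.pi*k*b : ℝ):ℂ)) := by
    simp only [ee]; congr 1; push_cast; ring
  rw [e, Complex.norm_exp_I_mul_ofReal_sub_one, norm_mul, Real.norm_eq_abs, Real.norm_eq_abs]
  have hpi := Real.pi_pos
  have e2 : |2*Real.pi*k*b/2| = Real.pi * (|(k:ℝ)| * |b|) := by
    rw [show 2*Real.pi*k*b/2 = Real.pi * (k * b) by ring, abs_mul, abs_mul, abs_of_pos hpi]
  have h1 := Real.mul_abs_le_abs_sin (x := 2*Real.pi*k*b/2) (by rw [e2]; nlinarith)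
  rw [e2] at h1
  have e3 : 2 / Real.pi * (Real.pi * (|(k:ℝ)| * |b|)) = 2 * (|(k:ℝ)| * |b|) := by field_simp
  rw [e3] at h1
  rw [abs_of_pos (two_pos : (0:ℝ) < 2)]
  linarith

theorem g_iter {F g : ℝ → ℝ} {τ : ℝ} (hg1 : ∀ t, g (t+1) = g t + 1) (hgF : ∀ t, g (t+τ) = F (g t)) (l : ℕ) (q : ℤ) (t : ℝ) :
    g (t + (l * τ - q)) = F^[l] (g t) - q := by
  have h1 : ∀ (l : ℕ) t, g (t + l * τ) = F^[l] (g t) := by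
    intro l
    induction l with
    | zero => simp
    | succ l ih => 
      intro t
      rw [Function.iterate_succ_apply', ← ih, ← hgF]; push_cast; congr 1; ring
  have h2 : ∀ (n : ℕ) t, g (t + n) = g t + n := by
    intro n
    induction n with
    | zero => simp
    | succ n ih => intro t; push_cast; rw [← add_assoc, hg1, ih]; ring
  have h3 : ∀ (q : ℤ) t, g (t - q) = g t - q := by
    intro q t
    obtain ⟨n, rfl | rfl⟩ := q.eq_nat_or_neg
    · have := h2 n (t - n)
      push_cast
      rw [sub_add_cancel] at this; linarith
    · push_cast
      rw [sub_neg_eq_add, h2]; ring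
  rw [← add_sub_assoc, h3, h1]

theorem cf_Df {τ b1 L : ℝ} {bs : ℕ → ℝ} {F g : ℝ → ℝ} (h : Cls τ b1 L bs F) (hgc : Continuous g)
    (hg1 : ∀ t, g (t+1) = g t + 1) (hgF : ∀ t, g (t+τ) = F (g t)) (l : ℕ) (q k : ℤ) (hk : k ≠ 0) (j : ℕ) :
    (∀ t, Df F l q (j+1) 0 (g (t+1)) = Df F l q (j+1) 0 (g t)) ∧ 
    cf k (fun t => Df F l q (j+1) 0 (g t)) = (ee k (l * τ - q) - 1)^(j+1) * cf k (fun t => g t - t) := by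
  have hc : ∀ j, Continuous (fun t => Df F l q j 0 (g t)) := fun j => 
    (Df_sm (fun k => (h.isp k).1) l q j 0).continuous.comp hgc
  have step : ∀ j t, Df F l q (j+1) 0 (g t) = Df F l q j 0 (g (t + (l*τ-q))) - Df F l q j 0 (g t) := by
    intro j t
    rw [g_iter hg1 hgF, ← Df_shift h.iint]; rfl
  induction j with
  | zero =>
    have e : ∀ t, Df F l q 0 0 (g t) = g t := by intro t; simp [Df]
    constructor
    · intro t
      rw [step, step, e, e, e, e, add_right_comm, hg1, hg1]; ring
    · have e2 : (fun t => Df F l q (0+1) 0 (g t)) = fun t => ((fun t => g (t + (l*τ-q)) - (t + (l*τ-q))) t - (fun t => g t - t) t) - (fun _ => -(l*τ-q)) t := by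
        funext t; simp only [step, e]; ring
      rw [e2, cf_sub k (by fun_prop) (by fun_prop), cf_const k hk, cf_sub k (by fun_prop) (by fun_prop), 
        cf_shift k (u := fun t => g t - t) (fun t => by rw [hg1]; ring)]
      ring
  | succ j ih =>
    constructor
    · intro t
      rw [step, step (j+1) t, ih.1, add_right_comm, ih.1]
    · have e2 : (fun t => Df F l q (j+1+1) 0 (g t)) = fun t => (fun t => Df F l q (j+1) 0 (g (t + (l*τ-q)))) t - (fun t => Df F l q (j+1) 0 (g t)) t := by
        funext t; simp only [step (j+1)]
      have hc1 := hc (j+1)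
      rw [e2, cf_sub k (u := fun t => Df F l q (j+1) 0 (g (t + (l*τ-q)))) (v := fun t => Df F l q (j+1) 0 (g t)) (hc1.comp (by fun_prop : Continuous fun t => t + (l*τ-q))) hc1, cf_shift k (u := fun t => Df F l q (j+1) 0 (g t)) ih.1, ih.2]
      ring

theorem gsm {τ c : ℝ} (b1 L : ℝ) (bs : ℕ → ℝ) {n : ℕ} (hc : 0 < c)
   (hn : 1 ≤ n) (hD : ∀ a : ℕ, 0 < a → ∀ p : ℤ, c / a^n ≤ |a * τ - p|) {C5 : ℝ} (hC5 : 1 ≤ C5) :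
   ∃ Bs : ℕ → ℝ, ∀ F g : ℝ → ℝ, Cls τ b1 L bs F → (∀ k x, deriv (F^[k]) x ≤ C5) → 
    (∀ (l : ℕ) (p : ℤ) x, |F^[l] x - x - p| ≤ C5 * |l * τ - p|) → 
    g 0 = 0 → (∀ x y, |g x - g y| ≤ C5 * |x - y|) → (∀ t, g (t+1) = g t + 1) → (∀ t, g (t+τ) = F (g t)) → 
    Sm (fun t => g t - t) ∧ ∀ j x, |iteratedDeriv j (fun t => g t - t) x| ≤ Bs j := by
  have hc' : 0 < c/2^n := by positivity
  choose A hA hdf using fun M : ℕ => diffb b1 L bs hC5 hc' n (4*(M+1)) hn (by omega)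
  obtain ⟨Bs, hBs⟩ := fourier_sm (C5+1) A
  refine ⟨Bs, fun F g h hJ hd hg0 hgl hg1 hgF => ?_⟩
  have hgc : Continuous g := by
    have : LipschitzWith ⟨C5, by linarith⟩ g := LipschitzWith.of_dist_le_mul fun x y => by
      rw [Real.dist_eq, Real.dist_eq]; exact hgl x y
    exact this.continuous
  refine hBs _ (by fun_prop) (fun t => by rw [hg1]; ring) ?_ ?_
  · intro t
    have h1 := g_iter hg1 hgF 0 ⌊t⌋ t
    simp only [Nat.cast_zero, zero_mul, zero_sub, Function.iterate_zero, id] at h1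
    have h2 := hgl (Int.fract t) 0
    have h3 : Int.fract t = t + -⌊t⌋ := by rw [Int.fract]; ring
    have h4 := Int.fract_nonneg t
    have h5 := Int.fract_lt_one t
    rw [hg0, sub_zero, sub_zero, abs_of_nonneg h4] at h2
    rw [← h3] at h1
    have e : g t - t = g (Int.fract t) - Int.fract t := by rw [h1, h3]; ring
    rw [e]
    refine (abs_sub _ _).trans ?_
    rw [abs_of_nonneg h4]
    nlinarith
  · intro M k hk
    have hK1 : 1 ≤ |(k:ℝ)| := by
      have : (1:ℤ) ≤ |k| := Int.one_le_abs hk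
      exact_mod_cast this
    obtain ⟨K, hK⟩ : ∃ K, K = |(k:ℝ)| := ⟨_, rfl⟩
    rw [← hK] at hK1 ⊢
    obtain ⟨κ, hκ1, hκ⟩ : ∃ κ : ℝ, 1 ≤ κ ∧ κ^4 = K := by
      refine ⟨√(√K), by rw [Real.one_le_sqrt, Real.one_le_sqrt]; exact hK1, ?_⟩
      rw [show (√(√K))^4 = ((√(√K))^2)^2 by ring, Real.sq_sqrt (by positivity), Real.sq_sqrt (by positivity)]
    have hnat : ((k.natAbs : ℕ):ℝ) = K := by rw [hK, Nat.cast_natAbs]; push_cast; rfl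
    obtain ⟨q, l', hl0, hl1, hb⟩ := Real.exists_int_int_abs_mul_sub_le τ (n := 2 * k.natAbs) (by have := Int.natAbs_pos.2 hk; omega)
    obtain ⟨l, rfl⟩ := Int.eq_ofNat_of_zero_le hl0.le
    have hl0' : 0 < l := by exact_mod_cast hl0
    have hl2 : (l:ℝ) ≤ 2 * K := by rw [← hnat]; exact_mod_cast hl1
    push_cast at hb
    rw [hnat] at hb
    obtain ⟨β, hβ⟩ : ∃ β, β = |(l:ℝ) * τ - q| := ⟨_, rfl⟩
    rw [← hβ] at hb
    have hlp : (0:ℝ) < l := by exact_mod_cast hl0'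
    have hβl := hD l hl0' q
    rw [← hβ] at hβl
    have hβ0 : 0 < β := lt_of_lt_of_le (by positivity) hβl
    have hβK : K * β ≤ 1/2 := by
      rw [le_div_iff₀ (by positivity)] at hb; nlinarith
    have hcβ : c / 2^n ≤ β * κ^(4*n) := by
      rw [pow_mul, hκ]
      rw [div_le_iff₀ (by positivity)] at hβl ⊢
      calc c ≤ β * l^n := hβl
        _ ≤ β * (2*K)^n := by gcongr
        _ = _ := by rw [mul_pow]; ring
    have hD2 := hdf M τ F h hJ hd κ β l q hκ1 (by rw [hκ]; exact hl2) hβ hcβ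
    have h1 := cf_norm k (u := fun t => Df F l q (4*(M+1)) 0 (g t)) (fun t => hD2 (g t))
    have h2 := (cf_Df h hgc hg1 hgF l q k hk (4*M+3)).2
    rw [show 4*M+3+1 = 4*(M+1) by ring] at h2
    rw [h2, norm_mul, norm_pow] at h1
    have h3 := ee_lb k (l*τ-q) (by rw [← hK, ← hβ]; exact hβK)
    rw [← hK, ← hβ] at h3
    obtain ⟨N, hN⟩ : ∃ N, N = 4*(M+1) := ⟨_, rfl⟩
    rw [← hN] at h1
    have h4 : (K*β)^N * ‖cf k (fun t => g t - t)‖ ≤ A M * β^N * κ^(3*N) := by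
      refine le_trans ?_ h1
      gcongr
      nlinarith
    have h5 : κ^N * ‖cf k (fun t => g t - t)‖ ≤ A M := by
      rw [← hκ, mul_pow] at h4
      have e : (κ^4)^N = κ^N * κ^(3*N) := by rw [← pow_mul, ← pow_add]; congr 1; ring
      rw [e] at h4
      have hp : 0 < β^N * κ^(3*N) := by positivity
      refine le_of_mul_le_mul_right ?_ hp
      nlinarith
    rw [le_div_iff₀ (by positivity)]
    refine le_trans ?_ h5
    rw [mul_comm]
    gcongr
    rw [hN, pow_mul, hκ]
    exact pow_le_pow_right₀ hK1 (by omega)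

/-- uniformly bounded derivatives up to order k -/
def UB {ι : Type} (k : ℕ) (u : ι → ℝ → ℝ) : Prop :=
  (∀ i, Sm (u i)) ∧ ∀ j ≤ k, ∃ B : ℝ, ∀ i x, |iteratedDeriv j (u i) x| ≤ B

section ub
variable {ι : Type} {k : ℕ} {u v : ι → ℝ → ℝ}

theorem UB.succ_iff : UB (k+1) u ↔ UB 0 u ∧ UB k (fun i => deriv (u i)) := by
  constructor
  · intro h
    refine ⟨⟨h.1, fun j hj => h.2 j (by omega)⟩, fun i => (h.1 i).deriv, fun j hj => ?_⟩
    obtain ⟨B, hB⟩ := h.2 (j+1) (by omega)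
    exact ⟨B, fun i x => by rw [← iteratedDeriv_succ']; exact hB i x⟩
  · rintro ⟨h0, h1⟩
    refine ⟨h0.1, fun j hj => ?_⟩
    cases j with
    | zero => exact h0.2 0 le_rfl
    | succ j =>
      obtain ⟨B, hB⟩ := h1.2 j (by omega)
      exact ⟨B, fun i x => by rw [iteratedDeriv_succ']; exact hB i x⟩

theorem UB.zero_iff (h : ∀ i, Sm (u i)) {B : ℝ} (hB : ∀ i x, |u i x| ≤ B) : UB 0 u := by
  refine ⟨h, fun j hj => ⟨B, fun i x => ?_⟩⟩
  obtain rfl : j = 0 := by omega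
  simpa using hB i x

theorem UB.le {k' : ℕ} (h : UB k u) (hk : k' ≤ k) : UB k' u := ⟨h.1, fun j hj => h.2 j (hj.trans hk)⟩

theorem UB.bd (h : UB k u) : ∃ B : ℝ, ∀ i x, |u i x| ≤ B := by
  obtain ⟨B, hB⟩ := h.2 0 (by omega)
  exact ⟨B, fun i x => by simpa using hB i x⟩

theorem UB.add (hu : UB k u) (hv : UB k v) : UB k (fun i x => u i x + v i x) := by
  refine ⟨fun i => (hu.1 i).add (hv.1 i), fun j hj => ?_⟩
  obtain ⟨B, hB⟩ := hu.2 j hj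
  obtain ⟨B', hB'⟩ := hv.2 j hj
  refine ⟨B + B', fun i x => ?_⟩
  have := iteratedDeriv_add ((hu.1 i).at j x) ((hv.1 i).at j x)
  have e : (fun x => u i x + v i x) = u i + v i := rfl
  simp only
  rw [e, this]
  exact (abs_add_le _ _).trans (add_le_add (hB i x) (hB' i x))

theorem UB.mul (hu : UB k u) (hv : UB k v) : UB k (fun i x => u i x * v i x) := by
  induction k generalizing u v with
  | zero =>
    obtain ⟨B, hB⟩ := hu.bd
    obtain ⟨B', hB'⟩ := hv.bd
    refine UB.zero_iff (fun i => (hu.1 i).mul (hv.1 i)) (B := B * B') fun i x => ?_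
    rw [abs_mul]
    exact mul_le_mul (hB i x) (hB' i x) (abs_nonneg _) ((abs_nonneg _).trans (hB i x))
  | succ k ih =>
    have h1 := UB.succ_iff.1 hu
    have h2 := UB.succ_iff.1 hv
    rw [UB.succ_iff]
    refine ⟨?_, ?_⟩
    · exact (ih (hu.le (by omega)) (hv.le (by omega))).le (by omega)
    · have e : (fun i => deriv (fun x => u i x * v i x)) = fun i x => (deriv (u i) x * v i x) + u i x * deriv (v i) x := by
        funext i x
        exact (((hu.1 i).hd x).mul ((hv.1 i).hd x)).deriv
      rw [e]
      exact (ih h1.2 (hv.le (by omega))).add (ih (hu.le (by omega)) h2.2)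

theorem UB.const (c : ℝ) : UB (ι := ι) k (fun _ _ => c) := by
  induction k generalizing c with
  | zero => exact UB.zero_iff (fun i => contDiff_const) (B := |c|) fun i x => le_rfl
  | succ k ih =>
    rw [UB.succ_iff]
    refine ⟨UB.zero_iff (fun i => contDiff_const) (B := |c|) fun i x => le_rfl, ?_⟩
    simp only [deriv_const']
    exact ih 0

theorem UB.inv (hu : UB k u) {δ : ℝ} (hδ : 0 < δ) (hl : ∀ i x, δ ≤ u i x) : UB k (fun i x => (u i x)⁻¹) := by
  have hs : ∀ i, Sm (fun x => (u i x)⁻¹) := fun i => (hu.1 i).inv fun x => (hδ.trans_le (hl i x)).ne'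
  have h0 : UB 0 (fun i x => (u i x)⁻¹) := by
    refine UB.zero_iff hs (B := δ⁻¹) fun i x => ?_
    have := hδ.trans_le (hl i x)
    rw [abs_of_pos (by positivity)]
    exact inv_anti₀ hδ (hl i x)
  induction k with
  | zero => exact h0
  | succ k ih =>
    have h1 := UB.succ_iff.1 hu
    rw [UB.succ_iff]
    refine ⟨h0, ?_⟩
    have ih' := ih (hu.le (by omega))
    have e : (fun i => deriv (fun x => (u i x)⁻¹)) = fun i x => ((-1) * deriv (u i) x) * ((u i x)⁻¹ * (u i x)⁻¹) := by
      funext i x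
      have hne := (hδ.trans_le (hl i x)).ne'
      have := (((hu.1 i).hd x).inv hne).deriv
      have e3 : (fun x => (u i x)⁻¹) = (u i)⁻¹ := rfl
      rw [e3, this]; field_simp
    rw [e]
    exact ((UB.const _).mul h1.2).mul (ih'.mul ih')

theorem UB.compInv {H : ι → ℝ → ℝ} {w : ι → ℝ → ℝ} (hw : ∀ k, UB k w) (hH : ∀ i, Sm (H i)) 
    (hd : ∀ i x, deriv (H i) x = w i (H i x)) (hu : ∀ k, UB k u) : UB k (fun i x => u i (H i x)) := by
  have hs : ∀ {u : ι → ℝ → ℝ}, (∀ k, UB k u) → UB 0 (fun i x => u i (H i x)) := by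
    intro u hu
    obtain ⟨B, hB⟩ := (hu 0).bd
    exact UB.zero_iff (fun i => ((hu 0).1 i).comp (hH i)) fun i x => hB i _
  induction k generalizing u with
  | zero => exact hs hu
  | succ k ih =>
    rw [UB.succ_iff]
    refine ⟨hs hu, ?_⟩
    have e : (fun i => deriv (fun x => u i (H i x))) = fun i x => (deriv (u i)) (H i x) * w i (H i x) := by
      funext i x
      rw [deriv_comp' ((hu 0).1 i) (hH i), ← hd]
    rw [e]
    exact (ih fun k => (UB.succ_iff.1 (hu (k+1))).2).mul (ih hw)
end ub

/-- conjugacy package -/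
structure Pk (τ : ℝ) (Λ : ℝ) (Bh : ℕ → ℝ) (F g H : ℝ → ℝ) : Prop where
  gs : Sm g
  hs : Sm H
  g0 : g 0 = 0
  h0 : H 0 = 0
  gp : ∀ t, g (t+1) = g t + 1
  hp : ∀ t, H (t+1) = H t + 1
  gh : ∀ x, g (H x) = x
  hg : ∀ x, H (g x) = x
  gF : ∀ t, g (t+τ) = F (g t)
  hF : ∀ x, H (F x) = H x + τ
  gl : ∀ x y, |g x - g y| ≤ Λ * |x - y|
  hl : ∀ x y, |H x - H y| ≤ Λ * |x - y|
  hd : ∀ x, 0 < deriv H x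
  hb : ∀ j x, |iteratedDeriv (j+1) H x| ≤ Bh j

theorem inv_pk {g : ℝ → ℝ} (hs : Sm g) {C5 : ℝ} (hC5 : 1 ≤ C5) (hl : ∀ x, 1 ≤ C5 * deriv g x) (hg0 : g 0 = 0) (hg1 : ∀ t, g (t+1) = g t + 1) :
   ∃ H : ℝ → ℝ, Sm H ∧ (∀ x, g (H x) = x) ∧ (∀ x, H (g x) = x) ∧ (∀ x, deriv H x = (deriv g (H x))⁻¹) := by
  have hpos : ∀ x, 0 < deriv g x := fun x => by
    have := hl x
    by_contra hc; push Not at hc; nlinarith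
  have hmono : StrictMono g := strictMono_of_deriv_pos hpos
  have hint : ∀ n : ℤ, g n = n := by
    intro n
    have h2 := g_iter (F := id) (g := g) (τ := 0) hg1 (fun t => by simp) 0 (-n) 0
    simpa [hg0] using h2
  have hsurj : Function.Surjective g := by
    intro y
    have h1 := intermediate_value_Icc (f := g) (a := (⌊y⌋:ℝ)) (b := ((⌊y⌋+1 : ℤ):ℝ)) (by push_cast; linarith) hs.continuous.continuousOn
    rw [hint, hint] at h1
    obtain ⟨x, _, hx⟩ := h1 ⟨Int.floor_le y, by push_cast; exact (Int.lt_floor_add_one y).le⟩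
    exact ⟨x, hx⟩
  let e := hmono.orderIsoOfSurjective g hsurj
  have he : ∀ x, e x = g x := fun x => rfl
  have hgH : ∀ x, g (e.symm x) = x := fun x => by rw [← he]; exact e.apply_symm_apply x
  have hHg : ∀ x, e.symm (g x) = x := fun x => by rw [← he]; exact e.symm_apply_apply x
  have hc : Continuous e.symm := e.symm.continuous
  have hd : ∀ x, HasDerivAt e.symm ((deriv g (e.symm x))⁻¹) x := fun x =>
    HasDerivAt.of_local_left_inverse hc.continuousAt (hs.hd _) (hpos _).ne' (Filter.Eventually.of_forall hgH)
  have hd' : deriv e.symm = fun x => (deriv g (e.symm x))⁻¹ := funext fun x => (hd x).deriv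
  have hn : ∀ n : ℕ, ContDiff ℝ n (e.symm : ℝ → ℝ) := by
    intro n
    induction n with
    | zero => exact contDiff_zero.2 hc
    | succ n ih =>
      push_cast
      rw [contDiff_succ_iff_deriv]
      refine ⟨fun x => (hd x).differentiableAt, by simp, ?_⟩
      rw [hd']
      exact ((hs.deriv.of_le (by exact_mod_cast le_top)).comp ih).inv fun x => (hpos _).ne'
  exact ⟨e.symm, contDiff_infty.2 hn, hgH, hHg, fun x => (hd x).deriv⟩

theorem exists_pk {τ c : ℝ} (hτ : Irrational τ) (b1 L : ℝ) (bs : ℕ → ℝ) {n : ℕ} (hc : 0 < c) (hc2 : c ≤ 1/2)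
   (hn : 1 ≤ n) (hD : ∀ a : ℕ, 0 < a → ∀ p : ℤ, c / a^n ≤ |a * τ - p|) :
   ∃ (Λ : ℝ) (Bh : ℕ → ℝ), 1 ≤ Λ ∧ ∀ F, Cls τ b1 L bs F → ∃ g H, Pk τ Λ Bh F g H := by
  obtain ⟨C5, hC5, hB⟩ := conclB hτ b1 L bs hc hc2 hn hD
  obtain ⟨Bs, hBs⟩ := gsm b1 L bs hc hn hD hC5
  let ι := {F : ℝ → ℝ // Cls τ b1 L bs F}
  choose g hg0 hgl hg1 hgF using fun i : ι => exists_g hτ hC5 i.2 (hB i.1 i.2).2.2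
  have hψ := fun i : ι => hBs i.1 (g i) i.2 (hB i.1 i.2).1 (hB i.1 i.2).2.2 (hg0 i) (hgl i) (hg1 i) (hgF i)
  have hψU : ∀ k, UB k (fun (i : ι) t => g i t - t) := fun k => ⟨fun i => (hψ i).1, fun j _ => ⟨Bs j, fun i x => (hψ i).2 j x⟩⟩
  have hgs : ∀ i, Sm (g i) := fun i => by
    have := (hψ i).1.add contDiff_id
    have e : (fun t => g i t - t) + id = g i := by funext t; simp
    rw [← e]; exact this
  have hgU : ∀ k, UB k (fun (i : ι) => deriv (g i)) := fun k => by
    have h1 := (UB.succ_iff.1 (hψU (k+1))).2.add (UB.const (ι := ι) 1)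
    have e : (fun (i : ι) => deriv (g i)) = fun i t => deriv (fun t => g i t - t) t + 1 := by
      funext i t
      have := (((hgs i).hd t).sub (hasDerivAt_id t)).deriv
      have e3 : (fun t => g i t - t) = g i - id := rfl
      rw [e3, this]; ring
    rw [e]; exact h1
  have hgd : ∀ i x, 1 ≤ C5 * deriv (g i) x := by
    intro i
    obtain ⟨ξ, _, hξ⟩ := mvt_eq (hgs i) 0 1
    have h1 : deriv (g i) ξ = 1 := by
      have := hg1 i 0
      rw [zero_add] at this
      rw [this, hg0] at hξ; linarith
    have hcl : IsClosed {b : ℝ | 1 ≤ C5 * deriv (g i) (ξ + b)} := by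
      have := (hgs i).deriv.continuous
      exact isClosed_le continuous_const (by fun_prop)
    have hsub : Orb τ ⊆ {b : ℝ | 1 ≤ C5 * deriv (g i) (ξ + b)} := by
      rintro _ ⟨⟨l, q⟩, rfl⟩
      have h2 : (fun t => g i (t + (l * τ - q))) = fun t => i.1^[l] (g i t) - q := funext fun t => g_iter (hg1 i) (hgF i) l q t
      have h3 := congrFun (congrArg deriv h2) ξ
      rw [deriv_comp_add_const, deriv_sub_const, deriv_comp' (i.2.isp l).1 (hgs i)] at h3
      simp only [h1, mul_one] at h3
      simp only [mem_setOf_eq]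
      rw [h3]
      exact (hB i.1 i.2).2.1 l _
    intro x
    have := hcl.closure_subset_iff.2 hsub
    rw [(Orb_dense hτ).closure_eq] at this
    have h4 := this (mem_univ (x - ξ))
    simpa using h4
  choose H hHs hgH hHg hHd using fun i : ι => inv_pk (hgs i) hC5 (hgd i) (hg0 i) (hg1 i)
  have hgdl : ∀ i x, C5⁻¹ ≤ deriv (g i) x := fun i x => by
    rw [inv_le_iff_one_le_mul₀ (by linarith)]; linarith [hgd i x]
  have hw : ∀ k, UB k (fun i x => (deriv (g i) x)⁻¹) := fun k => (hgU k).inv (inv_pos.2 (by linarith)) hgdl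
  have hHU : ∀ k, UB k (fun i => deriv (H i)) := fun k => by
    have := UB.compInv (k := k) hw hHs hHd hw
    have e : (fun i => deriv (H i)) = fun i x => (deriv (g i) (H i x))⁻¹ := by funext i x; rw [hHd]
    rw [e]; exact this
  choose Bh hBh using fun k => (hHU k).2 k le_rfl
  have hinj : ∀ i, Function.Injective (g i) := fun i => (Function.LeftInverse.injective (hHg i))
  have hHpos : ∀ i x, 0 < deriv (H i) x := fun i x => by
    rw [hHd]; exact inv_pos.2 ((inv_pos.2 (by linarith)).trans_le (hgdl i _))
  refine ⟨C5, Bh, hC5, fun F hF => ⟨g ⟨F, hF⟩, H ⟨F, hF⟩, ?_⟩⟩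
  generalize hi : (⟨F, hF⟩ : ι) = i
  have hiF : i.1 = F := by rw [← hi]
  refine ⟨hgs i, hHs i, hg0 i, ?_, hg1 i, ?_, hgH i, hHg i, ?_, ?_, hgl i, ?_, hHpos i, ?_⟩
  · conv_lhs => rw [← hg0 i]
    exact hHg i 0
  · intro t
    apply hinj i
    rw [hgH, hg1, hgH]
  · intro t; rw [hgF i, hiF]
  · intro x
    apply hinj i
    rw [hgH, hgF, hgH, hiF]
  · intro x y
    refine mvt (hHs i) fun z _ => ?_
    rw [abs_of_pos (hHpos i z), hHd]
    exact inv_le_of_inv_le₀ (by linarith) (hgdl i _)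
  · intro j x
    rw [iteratedDeriv_succ']; exact hBh j i x

theorem orb_net {τ : ℝ} (hτ : Irrational τ) {r : ℝ} (hr : 0 < r) : ∃ n : ℕ, ∀ t : ℝ, ∃ l ≤ n, ∃ q : ℤ, |l * τ - q - t| ≤ r := by
  obtain ⟨N, hN⟩ := exists_nat_gt (2/r)
  have hN0 : (0:ℝ) < N := (by positivity : 0 < 2/r).trans hN
  have hex : ∀ i : ℕ, ∃ lp : ℕ × ℤ, |lp.1 * τ - lp.2 - i/N| < r/2 := by
    intro i
    obtain ⟨_, h1, ⟨lp, rfl⟩⟩ := Metric.dense_iff.1 (Orb_dense hτ) (i/N) (r/2) (by positivity)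
    exact ⟨lp, by rw [Metric.mem_ball, Real.dist_eq] at h1; exact h1⟩
  choose lp hlp using hex
  refine ⟨∑ i ∈ Finset.range N, (lp i).1, fun t => ?_⟩
  obtain ⟨i, hi⟩ : ∃ i, i = ⌊Int.fract t * N⌋₊ := ⟨_, rfl⟩
  have f0 := Int.fract_nonneg t
  have f1 := Int.fract_lt_one t
  have i1 : (i:ℝ) ≤ Int.fract t * N := by rw [hi]; exact Nat.floor_le (by positivity)
  have i2 : Int.fract t * N < i + 1 := by rw [hi]; exact Nat.lt_floor_add_one _
  have iN : i < N := by
    have : (i:ℝ) < N := by nlinarith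
    exact_mod_cast this
  refine ⟨(lp i).1, Finset.single_le_sum (f := fun i => (lp i).1) (fun _ _ => Nat.zero_le _) (Finset.mem_range.2 iN), (lp i).2 - ⌊t⌋, ?_⟩
  have h1 := hlp i
  have h2 : |(i:ℝ)/N - Int.fract t| ≤ r/2 := by
    have hN2 : 1/N ≤ r/2 := by
      rw [div_lt_iff₀ hr] at hN
      rw [div_le_div_iff₀ hN0 two_pos]; linarith
    have e1 : (i:ℝ)/N ≤ Int.fract t := by rw [div_le_iff₀ hN0]; exact i1
    have e2 : Int.fract t ≤ (i:ℝ)/N + 1/N := by rw [← add_div, le_div_iff₀ hN0]; exact i2.le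
    rw [abs_le]; constructor <;> linarith
  have e : ((lp i).1:ℝ) * τ - (((lp i).2 - ⌊t⌋ : ℤ):ℝ) - t = ((lp i).1 * τ - (lp i).2 - i/N) + (i/N - Int.fract t) := by
    rw [Int.fract]; push_cast; ring
  rw [e]
  refine (abs_add_le _ _).trans (by linarith)

theorem per_int' {u : ℝ → ℝ} (hp : ∀ t, u (t+1) = u t) (t : ℝ) (q : ℤ) : u (t - q) = u t := by
  have : Function.Periodic u 1 := hp
  have := this.sub_int_mul_eq q (x := t)
  simpa using this

theorem cont0 {τ Λ : ℝ} (hτ : Irrational τ) (hΛ : 1 ≤ Λ) (Bh : ℕ → ℝ) {ε : ℝ} (hε : 0 < ε) : ∃ η > 0, ∀ F g H F1 g1 H1 : ℝ → ℝ, ∀ p : ℝ, 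
    Pk τ Λ Bh F g H → Pk τ Λ Bh F1 g1 H1 → (∀ x, |F x - F1 x - p| ≤ η) → ∀ x, |H1 x - H x| ≤ ε := by
  have hr : 0 < ε / (2*(Λ^2+1)) := by positivity
  obtain ⟨n, hn⟩ := orb_net hτ hr
  have hη : 0 < ε / (4 * Λ * (n+1)) := by positivity
  refine ⟨_, hη, fun F g H F1 g1 H1 p hP hP1 hF x => ?_⟩
  obtain ⟨η, hηe⟩ : ∃ η, η = ε / (4 * Λ * (n+1)) := ⟨_, rfl⟩
  rw [← hηe] at hF hη
  let u : ℝ → ℝ := fun t => H1 (g t) - t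
  have hu : ∀ t, u t = H1 (g t) - t := fun _ => rfl
  have up : ∀ t, u (t+1) = u t := fun t => by rw [hu, hu, hP.gp, hP1.hp]; ring
  have uc : Continuous u := by
    have := hP1.hs.continuous; have := hP.gs.continuous; fun_prop
  have u0 : u 0 = 0 := by rw [hu, hP.g0, hP1.h0]; ring
  have ud : ∀ t, u (t+τ) - u t = H1 (F (g t)) - H1 (F1 (g t)) := fun t => by
    rw [hu, hu, hP.gF, hP1.hF]; ring
  have hmono : StrictMono H1 := strictMono_of_deriv_pos hP1.hd
  have hp1 : p ≤ η := by
    obtain ⟨x0, hx0⟩ := per_max uc up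
    have h1 := ud x0
    have h2 := hx0 (x0 + τ)
    have h3 : F (g x0) ≤ F1 (g x0) := hmono.le_iff_le.1 (by linarith)
    have := (abs_le.1 (hF (g x0))).1
    linarith
  have hp2 : -η ≤ p := by
    obtain ⟨x0, hx0⟩ := per_max (f := fun t => - u t) uc.neg (fun t => by rw [up])
    have h1 := ud x0
    have h2 := hx0 (x0 + τ)
    have h3 : F1 (g x0) ≤ F (g x0) := hmono.le_iff_le.1 (by linarith)
    have := (abs_le.1 (hF (g x0))).2
    linarith
  have hFF : ∀ x, |F x - F1 x| ≤ 2 * η := fun x => by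
    have := abs_le.1 (hF x)
    rw [abs_le]; constructor <;> linarith
  have ud2 : ∀ t, |u (t+τ) - u t| ≤ Λ * (2*η) := fun t => by
    rw [ud]
    refine (hP1.hl _ _).trans ?_
    have := hFF (g t)
    gcongr
  have ul : ∀ l : ℕ, |u (l*τ)| ≤ l * (Λ * (2*η)) := by
    intro l
    induction l with
    | zero => simp [u0]
    | succ l ih =>
      have h1 := ud2 (l*τ)
      have e : u ((l+1:ℕ)*τ) = (u (l*τ+τ) - u (l*τ)) + u (l*τ) := by
        rw [sub_add_cancel]; push_cast; congr 1; ring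
      rw [e]
      refine (abs_add_le _ _).trans ?_
      push_cast; linarith
  have ulip : ∀ s t, |u s - u t| ≤ (Λ^2+1) * |s - t| := by
    intro s t
    have h1 := hP1.hl (g s) (g t)
    have h2 := hP.gl s t
    have e : u s - u t = (H1 (g s) - H1 (g t)) - (s - t) := by rw [hu, hu]; ring
    rw [e]
    refine (abs_sub _ _).trans ?_
    have : Λ * |g s - g t| ≤ Λ * (Λ * |s-t|) := by gcongr
    nlinarith
  have ub : ∀ t, |u t| ≤ ε := by
    intro t
    obtain ⟨l, hl, q, hq⟩ := hn t
    have h1 := ulip t (l*τ - q)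
    rw [per_int' up] at h1
    have h2 := ul l
    have h3 : (l:ℝ) ≤ n + 1 := by
      have : (l:ℝ) ≤ n := by exact_mod_cast hl
      linarith
    have h4 : l * (Λ * (2*η)) ≤ ε/2 := by
      calc l * (Λ * (2*η)) ≤ (n+1) * (Λ * (2*η)) := by gcongr
        _ = ε/2 := by rw [hηe]; field_simp; ring
    have h5 : (Λ^2+1) * |t - (l*τ-q)| ≤ ε/2 := by
      rw [abs_sub_comm]
      calc (Λ^2+1) * |l*τ-q - t| ≤ (Λ^2+1) * (ε / (2*(Λ^2+1))) := by gcongr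
        _ = ε/2 := by field_simp
    have e : u t = (u t - u (l*τ)) + u (l*τ) := by ring
    rw [e]
    exact (abs_add_le _ _).trans (by linarith)
  have := ub (H x)
  rw [hu, hP.gh] at this
  exact this

theorem contj {τ Λ : ℝ} (hτ : Irrational τ) (hΛ : 1 ≤ Λ) (Bh : ℕ → ℝ) (j : ℕ) {ε : ℝ} (hε : 0 < ε) : ∃ η > 0, ∀ F g H F1 g1 H1 : ℝ → ℝ, ∀ p : ℝ, 
    Pk τ Λ Bh F g H → Pk τ Λ Bh F1 g1 H1 → (∀ x, |F x - F1 x - p| ≤ η) → ∀ x, |iteratedDeriv j H1 x - iteratedDeriv j H x| ≤ ε := by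
  obtain ⟨C, hC, hlk⟩ := lk 1 j
  obtain ⟨B, hB⟩ : ∃ B, B = 2 * |Bh j| := ⟨_, rfl⟩
  have hB0 : 0 ≤ B := by rw [hB]; positivity
  obtain ⟨T, hT⟩ : ∃ T, T = ε / (2 * (C * B + 1)) := ⟨_, rfl⟩
  have hT0 : 0 < T := by rw [hT]; positivity
  obtain ⟨δ, hδ⟩ : ∃ δ, δ = ε * T^j / (2 * (C + 1)) := ⟨_, rfl⟩
  have hδ0 : 0 < δ := by rw [hδ]; positivity
  obtain ⟨η, hη, h0⟩ := cont0 hτ hΛ Bh hδ0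
  refine ⟨η, hη, fun F g H F1 g1 H1 p hP hP1 hF x => ?_⟩
  have hsub : ∀ j x, iteratedDeriv j (H1 - H) x = iteratedDeriv j H1 x - iteratedDeriv j H x := fun j x => 
    iteratedDeriv_sub (hP1.hs.at j x) (hP.hs.at j x)
  have h1 := hlk (H1 - H) x T δ B (hP1.hs.sub hP.hs) hT0 (fun y _ => h0 F g H F1 g1 H1 p hP hP1 hF y) (fun y _ => by
    rw [hsub]
    refine (abs_sub _ _).trans ?_
    have a1 := hP1.hb j y
    have a2 := hP.hb j y
    have := le_abs_self (Bh j)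
    rw [hB]; linarith) x ⟨le_rfl, by linarith⟩
  rw [hsub] at h1
  refine h1.trans ?_
  have e1 : C * (δ / T^j) ≤ ε/2 := by
    have : C * (δ / T^j) = C / (C+1) * (ε/2) := by rw [hδ]; field_simp
    rw [this]
    have : C/(C+1) ≤ 1 := by rw [div_le_one (by positivity)]; linarith
    nlinarith
  have e2 : C * (B * T^1) ≤ ε/2 := by
    have hh : C * (B * T^1) = (C*B) / (C*B+1) * (ε/2) := by rw [hT]; field_simp
    rw [hh]
    have hcb : 0 ≤ C * B := by positivity
    have : C*B/(C*B+1) ≤ 1 := by rw [div_le_one (by positivity)]; linarith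
    nlinarith
  linarith [mul_add C (δ / T^j) (B*T^1)]

theorem lift_unique {f : Equiv.Perm S1} {F G : ℝ → ℝ} (hF : IsLift f F) (hG : IsLift f G) : ∃ n : ℤ, ∀ x, F x = G x + n := by
  have h : ∀ x, ∃ n : ℤ, (n:ℝ) = F x - G x := by
    intro x
    have h1 : ((F x - G x : ℝ) : S1) = 0 := by
      rw [AddCircle.coe_sub, ← hF.2.2.2, ← hG.2.2.2, sub_self]
    obtain ⟨n, hn⟩ := (AddCircle.coe_eq_zero_iff 1).1 h1
    exact ⟨n, by simpa using hn⟩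
  choose n hn using h
  have hc : Continuous n := by
    rw [Int.isClosedEmbedding_coe_real.isEmbedding.continuous_iff]
    have e : (Int.cast ∘ n : ℝ → ℝ) = fun x => F x - G x := funext hn
    rw [e]
    exact hF.1.continuous.sub hG.1.continuous
  refine ⟨n 0, fun x => ?_⟩
  have := PreconnectedSpace.constant (Y := ℤ) inferInstance hc (x := x) (y := 0)
  rw [← this, hn]; ring

theorem lift_shift {f : Equiv.Perm S1} {F : ℝ → ℝ} (hF : IsLift f F) (n : ℤ) : IsLift f (fun x => F x - n) := by
  refine ⟨hF.1.sub contDiff_const, fun x => by simp only [hF.2.1]; ring, fun x => by rw [deriv_sub_const]; exact hF.2.2.1 x, fun x => ?_⟩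
  rw [hF.2.2.2, AddCircle.coe_sub]
  have : ((n:ℝ) : S1) = 0 := (AddCircle.coe_eq_zero_iff 1).2 ⟨n, by simp⟩
  rw [this, sub_zero]

theorem lift_tau {f : Equiv.Perm S1} {t : S1} (hf : HasRotNum f t) {τ : ℝ} (hτ : (τ : S1) = t) : 
    ∃ F, IsLift f F ∧ ∀ (k l : ℕ) (q : ℤ), k * τ + q < l * τ → ∀ x, F^[k] x + q < F^[l] x := by
  obtain ⟨F, τ', hF, hτ', hlim⟩ := hf
  obtain ⟨n, hn⟩ : ∃ n : ℤ, (n:ℝ) = τ' - τ := by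
    have h1 : ((τ' - τ : ℝ) : S1) = 0 := by rw [AddCircle.coe_sub, hτ, hτ', sub_self]
    obtain ⟨n, hn⟩ := (AddCircle.coe_eq_zero_iff 1).1 h1
    exact ⟨n, by simpa using hn⟩
  have hG := lift_shift hF n
  refine ⟨_, hG, ?_⟩
  obtain ⟨G, hGe⟩ : ∃ G, G = fun x => F x - n := ⟨_, rfl⟩
  rw [← hGe] at hG ⊢
  have hmono : StrictMono G := strictMono_of_deriv_pos hG.2.2.1
  let Φ : CircleDeg1Lift := ⟨⟨G, hmono.monotone⟩, hG.2.1⟩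
  have hΦ : ⇑Φ = G := rfl
  have hFmono : StrictMono F := strictMono_of_deriv_pos hF.2.2.1
  let Ψ : CircleDeg1Lift := ⟨⟨F, hFmono.monotone⟩, hF.2.1⟩
  have hΨ : ⇑Ψ = F := rfl
  have hit : ∀ m : ℕ, G^[m] 0 = F^[m] 0 - m * n := by
    intro m
    induction m with
    | zero => simp
    | succ m ih =>
      rw [Function.iterate_succ_apply', Function.iterate_succ_apply', ih, hGe]
      have := Ψ.map_sub_int (F^[m] 0) (m * n)
      rw [hΨ] at this
      push_cast at this ⊢
      rw [this]; ring
  have htn : Φ.translationNumber = τ := by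
    apply Φ.translationNumber_eq_of_tendsto₀
    rw [hΦ]
    have h1 : Tendsto (fun m : ℕ => F^[m] 0 / m - n) atTop (𝓝 (τ' - n)) := hlim.sub_const _
    rw [hn, sub_sub_cancel] at h1
    refine h1.congr' ?_
    filter_upwards [eventually_gt_atTop 0] with m hm
    have : (m:ℝ) ≠ 0 := by exact_mod_cast hm.ne'
    rw [hit]; field_simp
    rw [hn]
  have hpow : ∀ d : ℕ, (Φ^d).translationNumber = d * τ := fun d => by rw [CircleDeg1Lift.translationNumber_pow, htn]
  have hpc : ∀ (d : ℕ) x, (Φ^d) x = G^[d] x := fun d x => by rw [CircleDeg1Lift.coe_pow, hΦ]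
  intro k l q h x
  rcases le_total k l with hkl | hkl
  · obtain ⟨d, rfl⟩ := Nat.exists_eq_add_of_le' hkl
    push_cast at h
    have := (Φ^d).lt_map_of_int_lt_translationNumber (n := q) (by rw [hpow]; linarith) (G^[k] x)
    rw [hpc, ← Function.iterate_add_apply] at this
    exact this
  · obtain ⟨d, rfl⟩ := Nat.exists_eq_add_of_le' hkl
    push_cast at h
    have := (Φ^d).map_lt_of_translationNumber_lt_int (n := -q) (by rw [hpow]; push_cast; linarith) (G^[l] x)
    rw [hpc, ← Function.iterate_add_apply] at this
    push_cast at this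
    linarith

theorem per_bdd {f : ℝ → ℝ} (hf : Continuous f) (hp : ∀ x, f (x+1) = f x) : ∃ B, ∀ x, |f x| ≤ B := by
  obtain ⟨x0, h⟩ := per_max hf.abs (fun x => by rw [hp])
  exact ⟨_, h⟩

theorem dj_per {f : ℝ → ℝ} (hp : ∀ x, f (x+1) = f x) (j : ℕ) (x : ℝ) : iteratedDeriv j f (x+1) = iteratedDeriv j f x := by
  have e : (fun x => f (x+1)) = f := funext hp
  have := iteratedDeriv_comp_add_const j f 1
  rw [e] at this
  exact (congrFun this x).symm

theorem lift_dper {f : Equiv.Perm S1} {F : ℝ → ℝ} (hF : IsLift f F) (x : ℝ) : deriv F (x+1) = deriv F x := by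
  have e : (fun x => F (x+1)) = fun x => F x + 1 := funext hF.2.1
  have := congrFun (congrArg deriv e) x
  rw [deriv_comp_add_const, deriv_add_const] at this
  exact this

theorem lift_dj {f g : Equiv.Perm S1} {F G : ℝ → ℝ} (hF : IsLift f F) (hG : IsLift g G) (k j : ℕ) (hj : j ≤ k) (x : ℝ) :
    |iteratedDeriv j F x - iteratedDeriv j G x| ≤ liftDist k F G := by
  have hb : BddAbove (range fun x => |iteratedDeriv j F x - iteratedDeriv j G x|) := by
    have hFs : Sm F := hF.1
    have hGs : Sm G := hG.1
    obtain ⟨B, hB⟩ := per_bdd (f := iteratedDeriv j (F - G)) (Sm.iter (hFs.sub hGs) j).continuous 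
      (dj_per (fun x => by simp only [Pi.sub_apply]; rw [hF.2.1, hG.2.1]; ring) j)
    refine ⟨B, ?_⟩
    rintro _ ⟨y, rfl⟩
    simp only
    rw [← iteratedDeriv_sub (hFs.at j y) (hGs.at j y)]
    exact hB y
  refine (le_ciSup hb x).trans ?_
  exact le_ciSup (f := fun j : Fin (k+1) => ⨆ x : ℝ, |iteratedDeriv (j : ℕ) F x - iteratedDeriv (j : ℕ) G x|) (Set.finite_range _).bddAbove ⟨j, by omega⟩

theorem close {f g : Equiv.Perm S1} {F G : ℝ → ℝ} (hF : IsLift f F) (hG : IsLift g G) {k : ℕ} {ε : ℝ} (h : distC k f g < ε) :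
    (∃ p : ℝ, ∀ x, |F x - G x - p| ≤ ε) ∧ ∀ j < k, ∀ x, |iteratedDeriv j (deriv F) x - iteratedDeriv j (deriv G) x| ≤ ε := by
  obtain ⟨_, ⟨F', G', hF', hG', rfl⟩, hd⟩ := exists_lt_of_csInf_lt (s := {d | ∃ F G, IsLift f F ∧ IsLift g G ∧ d = liftDist k F G}) ⟨_, F, G, hF, hG, rfl⟩ h
  obtain ⟨n, hn⟩ := lift_unique hF hF'
  obtain ⟨m, hm⟩ := lift_unique hG hG'
  constructor
  · refine ⟨n - m, fun x => ?_⟩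
    have := lift_dj hF' hG' k 0 (by omega) x
    simp only [iteratedDeriv_zero] at this
    rw [hn, hm]
    have e : F' x + n - (G' x + m) - (n - m) = F' x - G' x := by ring
    rw [e]; exact this.trans hd.le
  · intro j hj x
    have := lift_dj hF' hG' k (j+1) (by omega) x
    have e1 : deriv F = deriv F' := by rw [show F = fun x => F' x + n from funext hn]; funext x; rw [deriv_add_const]
    have e2 : deriv G = deriv G' := by rw [show G = fun x => G' x + m from funext hm]; funext x; rw [deriv_add_const]
    rw [iteratedDeriv_succ', iteratedDeriv_succ'] at this
    rw [e1, e2]; exact this.trans hd.le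

theorem distC_le {f g : Equiv.Perm S1} {F G : ℝ → ℝ} (hF : IsLift f F) (hG : IsLift g G) {k : ℕ} {ε : ℝ} 
    (h : ∀ j ≤ k, ∀ x, |iteratedDeriv j F x - iteratedDeriv j G x| ≤ ε) : distC k f g ≤ ε := by
  refine (csInf_le (s := {d | ∃ F G, IsLift f F ∧ IsLift g G ∧ d = liftDist k F G}) ⟨0, ?_⟩ ⟨F, G, hF, hG, rfl⟩).trans ?_
  · rintro _ ⟨F', G', hF', hG', rfl⟩
    exact (abs_nonneg _).trans (lift_dj hF' hG' k 0 (by omega) 0)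
  · exact ciSup_le fun j => ciSup_le fun x => h j (by omega) x

theorem distC_nonneg (k : ℕ) (f g : Equiv.Perm S1) : 0 ≤ distC k f g := by
  refine Real.sInf_nonneg ?_
  rintro _ ⟨F', G', hF', hG', rfl⟩
  exact (abs_nonneg _).trans (lift_dj hF' hG' k 0 (by omega) 0)

theorem ev_bd {f : ℕ → ℝ → ℝ} (h1 : ∀ m, ∃ B, ∀ x, f m x ≤ B) (h2 : ∃ B, ∀ᶠ m in atTop, ∀ x, f m x ≤ B) : ∃ B, ∀ m x, f m x ≤ B := by
  choose b hb using h1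
  obtain ⟨B, hB⟩ := h2
  obtain ⟨M, hM⟩ := eventually_atTop.1 hB
  refine ⟨|B| + ∑ i ∈ Finset.range M, |b i|, fun m x => ?_⟩
  have h0 : 0 ≤ ∑ i ∈ Finset.range M, |b i| := Finset.sum_nonneg fun _ _ => abs_nonneg _
  rcases le_or_gt M m with h | h
  · linarith [hM m h x, le_abs_self B]
  · have := Finset.single_le_sum (f := fun i => |b i|) (fun _ _ => abs_nonneg _) (Finset.mem_range.2 h)
    linarith [hb m x, le_abs_self (b m), abs_nonneg B]

theorem seq_cls {τ : ℝ} {A : ℕ → Equiv.Perm S1} {F : ℕ → ℝ → ℝ} (hF : ∀ m, IsLift (A m) (F m)) 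
    (ho : ∀ m, ∀ (k l : ℕ) (q : ℤ), k * τ + q < l * τ → ∀ x, (F m)^[k] x + q < (F m)^[l] x) 
    (h1 : ∀ j, ∃ B, ∀ᶠ m in atTop, ∀ x, |iteratedDeriv j (deriv (F m)) x| ≤ B) 
    (h2 : ∃ δ > 0, ∀ᶠ m in atTop, ∀ x, δ ≤ deriv (F m) x) : ∃ b1 L bs, ∀ m, Cls τ b1 L bs (F m) := by
  have hs : ∀ m, Sm (F m) := fun m => (hF m).1
  have hU : ∀ k, UB k (fun m => deriv (F m)) := fun k => ⟨fun m => (hs m).deriv, fun j _ => 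
    ev_bd (fun m => per_bdd ((hs m).deriv.iter j).continuous (dj_per (lift_dper (hF m)) j)) (h1 j)⟩
  obtain ⟨B, hB⟩ : ∃ B, ∀ m x, (deriv (F m) x)⁻¹ ≤ B := by
    refine ev_bd (fun m => ?_) ?_
    · obtain ⟨B, hB⟩ := per_bdd (f := fun x => (deriv (F m) x)⁻¹) ((hs m).deriv.continuous.inv₀ fun x => ((hF m).2.2.1 x).ne') (fun x => by rw [lift_dper (hF m)])
      exact ⟨B, fun x => (le_abs_self _).trans (hB x)⟩
    · obtain ⟨δ, hδ, h⟩ := h2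
      refine ⟨δ⁻¹, ?_⟩
      filter_upwards [h] with m hm x
      exact inv_anti₀ hδ (hm x)
  have hB0 : 0 < B := (inv_pos.2 ((hF 0).2.2.1 0)).trans_le (hB 0 0)
  have hl : ∀ m x, B⁻¹ ≤ deriv (F m) x := fun m x => inv_le_of_inv_le₀ ((hF m).2.2.1 x) (hB m x)
  have hI : ∀ k, UB k (fun m x => (deriv (F m) x)⁻¹) := fun k => (hU k).inv (inv_pos.2 hB0) hl
  have hN : ∀ k, UB k (fun m => nl (F m)) := fun k => by
    have := (UB.succ_iff.1 (hU (k+1))).2.mul (hI k)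
    have e : (fun m => nl (F m)) = fun m x => deriv (deriv (F m)) x * (deriv (F m) x)⁻¹ := by
      funext m x; rw [nl, div_eq_mul_inv]
    rw [e]; exact this
  have hS : ∀ k, UB k (fun m => sch (F m)) := fun k => by
    have := (UB.succ_iff.1 (hN (k+1))).2.add ((UB.const (-(1/2))).mul ((hN k).mul (hN k)))
    have e : (fun m => sch (F m)) = fun m x => deriv (nl (F m)) x + (-(1/2)) * (nl (F m) x * nl (F m) x) := by
      funext m x; rw [sch]; ring
    rw [e]; exact this
  obtain ⟨b1, hb1⟩ := (hU 0).bd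
  obtain ⟨L, hL⟩ := (hN 0).bd
  choose bs hbs using fun j => (hS j).2 j le_rfl
  exact ⟨b1, L, bs, fun m => ⟨hs m, (hF m).2.1, (hF m).2.2.1, fun x => (le_abs_self _).trans (hb1 m x), hL m, fun j x => hbs j m x, ho m⟩⟩

theorem sol {a : Equiv.Perm S1} {F g H : ℝ → ℝ} {t : S1} {τ Λ : ℝ} {Bh : ℕ → ℝ} (hirr : Irrational τ) (hF : IsLift a F) (hP : Pk τ Λ Bh F g H) (hτ : (τ : S1) = t) :
    ∃ c : Equiv.Perm S1, IsLift c H ∧ c ((0 : ℝ) : S1) = ((0 : ℝ) : S1) ∧ c * a * c⁻¹ = rot t ∧ 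
     ∀ c' : Equiv.Perm S1, HasLift c' → c' ((0 : ℝ) : S1) = ((0 : ℝ) : S1) → c' * a * c'⁻¹ = rot t → c' = c := by
  have p1 : ((1:ℝ) : S1) = 0 := AddCircle.coe_period 1
  have per : ∀ {G : ℝ → ℝ}, (∀ x, G (x+1) = G x + 1) → Function.Periodic (fun x => (G x : S1)) 1 := by
    intro G hG x
    simp only
    rw [hG, AddCircle.coe_add, p1, add_zero]
  let c : Equiv.Perm S1 := ⟨(per hP.hp).lift, (per hP.gp).lift, fun y => by
    induction y using QuotientAddGroup.induction_on with
    | H x => 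
      change ((g (H x) : ℝ) : S1) = x
      rw [hP.gh], fun y => by
    induction y using QuotientAddGroup.induction_on with
    | H x => 
      change ((H (g x) : ℝ) : S1) = x
      rw [hP.hg]⟩
  have hc : ∀ x : ℝ, c (x : S1) = (H x : S1) := fun x => rfl
  have conj : ∀ c : Equiv.Perm S1, c * a * c⁻¹ = rot t ↔ ∀ x : ℝ, c (a (x : S1)) = c x + t := by
    intro c
    rw [mul_inv_eq_iff_eq_mul, Equiv.ext_iff]
    constructor
    · intro h x; exact h x
    · intro h y
      induction y using QuotientAddGroup.induction_on with
      | H x => exact h x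
  refine ⟨c, ⟨hP.hs, hP.hp, hP.hd, hc⟩, by rw [hc, hP.h0], ?_, ?_⟩
  · rw [conj]
    intro x
    rw [hF.2.2.2, hc, hc, hP.hF, AddCircle.coe_add, hτ]
  · rintro c' ⟨H', hH'⟩ h0 hcj
    rw [conj] at hcj
    have key : (fun x : ℝ => (H' (g x) : S1)) = fun x : ℝ => (x : S1) := by
      have cc : Continuous (fun x : ℝ => (x : S1)) := AddCircle.continuous_mk' 1
      refine Continuous.ext_on (Orb_dense hirr) (cc.comp (hH'.1.continuous.comp hP.gs.continuous)) cc ?_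
      rintro _ ⟨⟨l, q⟩, rfl⟩
      have hl : ∀ l : ℕ, c' ((g (l * τ) : ℝ) : S1) = ((l * τ : ℝ) : S1) := by
        intro l
        induction l with
        | zero => simpa [hP.g0] using h0
        | succ l ih =>
          have e : ((l+1 : ℕ):ℝ) * τ = l * τ + τ := by push_cast; ring
          rw [e, hP.gF, ← hF.2.2.2, hcj, ih, AddCircle.coe_add, hτ]
      have hq : ((q:ℝ) : S1) = 0 := (AddCircle.coe_eq_zero_iff 1).2 ⟨q, by simp⟩
      have e1 : g (l * τ - q) = g (l * τ) - q := by
        have := g_iter (F := id) (g := g) (τ := 0) hP.gp (fun t => by simp) 0 q (l*τ)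
        simp at this
        exact this
      simp only
      rw [e1, ← hH'.2.2.2, AddCircle.coe_sub, AddCircle.coe_sub, hq, sub_zero, sub_zero]
      exact hl l
    ext y
    induction y using QuotientAddGroup.induction_on with
    | H x =>
      have := congrFun key (H x)
      simp only [hP.gh] at this
      rw [← hH'.2.2.2] at this
      exact this

theorem dio {τ : ℝ} (h : DiophantineReal τ) : Irrational τ ∧ ∃ (c : ℝ) (n : ℕ), 0 < c ∧ c ≤ 1/2 ∧ 1 ≤ n ∧ 
    ∀ a : ℕ, 0 < a → ∀ p : ℤ, c / a^n ≤ |a * τ - p| := by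
  obtain ⟨C, hC, n, hn, h⟩ := h
  constructor
  · rintro ⟨r, rfl⟩
    have h1 := h r.num r.den (by exact_mod_cast r.den_nz)
    have e : ((r.den:ℤ):ℝ) * (r:ℝ) - (r.num:ℝ) = 0 := by
      have : (r.den:ℚ) * r = r.num := Rat.den_mul_eq_num r
      have h2 : ((r.den:ℝ)) * (r:ℝ) = r.num := by exact_mod_cast this
      push_cast
      rw [h2, sub_self]
    rw [e, abs_zero] at h1
    have : 0 ≤ C / |(((r.den:ℤ)):ℝ)|^n := by positivity
    linarith
  · refine ⟨min C (1/2), n, by positivity, min_le_right _ _, hn, fun a ha p => ?_⟩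
    have h1 := h p a (by exact_mod_cast ha.ne')
    push_cast at h1
    rw [abs_of_nonneg (by positivity : (0:ℝ) ≤ a)] at h1
    refine le_trans ?_ h1.le
    gcongr
    exact min_le_left _ _

theorem lift_min {f : Equiv.Perm S1} {F : ℝ → ℝ} (hF : IsLift f F) : ∃ δ > 0, ∀ x, δ ≤ deriv F x := by
  have hs : Sm F := hF.1
  obtain ⟨x0, h0⟩ := per_max (f := fun x => - deriv F x) hs.deriv.continuous.neg (fun x => by rw [lift_dper hF])
  exact ⟨deriv F x0, hF.2.2.1 x0, fun x => by linarith [h0 x]⟩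

theorem seq_close {τ : ℝ} {A : ℕ → Equiv.Perm S1} {F : ℕ → ℝ → ℝ} (hF : ∀ m, IsLift (A m) (F m)) 
    (ho : ∀ m, ∀ (k l : ℕ) (q : ℤ), k * τ + q < l * τ → ∀ x, (F m)^[k] x + q < (F m)^[l] x) 
    {a : Equiv.Perm S1} {G : ℝ → ℝ} (hG : IsLift a G) (hd : ∀ k, Tendsto (fun m => distC k (A m) a) atTop (𝓝 0)) :
    ∃ b1 L bs, ∀ m, Cls τ b1 L bs (F m) := by
  have hs : Sm G := hG.1
  refine seq_cls hF ho (fun j => ?_) ?_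
  · obtain ⟨B, hB⟩ := per_bdd (hs.deriv.iter j).continuous (dj_per (lift_dper hG) j)
    refine ⟨B + 1, ?_⟩
    filter_upwards [(hd (j+1)).eventually_lt_const one_pos] with m hm x
    have h1 := (close (hF m) hG hm).2 j (by omega) x
    have h2 := hB x
    have e : iteratedDeriv j (deriv (F m)) x = (iteratedDeriv j (deriv (F m)) x - iteratedDeriv j (deriv G) x) + iteratedDeriv j (deriv G) x := by ring
    rw [e]
    exact (abs_add_le _ _).trans (by linarith)
  · obtain ⟨δ, hδ, h⟩ := lift_min hG
    refine ⟨δ/2, by positivity, ?_⟩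
    filter_upwards [(hd 1).eventually_lt_const (half_pos hδ)] with m hm x
    have h1 := (close (hF m) hG hm).2 0 (by omega) x
    simp only [iteratedDeriv_zero] at h1
    have := (abs_le.1 h1).1
    linarith [h x]

end HY

/-- Herman–Yoccoz: if `t` is Diophantine, every smooth circle diffeomorphism
with rotation number `t` is smoothly conjugate to the rotation `R_t` by a unique conjugacy
`c` fixing `0`; moreover `c` depends continuously on `a` in the C^∞ topology. -/
theorem herman_yoccoz (t : S1) (ht : Diophantine t) :
    ∀ a : Equiv.Perm S1, HasLift a → HasRotNum a t →
      (∃! c : Equiv.Perm S1, HasLift c ∧ c ((0 : ℝ) : S1) = ((0 : ℝ) : S1) ∧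
        c * a * c⁻¹ = rot t) ∧
      ∀ (A : ℕ → Equiv.Perm S1) (C : ℕ → Equiv.Perm S1) (c : Equiv.Perm S1),
        (∀ m, HasLift (A m)) → (∀ m, HasRotNum (A m) t) →
        (HasLift c ∧ c ((0 : ℝ) : S1) = ((0 : ℝ) : S1) ∧ c * a * c⁻¹ = rot t) →
        (∀ m, HasLift (C m) ∧ C m ((0 : ℝ) : S1) = ((0 : ℝ) : S1) ∧
          C m * A m * (C m)⁻¹ = rot t) →
        (∀ k : ℕ, Tendsto (fun m => distC k (A m) a) atTop (nhds 0)) →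
        ∀ k : ℕ, Tendsto (fun m => distC k (C m) c) atTop (nhds 0) := by
  intro a _ hrot
  obtain ⟨τ, hτ, hdio⟩ := ht
  obtain ⟨hirr, c0, n, hc0, hc2, hn, hD⟩ := HY.dio hdio
  obtain ⟨F, hF, ho⟩ := HY.lift_tau hrot hτ
  have hzero : ∀ k, distC k a a = 0 := fun k => le_antisymm 
    (HY.distC_le hF hF fun j _ x => by rw [sub_self, abs_zero]) (HY.distC_nonneg k a a)
  constructor
  · obtain ⟨b1, L, bs, hcls⟩ := HY.seq_close (A := fun _ => a) (F := fun _ => F) (fun _ => hF) (fun _ => ho) hF (fun k => by simp only [hzero]; exact tendsto_const_nhds)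
    obtain ⟨Λ, Bh, hΛ, hpk⟩ := HY.exists_pk hirr b1 L bs hc0 hc2 hn hD
    obtain ⟨g, H, hP⟩ := hpk F (hcls 0)
    obtain ⟨c, h1, h2, h3, h4⟩ := HY.sol hirr hF hP hτ
    exact ⟨c, ⟨⟨H, h1⟩, h2, h3⟩, fun c' hc' => h4 c' hc'.1 hc'.2.1 hc'.2.2⟩
  · intro A C c _ hAr hc hC hlim k
    choose Fm hFm hom using fun m => HY.lift_tau (hAr m) hτ
    let A' : ℕ → Equiv.Perm S1 := fun m => Nat.casesOn m a A
    let F' : ℕ → ℝ → ℝ := fun m => Nat.casesOn m F Fm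
    have hF' : ∀ m, IsLift (A' m) (F' m) := fun m => by
      cases m with
      | zero => exact hF
      | succ m => exact hFm m
    have ho' : ∀ m, ∀ (k l : ℕ) (q : ℤ), k * τ + q < l * τ → ∀ x, (F' m)^[k] x + q < (F' m)^[l] x := fun m => by
      cases m with
      | zero => exact ho
      | succ m => exact hom m
    obtain ⟨b1, L, bs, hcls⟩ := HY.seq_close hF' ho' hF (fun k => (tendsto_add_atTop_iff_nat 1).1 (hlim k))
    obtain ⟨Λ, Bh, hΛ, hpk⟩ := HY.exists_pk hirr b1 L bs hc0 hc2 hn hD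
    obtain ⟨g, H, hP⟩ := hpk F (hcls 0)
    choose gm Hm hPm using fun m => hpk (Fm m) (hcls (m+1))
    obtain ⟨c1, k1, k2, k3, k4⟩ := HY.sol hirr hF hP hτ
    have hcL : IsLift c H := by rw [k4 c hc.1 hc.2.1 hc.2.2]; exact k1
    have hCL : ∀ m, IsLift (C m) (Hm m) := fun m => by
      obtain ⟨c1, k1, k2, k3, k4⟩ := HY.sol hirr (hFm m) (hPm m) hτ
      rw [k4 (C m) (hC m).1 (hC m).2.1 (hC m).2.2]; exact k1
    rw [Metric.tendsto_atTop']
    intro ε hε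
    choose η hη hcont using fun j => HY.contj hirr hΛ Bh j (half_pos hε)
    have hev : ∀ᶠ m in atTop, ∀ j ∈ Finset.range (k+1), distC 0 (A m) a < η j := by
      rw [Filter.eventually_all_finset]
      exact fun j _ => (hlim 0).eventually_lt_const (hη j)
    obtain ⟨M, hM⟩ := eventually_atTop.1 hev
    refine ⟨M, fun m hm => ?_⟩
    rw [Real.dist_eq, sub_zero, abs_of_nonneg (HY.distC_nonneg _ _ _)]
    refine lt_of_le_of_lt (HY.distC_le (hCL m) hcL (ε := ε/2) fun j hj x => ?_) (half_lt_self hε)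
    obtain ⟨p, hp⟩ := (HY.close (hFm m) hF (hM m hm.le j (Finset.mem_range.2 (by omega)))).1
    refine hcont j F g H (Fm m) (gm m) (Hm m) (-p) hP (hPm m) (fun x => ?_) x
    rw [← abs_neg]
    have e : -(F x - Fm m x - -p) = Fm m x - F x - p := by ring
    rw [e]; exact hp x
end
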